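/- For every odd natural number n with 61 ≤ n ≤ 75000, the quantity E_n := (2n - 3) + L(n-4) - L(n) satisfies E_n ∈ {1, 2}, i.e., E_n > 0. -/

import Mathlib

open Polynomial

/-- `a n i` is the coefficient of `q^i` in `(q;q)_n = ∏_{k=1}^n (1 - q^k)` over `ℤ`. -/
noncomputable def a (n i : ℕ) : ℤ :=
  (∏ k ∈ Finset.Icc 1 n, (1 - (X : Polynomial ℤ) ^ k)).coeff i

/-- `M n` is the maximum of `|a n i|` over `0 ≤ i ≤ n(n+1)/2`. -/
noncomputable def M (n : ℕ) : ℕ :=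
  (Finset.range (n * (n + 1) / 2 + 1)).sup fun i => (a n i).natAbs

/-- `L n` is the least index `i` with `|a n i| = M n`. -/
noncomputable def L (n : ℕ) : ℕ :=
  sInf {i : ℕ | (a n i).natAbs = M n}

/-! ## Part A : certified computation -/

namespace QP

/-- the polynomial `(q;q)_n` -/
noncomputable def PP (n : ℕ) : Polynomial ℤ := ∏ k ∈ Finset.Icc 1 n, (1 - (X : Polynomial ℤ) ^ k)

/-- the degree -/
def NN (n : ℕ) : ℕ := n * (n + 1) / 2

lemma NN_succ (n : ℕ) : NN (n + 1) = NN n + (n + 1) := by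
  unfold NN
  have : (n+1)*(n+1+1) = n*(n+1) + 2*(n+1) := by ring
  rw [this]; omega

lemma PP_succ (n : ℕ) : PP (n + 1) = PP n * (1 - X ^ (n + 1)) := by
  unfold PP
  rw [Finset.prod_Icc_succ_top (by omega)]

lemma a_eq (n i : ℕ) : a n i = (PP n).coeff i := rfl

lemma a_zero_of_gt (n i : ℕ) (h : NN n < i) : a n i = 0 := by
  rw [a_eq]
  induction n generalizing i with
  | zero => simp [PP, coeff_one]; intro h0; simp [NN] at h; omega
  | succ n ih =>
    rw [PP_succ, mul_sub, mul_one, coeff_sub, coeff_mul_X_pow', NN_succ] at *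
    rw [ih i (by omega), if_pos (by omega), ih _ (by omega)]; rfl

lemma a_succ (n i : ℕ) : a (n + 1) i = a n i - if n + 1 ≤ i then a n (i - (n + 1)) else 0 := by
  simp only [a_eq]
  rw [PP_succ, mul_sub, mul_one, coeff_sub, coeff_mul_X_pow']

lemma natAbs_succ_le {n K : ℕ} (h : ∀ i, (a n i).natAbs ≤ K) (i : ℕ) :
    (a (n+1) i).natAbs ≤ 2 * K := by
  rw [a_succ]
  have h1 := h i
  have h2 := h (i - (n+1))
  split_ifs <;> omega

lemma eval_eq (n m : ℕ) (hm : NN n < m) (x : ℤ) :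
    (PP n).eval x = ∑ i ∈ Finset.range m, a n i * x ^ i := by
  apply eval_eq_sum_range'
  by_contra hc
  push Not at hc
  have h0 : PP n ≠ 0 := by
    intro h; rw [h] at hc; simp at hc; omega
  have := a_zero_of_gt n (PP n).natDegree (by omega)
  rw [a_eq] at this
  exact h0 (leadingCoeff_eq_zero.mp this)

lemma digit (x : ℕ) (j : ℕ) : ∀ (m : ℕ) (d : ℕ → ℕ), (∀ i, d i < x) → j < m →
    (∑ i ∈ Finset.range m, d i * x ^ i) / x ^ j % x = d j := by
  induction j with
  | zero =>
    intro m d hd hm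
    obtain ⟨m, rfl⟩ : ∃ k, m = k + 1 := ⟨m - 1, by omega⟩
    rw [Finset.sum_range_succ']
    have : ∑ k ∈ Finset.range m, d (k + 1) * x ^ (k + 1)
        = x * ∑ k ∈ Finset.range m, d (k + 1) * x ^ k := by
      rw [Finset.mul_sum]; apply Finset.sum_congr rfl; intros; ring
    rw [this]; simp [Nat.mod_eq_of_lt (hd 0)]
  | succ j ih =>
    intro m d hd hm
    obtain ⟨m, rfl⟩ : ∃ k, m = k + 1 := ⟨m - 1, by omega⟩
    rw [Finset.sum_range_succ']
    have : ∑ k ∈ Finset.range m, d (k + 1) * x ^ (k + 1)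
        = x * ∑ k ∈ Finset.range m, d (k + 1) * x ^ k := by
      rw [Finset.mul_sum]; apply Finset.sum_congr rfl; intros; ring
    have hx : 0 < x := lt_of_le_of_lt (Nat.zero_le _) (hd 0)
    rw [this, pow_succ', ← Nat.div_div_eq_div_mul]
    have h2 : (x * ∑ k ∈ Finset.range m, d (k + 1) * x ^ k + d 0 * x ^ 0) / x
       = ∑ k ∈ Finset.range m, d (k + 1) * x ^ k := by
      rw [pow_zero, mul_one, Nat.mul_add_div hx, Nat.div_eq_of_lt (hd 0), add_zero]
    rw [h2]
    exact ih m (fun k => d (k+1)) (fun i => hd _) (by omega)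

lemma digit_bit (B m j : ℕ) (hB : 0 < B) (d : ℕ → ℕ) (hd : ∀ i, d i < 2 ^ B) (hj : j < m) :
    (∑ i ∈ Finset.range m, d i * (2 ^ B) ^ i).testBit (B * j + (B - 1)) = (d j).testBit (B - 1) := by
  rw [← digit (2 ^ B) j m d hd hj, Nat.testBit_mod_two_pow, ← pow_mul, Nat.testBit_div_two_pow]
  simp [hB]; congr 1; omega

/-- the mask check -/
lemma mask (B m j : ℕ) (hB : 0 < B) (d : ℕ → ℕ) (hd : ∀ i, d i < 2 ^ B) (hj : j < m)
    (h : (∑ i ∈ Finset.range m, d i * (2 ^ B) ^ i) &&& (∑ i ∈ Finset.range m, 2 ^ (B-1) * (2 ^ B) ^ i)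
      = ∑ i ∈ Finset.range m, 2 ^ (B-1) * (2 ^ B) ^ i) : 2 ^ (B - 1) ≤ d j := by
  by_contra hc
  push Not at hc
  have h1 := congrArg (fun t => t.testBit (B * j + (B - 1))) h
  simp only [Nat.testBit_and] at h1
  rw [digit_bit B m j hB d hd hj, digit_bit B m j hB (fun _ => 2 ^ (B-1)) (fun _ => ?_) hj,
    Nat.testBit_lt_two_pow hc] at h1
  · simp at h1
  · exact Nat.pow_lt_pow_right (by norm_num) (by omega)

/-- sum of `2^(B i)` for `i < m` -/
def repJ (B : ℕ) : ℕ → ℕ → ℕ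
  | 0, _ => 0
  | f + 1, m =>
    let h := repJ B f (m / 2)
    let e := h + h <<< (B * (m / 2))
    bif m % 2 == 1 then e <<< B + 1 else e

lemma geo_add (y p q : ℕ) : ∑ i ∈ Finset.range (p + q), y ^ i
    = ∑ i ∈ Finset.range p, y ^ i + y ^ p * ∑ i ∈ Finset.range q, y ^ i := by
  rw [Finset.sum_range_add, Finset.mul_sum]; simp [pow_add]

lemma repJ_eq (B : ℕ) (f : ℕ) : ∀ m, m < 2 ^ f → repJ B f m = ∑ i ∈ Finset.range m, (2 ^ B) ^ i := by
  induction f with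
  | zero => intro m hm; simp at hm; subst hm; simp [repJ]
  | succ f ih =>
    intro m hm
    have h2 := ih (m/2) (by rw [pow_succ] at hm; omega)
    have he : repJ B f (m/2) + repJ B f (m/2) <<< (B * (m/2)) =
        ∑ i ∈ Finset.range (m/2 + m/2), (2 ^ B) ^ i := by
      rw [geo_add, h2, Nat.shiftLeft_eq, pow_mul]; ring
    rcases Nat.mod_two_eq_zero_or_one m with h | h
    · simp only [repJ, h]
      rw [he]; simp; congr 2; omega
    · simp only [repJ, h]
      rw [he]
      have : m = 1 + (m/2 + m/2) := by omega
      conv_rhs => rw [this, geo_add]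
      simp [Nat.shiftLeft_eq]; ring

/-- `∏_{j<2^f} (2^(B(lo+j)) - 1)` balanced -/
def prodT (B : ℕ) : ℕ → ℕ → ℕ → ℕ
  | 0, _, _ => 1
  | f + 1, lo, len =>
    bif len == 0 then 1 else bif len == 1 then 1 <<< (B * lo) - 1 else
      prodT B f lo (len / 2) * prodT B f (lo + len / 2) (len - len / 2)

lemma prodT_eq (B f : ℕ) : ∀ lo len, len ≤ 2 ^ f → prodT B (f+1) lo len =
    ∏ j ∈ Finset.range len, (2 ^ (B * (lo + j)) - 1) := by
  induction f with
  | zero =>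
    intro lo len h
    have : len = 0 ∨ len = 1 := by simp at h; omega
    rcases this with rfl | rfl <;> simp [prodT, Nat.shiftLeft_eq]
  | succ f ih =>
    intro lo len h
    rw [prodT]
    by_cases h0 : len = 0
    · simp [h0]
    by_cases h1 : len = 1
    · simp [h1, Nat.shiftLeft_eq]
    simp only [beq_iff_eq, h0, h1, Bool.cond_eq_ite, if_false]
    rw [ih _ _ (by rw [pow_succ] at h; omega), ih _ _ (by rw [pow_succ] at h; omega)]
    conv_rhs => rw [show len = len/2 + (len - len/2) by omega, Finset.prod_range_add]
    simp [add_assoc]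

/-- relation between the big integer and the polynomial (odd index) -/
def Rel (B n V : ℕ) : Prop := (V : ℤ) = (-1) ^ n * (PP n).eval (2 ^ B : ℤ)

lemma rel_start (B f n : ℕ) (h : n ≤ 2 ^ f) : Rel B n (prodT B (f+1) 1 n) := by
  unfold Rel
  rw [prodT_eq B f 1 n h]
  clear h
  induction n with
  | zero => simp [PP]
  | succ n ih =>
    rw [Finset.prod_range_succ, PP_succ, eval_mul]
    rw [Nat.cast_mul, ih, Nat.cast_sub Nat.one_le_two_pow]
    push_cast
    simp [pow_mul, add_comm 1 n]; ring

lemma rel_step {B n V : ℕ} (h : Rel B n V) : Rel B (n+1) (V <<< (B * (n+1)) - V) := by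
  unfold Rel at *
  rw [Nat.cast_sub, PP_succ, Nat.shiftLeft_eq]
  · push_cast; rw [h]; simp [pow_mul]; ring
  · rw [Nat.shiftLeft_eq]; exact Nat.le_mul_of_pos_right _ (by positivity)

lemma dig_eq (x B k : ℕ) : (Nat.land x ((2 ^ B - 1) <<< k)) >>> k = (x >>> k) % 2 ^ B := by
  have : Nat.land x ((2 ^ B - 1) <<< k) = x &&& ((2 ^ B - 1) <<< k) := rfl
  rw [this, Nat.shiftRight_and_distrib, Nat.shiftLeft_shiftRight, Nat.and_two_pow_sub_one_eq_mod]

/-- block check. `J` is the all ones number, `HJ = 2^(B-1) J`. -/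
def chk (B m J HJ e : ℕ) : List ℕ → ℕ → ℕ → ℕ → Bool
  | [], _, _, Mp => Nat.ble Mp (2 ^ e)
  | x :: xs, n, V, Mp =>
    let V1 := V <<< (B * (n + 1)) - V
    let V2 := V1 <<< (B * (n + 2)) - V1
    let l := ((n + 2) * (n + 3) / 2 - x) / 2
    let d := (Nat.land (V2 + HJ) ((2 ^ B - 1) <<< (B * l))) >>> (B * l)
    let M' := (d - 2 ^ (B - 1)) + (2 ^ (B - 1) - d)
    let W := (HJ + M' * J) - repJ B 24 l
    Nat.ble (4 * Mp + M' + 2) (2 ^ (B - 1)) && Nat.ble 1 M' && (Nat.beq (2 * l + x) ((n + 2) * (n + 3) / 2)) &&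
    (Nat.beq (Nat.land (W + V2) HJ) HJ) && (Nat.beq (Nat.land (W - V2) HJ) HJ)
     && chk B m J HJ e xs (n + 2) V2 M'

lemma sum_ite_lt (m l : ℕ) (hl : l ≤ m) (x : ℤ) :
    ∑ i ∈ Finset.range m, (if i < l then (1:ℤ) else 0) * x ^ i = ∑ i ∈ Finset.range l, x ^ i := by
  simp only [ite_mul, one_mul, zero_mul]
  rw [← Finset.sum_filter]
  congr 1
  ext i; simp; omega

lemma core {B m n V K M' l : ℕ} (hm : NN n < m) (hl : l < m) (hR : Rel B n V)
    (hK : ∀ i, (a n i).natAbs ≤ K) (hb : K + M' + 2 ≤ 2 ^ (B - 1)) (hB : 0 < B) (hM : 1 ≤ M')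
    {J HJ W : ℕ}
    (hJ : J = ∑ i ∈ Finset.range m, (2 ^ B) ^ i)
    (hHJ : HJ = J <<< (B - 1))
    (hW : W = (HJ + M' * J) - ∑ i ∈ Finset.range l, (2 ^ B) ^ i)
    (hd : M' = (((V + HJ) >>> (B * l)) % (2 ^ B) - 2 ^ (B - 1)) +
      (2 ^ (B - 1) - ((V + HJ) >>> (B * l)) % (2 ^ B)))
    (h1 : (W + V) &&& HJ = HJ) (h2 : (W - V) &&& HJ = HJ) :
    (∀ i, (a n i).natAbs ≤ M') ∧ (∀ i < l, (a n i).natAbs < M') ∧ (a n l).natAbs = M' := by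
  obtain ⟨c, hc⟩ : ∃ c : ℕ → ℤ, c = fun i => (-1) ^ n * a n i := ⟨_, rfl⟩
  have hcabs : ∀ i, (a n i).natAbs = (c i).natAbs := by
    intro i; rw [hc]; simp [Int.natAbs_mul, Int.natAbs_pow]
  have h2B : (2:ℕ) ^ B = 2 * 2 ^ (B - 1) := by
    rw [← pow_succ']; congr 1; omega
  have hV : (V : ℤ) = ∑ i ∈ Finset.range m, c i * ((2 ^ B : ℕ) : ℤ) ^ i := by
    unfold Rel at hR
    rw [hR, eval_eq n m hm, Finset.mul_sum, hc]; push_cast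
    apply Finset.sum_congr rfl; intros; ring
  have hHJ' : HJ = ∑ i ∈ Finset.range m, 2 ^ (B-1) * (2 ^ B) ^ i := by
    rw [hHJ, Nat.shiftLeft_eq, hJ, mul_comm, Finset.mul_sum]
  have hW' : (W : ℤ) = ∑ i ∈ Finset.range m,
      ((2 ^ (B - 1) : ℕ) + (M' : ℤ) - if i < l then (1:ℤ) else 0) * ((2 ^ B : ℕ) : ℤ) ^ i := by
    have hle : ∑ i ∈ Finset.range l, (2 ^ B) ^ i ≤ HJ + M' * J := by
      calc ∑ i ∈ Finset.range l, (2 ^ B) ^ i ≤ J := by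
            rw [hJ]; apply Finset.sum_le_sum_of_subset; intro i; simp; omega
        _ ≤ M' * J := Nat.le_mul_of_pos_left _ hM
        _ ≤ _ := Nat.le_add_left _ _
    rw [hW, Nat.cast_sub hle, hHJ', hJ]
    simp only [sub_mul, Finset.sum_sub_distrib, sum_ite_lt m l hl.le, add_mul, Finset.sum_add_distrib]
    push_cast
    simp only [Finset.mul_sum]
  have hcK : ∀ i, (c i).natAbs ≤ K := fun i => by rw [← hcabs]; exact hK i
  -- three digit sequences
  have e1 : W + V = ∑ i ∈ Finset.range m,
      (c i + ((2 ^ (B - 1) : ℕ) + (M' : ℤ) - if i < l then (1:ℤ) else 0)).toNat * (2 ^ B) ^ i := by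
    rw [← Nat.cast_inj (R := ℤ), Nat.cast_add, hW', hV, Nat.cast_sum, ← Finset.sum_add_distrib]
    apply Finset.sum_congr rfl
    intro i _
    have := hcK i
    rw [Nat.cast_mul, Int.toNat_of_nonneg,
      show (((2 ^ B) ^ i : ℕ) : ℤ) = ((2 ^ B : ℕ) : ℤ) ^ i from Nat.cast_pow _ _]
    · ring
    · split_ifs <;> omega
  have e2 : W - V = ∑ i ∈ Finset.range m,
      (((2 ^ (B - 1) : ℕ) + (M' : ℤ) - if i < l then (1:ℤ) else 0) - c i).toNat * (2 ^ B) ^ i := by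
    have : W = (∑ i ∈ Finset.range m,
      (((2 ^ (B - 1) : ℕ) + (M' : ℤ) - if i < l then (1:ℤ) else 0) - c i).toNat * (2 ^ B) ^ i) + V := by
      rw [← Nat.cast_inj (R := ℤ), Nat.cast_add, hW', hV, Nat.cast_sum, ← Finset.sum_add_distrib]
      apply Finset.sum_congr rfl
      intro i _
      have := hcK i
      rw [Nat.cast_mul, Int.toNat_of_nonneg,
      show (((2 ^ B) ^ i : ℕ) : ℤ) = ((2 ^ B : ℕ) : ℤ) ^ i from Nat.cast_pow _ _]
      · ring
      · split_ifs <;> omega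
    omega
  have e3 : V + HJ = ∑ i ∈ Finset.range m, (c i + (2 ^ (B - 1) : ℕ)).toNat * (2 ^ B) ^ i := by
    rw [← Nat.cast_inj (R := ℤ), Nat.cast_add, hHJ', hV, Nat.cast_sum, Nat.cast_sum,
      ← Finset.sum_add_distrib]
    apply Finset.sum_congr rfl
    intro i _
    have := hcK i
    rw [Nat.cast_mul, Nat.cast_mul, Int.toNat_of_nonneg,
      show (((2 ^ B) ^ i : ℕ) : ℤ) = ((2 ^ B : ℕ) : ℤ) ^ i from Nat.cast_pow _ _]
    · ring
    · omega
  have e3' : ((V + HJ) >>> (B * l)) % (2 ^ B) = (c l + (2 ^ (B - 1) : ℕ)).toNat := by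
    rw [Nat.shiftRight_eq_div_pow, pow_mul, e3]
    apply digit (2 ^ B) l m (fun i => (c i + (2 ^ (B - 1) : ℕ)).toNat) _ hl
    intro i
    have := hcK i
    omega
  rw [hHJ', e1] at h1
  rw [hHJ', e2] at h2
  have k1 : ∀ i < m, -(M' : ℤ) + (if i < l then (1:ℤ) else 0) ≤ c i := by
    intro i hi
    have := mask B m i hB _ (fun i => ?_) hi h1
    · have hk := hcK i
      split_ifs at * <;> omega
    · have hk := hcK i
      split_ifs <;> omega
  have k2 : ∀ i < m, c i ≤ M' - (if i < l then (1:ℤ) else 0) := by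
    intro i hi
    have := mask B m i hB _ (fun i => ?_) hi h2
    · have hk := hcK i
      split_ifs at * <;> omega
    · have hk := hcK i
      split_ifs <;> omega
  refine ⟨?_, ?_, ?_⟩
  · intro i
    by_cases hi : i < m
    · have := k1 i hi
      have := k2 i hi
      rw [hcabs]
      split_ifs at * <;> omega
    · rw [a_zero_of_gt n i (by omega)]; simp
  · intro i hi
    have := k1 i (by omega)
    have := k2 i (by omega)
    rw [if_pos hi] at *
    rw [hcabs]; omega
  · rw [hcabs]
    rw [e3'] at hd
    have := hcK l
    omega

lemma L_of {n M' l : ℕ} (hl : l ≤ NN n) (h1 : ∀ i, (a n i).natAbs ≤ M')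
    (h2 : ∀ i < l, (a n i).natAbs < M') (h3 : (a n l).natAbs = M') : L n = l := by
  have hM : M n = M' := by
    apply le_antisymm
    · apply Finset.sup_le; intro i _; exact h1 i
    · rw [← h3]; unfold M
      apply Finset.le_sup (f := fun i => (a n i).natAbs)
      rw [Finset.mem_range]; unfold NN at hl; omega
  unfold L
  rw [hM]
  apply le_antisymm
  · exact Nat.sInf_le h3
  · by_contra hc
    push Not at hc
    have : sInf {i : ℕ | (a n i).natAbs = M'} ∈ {i : ℕ | (a n i).natAbs = M'} := Nat.sInf_mem ⟨l, h3⟩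
    have h4 := h2 _ hc
    simp only [Set.mem_ofPred_eq] at this
    omega

/-- the list `xs` has the right values `X_(n+2), X_(n+4), ...` -/
def GoodL : List ℕ → ℕ → Prop
  | [], _ => True
  | x :: xs, n => 2 * L (n + 2) + x = NN (n + 2) ∧ GoodL xs (n + 2)

lemma chk_sound {B m J HJ e : ℕ} (hB : 0 < B) (hm24 : m < 2 ^ 24)
    (hJ : J = ∑ i ∈ Finset.range m, (2 ^ B) ^ i)
    (hHJ : HJ = J <<< (B - 1)) : ∀ (xs : List ℕ) (n V Mp : ℕ), NN (n + 2 * xs.length) < m →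
    Rel B n V → (∀ i, (a n i).natAbs ≤ Mp) → chk B m J HJ e xs n V Mp = true →
    GoodL xs n ∧ ∀ i, (a (n + 2 * xs.length) i).natAbs ≤ 2 ^ e := by
  intro xs
  induction xs with
  | nil =>
    intro n V Mp hm hR hK h
    simp only [chk, Nat.ble_eq] at h
    exact ⟨trivial, fun i => (hK i).trans h⟩
  | cons x xs ih =>
    intro n V Mp hm hR hK h
    simp only [chk, dig_eq, Bool.and_eq_true, Nat.ble_eq, Nat.beq_eq] at h
    obtain ⟨⟨⟨⟨⟨c1, c2⟩, c3⟩, c4⟩, c5⟩, c6⟩ := h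
    have hR2 := rel_step (rel_step hR)
    have hNN : NN (n + 2) = (n + 2) * (n + 3) / 2 := rfl
    have hNN1 : NN (n + 1 + 1) = (n + 2) * (n + 3) / 2 := rfl
    have hmono : NN (n + 2) ≤ NN (n + 2 * (xs.length + 1)) := by
      unfold NN; apply Nat.div_le_div_right; gcongr <;> omega
    simp only [List.length_cons] at hm
    have hK2 : ∀ i, (a (n + 2) i).natAbs ≤ 4 * Mp := by
      intro i
      have := natAbs_succ_le (natAbs_succ_le hK) i
      rw [show 4 * Mp = 2 * (2 * Mp) by ring]; exact this
    obtain ⟨q1, q2, q3⟩ := core (m := m) (by omega) (by omega) hR2 hK2 c1 hB c2 hJ hHJ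
      (by rw [← repJ_eq B 24 _ (by omega)]) rfl c4 c5
    have hL := L_of (by omega) q1 q2 q3
    obtain ⟨g1, g2⟩ := ih (n + 2) _ _ (by convert hm using 2; ring) hR2 q1 c6
    refine ⟨⟨?_, g1⟩, ?_⟩
    · rw [hL, hNN]; exact c3
    · convert g2 using 4; simp; ring

/-- block check with everything computed -/
def block (B e0 e n : ℕ) (xs : List ℕ) : Bool :=
  let m := NN (n + 2 * xs.length) + 1
  let J := repJ B 24 m
  Nat.ble 1 B && Nat.ble (m + 1) (2 ^ 24) && Nat.ble n (2 ^ 12) && chk B m J (J <<< (B - 1)) e xs n (prodT B 13 1 n) (2 ^ e0)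

lemma block_sound {B e0 e n : ℕ} {xs : List ℕ} (h : block B e0 e n xs = true)
    (h0 : ∀ i, (a n i).natAbs ≤ 2 ^ e0) :
    GoodL xs n ∧ ∀ i, (a (n + 2 * xs.length) i).natAbs ≤ 2 ^ e := by
  simp only [block, Bool.and_eq_true, Nat.ble_eq] at h
  obtain ⟨⟨⟨h1, h2⟩, h3⟩, h4⟩ := h
  exact chk_sound (by omega) (by omega) (repJ_eq B 24 _ (by omega)) rfl xs n _ _ (by omega)
    (rel_start B 12 n h3) h0 h4

end QP

section
/-! ## Part B : Fourier -/
namespace QP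
open Real intervalIntegral

/-- the product of sines -/
noncomputable def S (n : ℕ) (x : ℝ) : ℝ := ∏ k ∈ Finset.Icc 1 n, (2 * sin (k * x))

/-- sine transform -/
noncomputable def CC (n : ℕ) (x : ℝ) : ℝ := ∫ t in (0:ℝ)..(π/2), S n t * sin (x * t)

/-- its half difference -/
noncomputable def GG (n : ℕ) (y : ℝ) : ℝ := ∫ t in (0:ℝ)..(π/2), S n t * sin t * cos (y * t)

lemma S_succ (n : ℕ) (x : ℝ) : S (n+1) x = S n x * (2 * sin ((n+1 : ℕ) * x)) := by
  unfold S; rw [Finset.prod_Icc_succ_top (by omega)]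

lemma S_cont (n : ℕ) : Continuous (S n) := by
  unfold S; fun_prop

lemma CC_zero (n : ℕ) : CC n 0 = 0 := by simp [CC]
lemma CC_one (n : ℕ) : CC n 1 = GG n 0 := by simp [CC, GG]
lemma CC_neg (n : ℕ) (x : ℝ) : CC n (-x) = - CC n x := by
  unfold CC; rw [← intervalIntegral.integral_neg]; congr 1; ext t
  rw [neg_mul, sin_neg]; ring
lemma CC_step (n : ℕ) (x : ℝ) : CC n (x+2) - CC n x = 2 * GG n (x+1) := by
  unfold CC GG
  have h := S_cont n
  rw [← intervalIntegral.integral_sub, ← intervalIntegral.integral_const_mul]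
  · congr 1; ext t
    have h1 : (x+2)*t = (x+1)*t + t := by ring
    have h2 : x*t = (x+1)*t - t := by ring
    rw [h1, h2, sin_add, sin_sub]; ring
  · apply Continuous.intervalIntegrable; fun_prop
  · apply Continuous.intervalIntegrable; fun_prop

lemma exp_prod (n : ℕ) (x : ℝ) :
    ∏ k ∈ Finset.Icc 1 n, (1 - Complex.exp (2 * x * Complex.I) ^ k) =
      (-Complex.I) ^ n * (S n x : ℂ) * Complex.exp ((NN n : ℕ) * x * Complex.I) := by
  induction n with
  | zero => simp [S, NN]
  | succ n ih =>
    rw [Finset.prod_Icc_succ_top (by omega), ih, S_succ, NN_succ, ← Complex.exp_nat_mul]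
    have h1 : (1 - Complex.exp (((n+1 : ℕ):ℂ) * (2 * x * Complex.I))) =
        -Complex.I * ((2 * sin ((n+1 : ℕ) * x) : ℝ) : ℂ) * Complex.exp (((n+1 : ℕ):ℂ) * x * Complex.I) := by
      push_cast
      rw [Complex.sin]
      have e1 : Complex.exp (((n:ℂ)+1) * (2 * x * Complex.I)) =
        Complex.exp (((n:ℂ)+1) * x * Complex.I) * Complex.exp (((n:ℂ)+1) * x * Complex.I) := by
        rw [← Complex.exp_add]; ring_nf
      have e2 : Complex.exp (-(((n:ℂ)+1) * x) * Complex.I) * Complex.exp (((n:ℂ)+1) * x * Complex.I) = 1 := by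
        rw [← Complex.exp_add]; ring_nf; simp
      rw [e1]
      have := Complex.I_mul_I
      linear_combination (-1) * e2 + (-1) *(Complex.exp (-(((n:ℂ)+1) * x) * Complex.I) - Complex.exp (((n:ℂ)+1) * x * Complex.I)) * Complex.exp (((n:ℂ)+1) * x * Complex.I) * (-this)
    rw [h1]
    have e3 : Complex.exp (((NN n + (n+1) : ℕ):ℂ) * x * Complex.I) =
      Complex.exp ((NN n : ℂ) * x * Complex.I) * Complex.exp (((n+1 : ℕ):ℂ) * x * Complex.I) := by
      rw [← Complex.exp_add]; push_cast; ring_nf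
    rw [e3, pow_succ]; push_cast; ring

lemma exp_sum (n : ℕ) (x : ℝ) : ∏ k ∈ Finset.Icc 1 n, (1 - Complex.exp (2 * x * Complex.I) ^ k) =
    ∑ j ∈ Finset.range (NN n + 1), (a n j : ℂ) * Complex.exp (2 * x * Complex.I) ^ j := by
  have h : ∏ k ∈ Finset.Icc 1 n, (1 - Complex.exp (2 * x * Complex.I) ^ k) =
    (PP n).eval₂ (Int.castRingHom ℂ) (Complex.exp (2 * x * Complex.I)) := by
    unfold PP; rw [Polynomial.eval₂_finsetProd]; simp
  rw [h, Polynomial.eval₂_eq_sum_range' (n := NN n + 1)]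
  · rfl
  · rw [Nat.lt_succ_iff, Polynomial.natDegree_le_iff_coeff_eq_zero]
    intro N hN; exact a_zero_of_gt n N hN

lemma cos_int (m : ℤ) : ∫ t in (0:ℝ)..(π/2), cos (2 * m * t) = if m = 0 then π/2 else 0 := by
  split_ifs with h
  · subst h; simp
  · have h2 : (2 * (m:ℝ)) ≠ 0 := by positivity
    rw [intervalIntegral.integral_comp_mul_left (fun t => cos t) h2, integral_cos]
    have : 2 * (m:ℝ) * (π/2) = m * π := by ring
    rw [this, sin_int_mul_pi]; simp

lemma fourier (n : ℕ) (hn : Odd n) : ∃ e : ℝ, (e = 1 ∨ e = -1) ∧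
    ∀ j : ℕ, (π/2) * (a n j : ℝ) = e * CC n ((NN n : ℝ) - 2 * j) := by
  obtain ⟨r, hr⟩ := hn
  refine ⟨(-1)^r, neg_one_pow_eq_or ℝ r, fun l => ?_⟩
  have key : ∀ x : ℝ, ∑ j ∈ Finset.range (NN n + 1), (a n j : ℝ) * cos (2 * ((j : ℤ) - (l:ℤ) : ℤ) * x) =
      (-1)^r * (S n x * sin (((NN n : ℝ) - 2 * l) * x)) := by
    intro x
    have h := (exp_sum n x).symm.trans (exp_prod n x)
    have h2 := congrArg (fun z => (z * Complex.exp ((-(2 * l * x) : ℝ) * Complex.I)).re) h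
    simp only [Finset.sum_mul, Complex.re_sum] at h2
    have L1 : ∀ j : ℕ, ((a n j : ℂ) * Complex.exp (2 * x * Complex.I) ^ j * Complex.exp ((-(2 * l * x) : ℝ) * Complex.I)).re
       = (a n j : ℝ) * cos (2 * ((j : ℤ) - (l:ℤ) : ℤ) * x) := by
      intro j
      rw [← Complex.exp_nat_mul, mul_assoc, ← Complex.exp_add]
      have : (j:ℂ) * (2 * x * Complex.I) + ((-(2 * l * x) : ℝ):ℂ) * Complex.I = ((2 * ((j : ℤ) - (l:ℤ) : ℤ) * x : ℝ) : ℂ) * Complex.I := by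
        push_cast; ring
      have e0 : (a n j : ℂ) = (((a n j : ℝ)) : ℂ) := by push_cast; rfl
      rw [this, e0, Complex.re_ofReal_mul, Complex.exp_ofReal_mul_I_re]
    rw [Finset.sum_congr rfl (fun j _ => L1 j)] at h2
    rw [h2]
    have h3 : (-Complex.I) ^ n = ((-1:ℝ)^r : ℝ) * (-Complex.I) := by
      rw [hr, pow_succ, pow_mul]; push_cast; congr 1; congr 1; simp
    rw [h3, mul_assoc, ← Complex.exp_add]
    have : ((NN n : ℕ):ℂ) * x * Complex.I + ((-(2 * l * x) : ℝ):ℂ) * Complex.I = ((((NN n : ℝ) - 2 * l) * x : ℝ) : ℂ) * Complex.I := by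
        push_cast; ring
    rw [this, Complex.exp_mul_I, ← Complex.ofReal_cos, ← Complex.ofReal_sin]
    have : ((((-1:ℝ)^r : ℝ) : ℂ) * (-Complex.I) * (S n x : ℂ) * (((cos (((NN n : ℝ) - 2 * l) * x) : ℝ):ℂ) + ((sin (((NN n : ℝ) - 2 * l) * x):ℝ):ℂ) * Complex.I)) =
      (((-1)^r * (S n x * sin (((NN n : ℝ) - 2 * l) * x)) : ℝ) : ℂ) + ((-((-1)^r * (S n x * cos (((NN n : ℝ) - 2 * l) * x))) : ℝ) : ℂ) * Complex.I := by
      push_cast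
      have hI := Complex.I_mul_I
      linear_combination (-(-1:ℂ)^r * S n x * Complex.sin (((NN n : ℂ) - 2 * l) * x)) * hI
    rw [this, Complex.add_re, Complex.ofReal_re, Complex.re_ofReal_mul, Complex.I_re, mul_zero, add_zero]
  have h1 : ∫ t in (0:ℝ)..(π/2), ∑ j ∈ Finset.range (NN n + 1), (a n j : ℝ) * cos (2 * ((j : ℤ) - (l:ℤ) : ℤ) * t)
     = (-1)^r * CC n ((NN n : ℝ) - 2 * l) := by
    unfold CC
    rw [← intervalIntegral.integral_const_mul]
    congr 1; ext t; exact key t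
  rw [← h1, intervalIntegral.integral_finsetSum]
  · simp_rw [intervalIntegral.integral_const_mul, cos_int]
    by_cases hl : l ≤ NN n
    · rw [Finset.sum_eq_single l]
      · rw [if_pos (by ring)]; ring
      · intro b _ hb; rw [if_neg (by omega), mul_zero]
      · intro hb; simp at hb; omega
    · rw [a_zero_of_gt n l (by omega)]
      rw [Finset.sum_eq_zero]; · simp
      intro b hb; rw [if_neg, mul_zero]
      simp at hb; omega
  · intro i _; apply Continuous.intervalIntegrable; fun_prop

lemma M_ge (n i : ℕ) : (a n i).natAbs ≤ M n := by
  by_cases h : NN n < i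
  · rw [a_zero_of_gt n i h]; simp
  · exact Finset.le_sup (f := fun i => (a n i).natAbs) (Finset.mem_range.2 (by unfold NN at h; omega))

lemma L_mem (n : ℕ) : (a n (L n)).natAbs = M n ∧ L n ≤ NN n := by
  obtain ⟨i, hi, h⟩ := Finset.exists_mem_eq_sup (Finset.range (n * (n + 1) / 2 + 1)) ⟨0, by simp⟩ (fun i => (a n i).natAbs)
  have hh : (a n i).natAbs = M n := h.symm
  have h1 : (a n (L n)).natAbs = M n := Nat.sInf_mem (s := {i : ℕ | (a n i).natAbs = M n}) ⟨i, hh⟩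
  have h2 : L n ≤ i := Nat.sInf_le hh
  refine ⟨h1, h2.trans ?_⟩
  simp at hi; unfold NN; omega

lemma L_lt (n i : ℕ) (h : i < L n) : (a n i).natAbs < M n := by
  refine lt_of_le_of_ne (M_ge n i) fun hc => ?_
  exact absurd (Nat.sInf_le (s := {i : ℕ | (a n i).natAbs = M n}) hc) (by unfold L at h; omega)

lemma locate (n : ℕ) (hn : Odd n) (hn4 : 100 ≤ n) (Ylo Yhi : ℝ) (hYn : Ylo ≤ n)
    (h1 : ∀ y, 0 ≤ y → y ≤ Ylo → 0 < GG n y)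
    (h2 : ∀ y, Yhi ≤ y → y ≤ 1.35 * n → GG n y < 0)
    (h3 : ∃ j : ℕ, ∀ x : ℝ, 1.3 * n ≤ x → |CC n x| < CC n ((NN n : ℝ) - 2 * j)) :
    Ylo - 1 < (NN n : ℝ) - 2 * L n ∧ (NN n : ℝ) - 2 * L n ≤ Yhi + 1 := by
  obtain ⟨e, he, hF⟩ := fourier n hn
  have hpi := Real.pi_pos
  have habs : ∀ j : ℕ, ((a n j).natAbs : ℝ) * (π/2) = |CC n ((NN n : ℝ) - 2 * j)| := by
    intro j
    have := congrArg abs (hF j)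
    rw [abs_mul, abs_mul, abs_of_pos (by positivity : 0 < π/2)] at this
    have e1 : |e| = 1 := by rcases he with h | h <;> simp [h]
    rw [e1, one_mul] at this
    rw [← this, mul_comm, Nat.cast_natAbs]; push_cast; rfl
  obtain ⟨hM, hLN⟩ := L_mem n
  have hmax : ∀ j : ℕ, |CC n ((NN n : ℝ) - 2 * j)| ≤ |CC n ((NN n : ℝ) - 2 * L n)| := by
    intro j
    rw [← habs, ← habs]
    have : ((a n j).natAbs : ℝ) ≤ (a n (L n)).natAbs := by rw [hM]; exact_mod_cast M_ge n j
    gcongr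
  have hlt : ∀ j : ℕ, j < L n → |CC n ((NN n : ℝ) - 2 * j)| < |CC n ((NN n : ℝ) - 2 * L n)| := by
    intro j hj
    rw [← habs, ← habs]
    have : ((a n j).natAbs : ℝ) < (a n (L n)).natAbs := by rw [hM]; exact_mod_cast L_lt n j hj
    gcongr
  have hX0 : 2 * L n ≤ NN n := by
    by_contra hc
    have := hlt (NN n - L n) (by omega)
    rw [Nat.cast_sub hLN, show (NN n : ℝ) - 2 * ((NN n : ℝ) - L n) = -((NN n : ℝ) - 2 * L n) by ring, CC_neg, abs_neg] at this
    exact lt_irrefl _ this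
  obtain ⟨X, hX⟩ : ∃ X : ℕ, NN n = 2 * L n + X := ⟨NN n - 2 * L n, by omega⟩
  have hXr : (NN n : ℝ) - 2 * L n = X := by rw [hX]; push_cast; ring
  simp only [hXr] at hmax hlt ⊢
  have hNn : n ≤ NN n := by
    unfold NN; rw [Nat.le_div_iff_mul_le (by norm_num)]; nlinarith
  constructor
  · by_contra hc
    push Not at hc
    have hpos : ∀ x : ℕ, (x:ℝ) ≤ Ylo - 1 → 0 ≤ CC n x := by
      intro x
      induction x using Nat.strong_induction_on with
      | _ x ih =>
        intro hx
        rcases x with _ | _ | x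
        · simp [CC_zero]
        · have := CC_one n
          have h := h1 0 le_rfl (by push_cast at hx; linarith)
          simp only [zero_add, Nat.cast_one]; linarith
        · have h := ih x (by omega) (by push_cast at hx ⊢; linarith)
          have hh := CC_step n x
          have := h1 (x+1) (by positivity) (by push_cast at hx; linarith)
          push_cast
          have e : (x:ℝ) + 1 + 1 = x + 2 := by ring
          rw [e]; linarith
    have hL1 : 1 ≤ L n := by
      by_contra h0
      have : (NN n : ℝ) = X := by rw [hX]; have : L n = 0 := by omega
                                  rw [this]; simp
      have : (n:ℝ) ≤ NN n := by exact_mod_cast hNn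
      linarith
    have q1 := hlt (L n - 1) (by omega)
    rw [Nat.cast_sub hL1, show (NN n : ℝ) - 2 * ((L n:ℝ) - (1:ℕ)) = X + 2 by rw [← hXr]; push_cast; ring] at q1
    have q2 := CC_step n X
    have q3 := h1 (X+1) (by positivity) (by linarith)
    have q4 := hpos X hc
    rw [abs_of_nonneg q4, abs_of_nonneg (by linarith)] at q1
    linarith
  · by_contra hc
    push Not at hc
    obtain ⟨j, hj⟩ := h3
    have hjm := (le_abs_self _).trans (hmax j)
    have hn' : (100:ℝ) ≤ n := by exact_mod_cast hn4
    by_cases hb : 1.3 * (n:ℝ) ≤ X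
    · have := hj X hb; linarith
    push Not at hb
    have q2 := CC_step n (X - 2)
    have q3 := h2 (X-1) (by linarith) (by linarith)
    rw [show (X:ℝ) - 2 + 2 = X by ring, show (X:ℝ) - 2 + 1 = X - 1 by ring] at q2
    by_cases hs : 0 ≤ CC n X
    · have q1 := hmax (L n + 1)
      rw [show (NN n : ℝ) - 2 * ((L n + 1 : ℕ):ℝ) = X - 2 by rw [← hXr]; push_cast; ring] at q1
      rw [abs_of_nonneg hs, abs_of_nonneg (by linarith)] at q1
      linarith
    · push Not at hs
      have hneg : ∀ k : ℕ, (X:ℝ) + 2 * k ≤ 1.35 * n → CC n (X + 2 * k) ≤ CC n X := by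
        intro k
        induction k with
        | zero => intro _; simp
        | succ k ih =>
          intro hk
          push_cast at hk ⊢
          have := ih (by linarith)
          have w1 := CC_step n (X + 2 * k)
          have w2 := h2 (X + 2 * k + 1) (by have : (0:ℝ) ≤ k := by positivity
                                            linarith) (by linarith)
          rw [show (X:ℝ) + 2 * (k+1) = X + 2 * k + 2 by ring]
          linarith
      obtain ⟨k, hk1, hk2⟩ : ∃ k : ℕ, 1.3 * (n:ℝ) ≤ X + 2 * k ∧ (X:ℝ) + 2 * k ≤ 1.3 * n + 2 := by
        refine ⟨⌈(1.3 * (n:ℝ) - X)/2⌉₊, ?_, ?_⟩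
        · have := Nat.le_ceil ((1.3 * (n:ℝ) - X)/2); linarith
        · have := Nat.ceil_lt_add_one (a := (1.3 * (n:ℝ) - X)/2) (by linarith); linarith
      have w1 := hneg k (by linarith)
      have w2 := hj _ hk1
      have w3 := neg_abs_le (CC n (X + 2 * k))
      rw [abs_of_neg hs] at hjm
      linarith
end QP
end

section
/-! ## Part D : the main lobe -/
namespace QP
open Real intervalIntegral Set

/-- `x cot x` -/
noncomputable def c (x : ℝ) : ℝ := cos x / sinc x
/-- first derivative -/
noncomputable def c1 (x : ℝ) : ℝ := cos x / sin x - x / sin x ^ 2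
/-- second derivative -/
noncomputable def c2 (x : ℝ) : ℝ := 2 * (x * cos x - sin x) / sin x ^ 3

lemma c_eq {x : ℝ} (h : 0 < x) : c x = x * cos x / sin x := by
  unfold c; rw [sinc_of_ne_zero h.ne']
  field_simp

lemma c_zero : c 0 = 1 := by simp [c]

lemma sinpos {x : ℝ} (h : x ∈ Ioo 0 π) : 0 < sin x := sin_pos_of_pos_of_lt_pi h.1 h.2

lemma sinc_pos' {x : ℝ} (h : x ∈ Ico 0 π) : 0 < sinc x := by
  rcases h.1.eq_or_lt with h0 | h0
  · rw [← h0]; simp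
  · rw [sinc_of_ne_zero h0.ne']; have := sinpos ⟨h0, h.2⟩; positivity

lemma c_cont : ContinuousOn c (Ico 0 π) := by
  unfold c
  exact continuous_cos.continuousOn.div continuous_sinc.continuousOn fun x hx => (sinc_pos' hx).ne'

lemma c_deriv {x : ℝ} (h : x ∈ Ioo 0 π) : HasDerivAt c (c1 x) x := by
  have hs := (sinpos h).ne'
  have h1 : HasDerivAt (fun x => x * cos x / sin x) (c1 x) x := by
    refine HasDerivAt.congr_deriv (((hasDerivAt_id x).mul (hasDerivAt_cos x)).div (hasDerivAt_sin x) hs) ?_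
    unfold c1; simp only [id]; field_simp
    have := sin_sq_add_cos_sq x
    simp only [Pi.mul_apply, id]
    linear_combination (-x) * this
  refine h1.congr_of_eventuallyEq ?_
  filter_upwards [lt_mem_nhds h.1] with y hy using c_eq hy

lemma c1_deriv {x : ℝ} (h : x ∈ Ioo 0 π) : HasDerivAt c1 (c2 x) x := by
  have hs := (sinpos h).ne'
  refine HasDerivAt.congr_deriv (((hasDerivAt_cos x).div (hasDerivAt_sin x) hs).sub ((hasDerivAt_id x).div ((hasDerivAt_sin x).pow 2) (pow_ne_zero 2 hs))) ?_
  unfold c2; simp only [id]; field_simp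
  have := sin_sq_add_cos_sq x
  simp
  linear_combination (-sin x ^ 2) * this

/-- derivative of `c2` -/
noncomputable def c3 (x : ℝ) : ℝ := -(x * (2 + cos (2*x)) - 3/2 * sin (2*x)) * 2 / sin x ^ 4

lemma c2_deriv {x : ℝ} (h : x ∈ Ioo 0 π) : HasDerivAt c2 (c3 x) x := by
  have hs := (sinpos h).ne'
  refine HasDerivAt.congr_deriv (((((hasDerivAt_id x).mul (hasDerivAt_cos x)).sub (hasDerivAt_sin x)).const_mul 2).div ((hasDerivAt_sin x).pow 3) (pow_ne_zero 3 hs)) ?_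
  unfold c3; simp only [id]; rw [cos_two_mul, sin_two_mul]; field_simp
  have := sin_sq_add_cos_sq x
  simp
  linear_combination (-sin x ^ 2 * x) * this

lemma mono_pos {f f' : ℝ → ℝ} {b : ℝ} (hd : ∀ x, HasDerivAt f (f' x) x) (h0 : f 0 = 0)
    (hp : ∀ x ∈ Ioo 0 b, 0 < f' x) {x : ℝ} (hx : x ∈ Ioo 0 b) : 0 < f x := by
  have : StrictMonoOn f (Icc 0 x) := by
    apply strictMonoOn_of_deriv_pos (convex_Icc 0 x)
    · exact fun y _ => (hd y).continuousAt.continuousWithinAt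
    · intro y hy; rw [interior_Icc] at hy; rw [(hd y).deriv]; exact hp y ⟨hy.1, hy.2.trans hx.2⟩
  rw [← h0]; exact this ⟨le_rfl, hx.1.le⟩ ⟨hx.1.le, le_rfl⟩ hx.1

lemma sub_pos_aux {x : ℝ} (h : x ∈ Ioo 0 π) : 0 < sin x - x * cos x := by
  refine mono_pos (f := fun x => sin x - x * cos x) (f' := fun x => x * sin x) (b := π) ?_ (by simp) ?_ h
  · intro x; refine HasDerivAt.congr_deriv ((hasDerivAt_sin x).sub ((hasDerivAt_id x).mul (hasDerivAt_cos x))) ?_; simp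
  · intro x hx; exact mul_pos hx.1 (sinpos hx)

lemma c3_neg {x : ℝ} (h : x ∈ Ioo 0 π) : c3 x < 0 := by
  have : 0 < x * (2 + cos (2*x)) - 3/2 * sin (2*x) := by
    refine mono_pos (f := fun x => x * (2 + cos (2*x)) - 3/2 * sin (2*x)) (f' := fun x => 4 * sin x * (sin x - x * cos x)) (b := π) ?_ (by simp) ?_ h
    · intro x
      have h2 : HasDerivAt (fun x : ℝ => 2 * x) 2 x := by simpa using (hasDerivAt_id x).const_mul 2
      refine HasDerivAt.congr_deriv (((hasDerivAt_id x).mul ((h2.cos).const_add 2)).sub ((h2.sin).const_mul (3/2))) ?_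
      simp only [id]; rw [cos_two_mul, sin_two_mul]
      have := sin_sq_add_cos_sq x
      linear_combination (-4) * this
    · intro x hx; have := sub_pos_aux hx; have := sinpos hx; positivity
  unfold c3
  have hs := sinpos h
  rw [div_neg_iff]; right; constructor
  · linarith
  · positivity

lemma c2_neg {x : ℝ} (h : x ∈ Ioo 0 π) : c2 x < 0 := by
  unfold c2; have hs := sinpos h; have := sub_pos_aux h
  rw [div_neg_iff]; right; constructor
  · linarith
  · positivity

lemma c1_neg {x : ℝ} (h : x ∈ Ioo 0 π) : c1 x < 0 := by
  unfold c1; have hs := sinpos h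
  have h2 : sin (2*x) < 2 * x := sin_lt (by linarith [h.1])
  rw [sin_two_mul] at h2
  rw [show cos x / sin x - x / sin x ^ 2 = (sin x * cos x - x)/sin x ^ 2 by field_simp]
  rw [div_neg_iff]; right; constructor
  · linarith
  · positivity

lemma anti_of {f f' : ℝ → ℝ} {s : Set ℝ} (hs : Convex ℝ s) (hc : ContinuousOn f s)
    (hd : ∀ x ∈ interior s, HasDerivAt f (f' x) x)
    (hp : ∀ x ∈ interior s, f' x ≤ 0) : AntitoneOn f s := by
  apply antitoneOn_of_deriv_nonpos hs hc
  · intro x hx; exact (hd x hx).differentiableAt.differentiableWithinAt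
  · intro x hx; rw [(hd x hx).deriv]; exact hp x hx

lemma mono_of {f f' : ℝ → ℝ} {s : Set ℝ} (hs : Convex ℝ s) (hc : ContinuousOn f s)
    (hd : ∀ x ∈ interior s, HasDerivAt f (f' x) x)
    (hp : ∀ x ∈ interior s, 0 ≤ f' x) : MonotoneOn f s := by
  apply monotoneOn_of_deriv_nonneg hs hc
  · intro x hx; exact (hd x hx).differentiableAt.differentiableWithinAt
  · intro x hx; rw [(hd x hx).deriv]; exact hp x hx

lemma c_anti : AntitoneOn c (Ico 0 π) := by
  apply anti_of (convex_Ico 0 π) c_cont (f' := c1) <;> rw [interior_Ico]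
  · exact fun x hx => c_deriv hx
  · exact fun x hx => (c1_neg hx).le

lemma c1_anti : AntitoneOn c1 (Ioo 0 π) := by
  apply anti_of (convex_Ioo 0 π) (fun x hx => (c1_deriv hx).continuousAt.continuousWithinAt) (f' := c2) <;> rw [interior_Ioo]
  · exact fun x hx => c1_deriv hx
  · exact fun x hx => (c2_neg hx).le

lemma c2_anti : AntitoneOn c2 (Ioo 0 π) := by
  apply anti_of (convex_Ioo 0 π) (fun x hx => (c2_deriv hx).continuousAt.continuousWithinAt) (f' := c3) <;> rw [interior_Ioo]
  · exact fun x hx => c2_deriv hx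
  · exact fun x hx => (c3_neg hx).le

lemma c_conc : ConcaveOn ℝ (Ico 0 π) c := by
  apply AntitoneOn.concaveOn_of_deriv (convex_Ico 0 π) c_cont
  · rw [interior_Ico]; exact fun x hx => (c_deriv hx).differentiableAt.differentiableWithinAt
  · rw [interior_Ico]; intro x hx y hy hxy
    rw [(c_deriv hx).deriv, (c_deriv hy).deriv]; exact c1_anti hx hy hxy

lemma c_le_one {x : ℝ} (h : x ∈ Ico 0 π) : c x ≤ 1 := by
  rw [← c_zero]; exact c_anti ⟨le_rfl, pi_pos⟩ h h.1

/-- `h1 = -x c'` -/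
noncomputable def h1 (x : ℝ) : ℝ := - x * c1 x
/-- `h2 = -x^2 c''` -/
noncomputable def h2 (x : ℝ) : ℝ := - x^2 * c2 x

lemma h1_pos {x : ℝ} (h : x ∈ Ioo 0 π) : 0 < h1 x := by
  unfold h1; have := c1_neg h; nlinarith [h.1]
lemma h2_pos {x : ℝ} (h : x ∈ Ioo 0 π) : 0 < h2 x := by
  unfold h2; have := c2_neg h; have := h.1; nlinarith [sq_pos_of_pos h.1]

lemma h1_mono : MonotoneOn h1 (Ioo 0 π) := by
  intro x hx y hy hxy
  unfold h1; have h1 := c1_anti hx hy hxy; have := c1_neg hx; have := c1_neg hy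
  nlinarith [hx.1, hy.1]
lemma h2_mono : MonotoneOn h2 (Ioo 0 π) := by
  intro x hx y hy hxy
  unfold h2; have h1 := c2_anti hx hy hxy; have := c2_neg hx; have := c2_neg hy
  have : x^2 ≤ y^2 := pow_le_pow_left₀ hx.1.le hxy 2
  nlinarith [sq_nonneg x, sq_nonneg y]

lemma h1_deriv {x : ℝ} (h : x ∈ Ioo 0 π) : HasDerivAt h1 (- c1 x - x * c2 x) x := by
  refine HasDerivAt.congr_deriv (((hasDerivAt_id x).neg).mul (c1_deriv h)) ?_
  simp; ring

lemma h1_conv : ConvexOn ℝ (Ioo 0 π) h1 := by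
  apply MonotoneOn.convexOn_of_deriv (convex_Ioo 0 π) (fun x hx => (h1_deriv hx).continuousAt.continuousWithinAt)
  · rw [interior_Ioo]; exact fun x hx => (h1_deriv hx).differentiableAt.differentiableWithinAt
  · rw [interior_Ioo]; intro x hx y hy hxy
    rw [(h1_deriv hx).deriv, (h1_deriv hy).deriv]
    have := c1_anti hx hy hxy
    have h1 := c2_anti hx hy hxy; have := c2_neg hx; have := c2_neg hy
    nlinarith [hx.1, hy.1]

/-- antiderivative of `c` -/
noncomputable def I (x : ℝ) : ℝ := ∫ u in (0:ℝ)..x, c u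

lemma c_int {x : ℝ} (h : x ∈ Ico 0 π) : IntervalIntegrable c MeasureTheory.volume 0 x := by
  apply ContinuousOn.intervalIntegrable
  rw [uIcc_of_le h.1]
  exact c_cont.mono fun y hy => ⟨hy.1, hy.2.trans_lt h.2⟩

lemma I_deriv {x : ℝ} (h : x ∈ Ioo 0 π) : HasDerivAt I (c x) x := by
  have hc : ContinuousOn c (Ioo 0 π) := c_cont.mono Ioo_subset_Ico_self
  apply intervalIntegral.integral_hasDerivAt_right (c_int ⟨h.1.le, h.2⟩)
  · exact hc.stronglyMeasurableAtFilter isOpen_Ioo x h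
  · exact hc.continuousAt (isOpen_Ioo.mem_nhds h)

lemma I_zero : I 0 = 0 := by simp [I]

lemma I_cont : ContinuousOn I (Ico 0 π) := by
  intro x hx
  rcases hx.1.eq_or_lt with h0 | h0
  · subst h0
    have : ContinuousOn I (Icc 0 1) := by
      have := continuousOn_primitive_interval' (μ := MeasureTheory.volume) (c_int (x := 1) ⟨by norm_num, by linarith [pi_gt_three]⟩) (a := 0) (by simp)
      rwa [uIcc_of_le (by norm_num)] at this
    refine (this 0 (by simp)).mono_of_mem_nhdsWithin ?_
    refine Filter.mem_of_superset (Ico_mem_nhdsGE (show (0:ℝ) < 1 by norm_num)) Ico_subset_Icc_self |> nhdsWithin_mono _ Ico_subset_Ici_self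
  · exact (I_deriv ⟨h0, hx.2⟩).continuousAt.continuousWithinAt
end QP
end

section
namespace QP
open Real intervalIntegral Set

lemma le_of_deriv {f f' : ℝ → ℝ} {p q : ℝ} (hpq : p ≤ q) (hc : ContinuousOn f (Icc p q))
    (hd : ∀ x ∈ Ioo p q, HasDerivAt f (f' x) x) (hp : ∀ x ∈ Ioo p q, f' x ≤ 0) : f q ≤ f p := by
  have := anti_of (convex_Icc p q) hc (f' := f') (by rwa [interior_Icc]) (by rwa [interior_Icc])
  exact this ⟨le_rfl, hpq⟩ ⟨hpq, le_rfl⟩ hpq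

lemma int_lin {G g : ℝ → ℝ} {A B p q : ℝ} (hpq : p ≤ q) (hc : ContinuousOn G (Icc p q))
    (hd : ∀ u ∈ Ioo p q, HasDerivAt G (g u) u)
    (hle : ∀ u ∈ Ioo p q, g u ≤ A + B * (u - (p+q)/2)) : G q - G p ≤ (q - p) * A := by
  have := le_of_deriv (f := fun u => G u - A * u - B * (u - (p+q)/2)^2/2) (f' := fun u => g u - A - B * (u - (p+q)/2)) hpq
    (by fun_prop) (fun u hu => by
      refine (((hd u hu).sub ((hasDerivAt_id u).const_mul A)).sub (((((hasDerivAt_id u).sub_const ((p+q)/2)).pow 2).const_mul B).div_const 2)).congr_deriv ?_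
      simp; ring) (fun u hu => by linarith [hle u hu])
  nlinarith

lemma tangent_le {f f' : ℝ → ℝ} {s : Set ℝ} (hs : Convex ℝ s) (hd : ∀ x ∈ s, HasDerivAt f (f' x) x)
    (ha : AntitoneOn f' s) {x u : ℝ} (hx : x ∈ s) (hu : u ∈ s) : f u ≤ f x + f' x * (u - x) := by
  rcases lt_trichotomy u x with h | h | h
  · obtain ⟨ξ, hξ, e⟩ := exists_hasDerivAt_eq_slope f f' h (fun y hy => (hd y (hs.ordConnected.out hu hx hy)).continuousAt.continuousWithinAt) (fun y hy => hd y (hs.ordConnected.out hu hx (Ioo_subset_Icc_self hy)))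
    have := ha (hs.ordConnected.out hu hx (Ioo_subset_Icc_self hξ)) hx hξ.2.le
    rw [e, le_div_iff₀ (by linarith)] at this; linarith
  · subst h; simp
  · obtain ⟨ξ, hξ, e⟩ := exists_hasDerivAt_eq_slope f f' h (fun y hy => (hd y (hs.ordConnected.out hx hu hy)).continuousAt.continuousWithinAt) (fun y hy => hd y (hs.ordConnected.out hx hu (Ioo_subset_Icc_self hy)))
    have := ha hx (hs.ordConnected.out hx hu (Ioo_subset_Icc_self hξ)) hξ.1.le
    rw [e, div_le_iff₀ (by linarith)] at this; linarith

lemma I_mid {x d : ℝ} (hd : 0 ≤ d) (h0 : 0 < x) (h1 : 0 ≤ x - d) (h2 : x + d < π) : I (x+d) - I (x-d) ≤ 2 * d * c x := by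
  have := int_lin (G := I) (g := c) (A := c x) (B := c1 x) (p := x - d) (q := x + d) (by linarith)
    (I_cont.mono fun y hy => ⟨h1.trans hy.1, hy.2.trans_lt h2⟩)
    (fun u hu => I_deriv ⟨by linarith [hu.1], by linarith [hu.2]⟩)
    (fun u hu => by
      have := tangent_le (convex_Ioo 0 π) (fun x hx => c_deriv hx) c1_anti (x := x) (u := u) ⟨h0, by linarith⟩ ⟨by linarith [hu.1], by linarith [hu.2]⟩
      convert this using 3; ring)
  linarith

lemma I_trap {x y : ℝ} (h0 : 0 ≤ x) (hxy : x < y) (h2 : y < π) : (y - x) * ((c x + c y)/2) ≤ I y - I x := by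
  have := int_lin (G := fun u => - I u) (g := fun u => - c u) (A := -((c x + c y)/2)) (B := -((c y - c x)/(y-x))) (p := x) (q := y) (by linarith)
    (I_cont.mono fun u hy => ⟨h0.trans hy.1, hy.2.trans_lt h2⟩).neg
    (fun u hu => (I_deriv ⟨by linarith [hu.1], by linarith [hu.2]⟩).neg)
    (fun u hu => by
      have e := c_conc.2 (show x ∈ Ico 0 π from ⟨h0, by linarith⟩) (show y ∈ Ico 0 π from ⟨by linarith, h2⟩) (show 0 ≤ (y-u)/(y-x) from div_nonneg (by linarith [hu.2]) (by linarith)) (show 0 ≤ (u-x)/(y-x) from div_nonneg (by linarith [hu.1]) (by linarith))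
        (by have : y - x ≠ 0 := by linarith
            field_simp; ring)
      simp only [smul_eq_mul] at e
      have hne : y - x ≠ 0 := by linarith
      rw [show (y-u)/(y-x)*x + (u-x)/(y-x)*y = u by field_simp; ring] at e
      rw [show (y-u)/(y-x)*c x + (u-x)/(y-x)*c y = (c x + c y)/2 + ((c y - c x)/(y-x)) * (u - (x+y)/2) by field_simp; ring] at e
      linarith)
  linarith

lemma I_le {x : ℝ} (h : x ∈ Ico 0 π) : I x ≤ x := by
  have := int_lin (G := I) (g := c) (A := 1) (B := 0) (p := 0) (q := x) h.1
    (I_cont.mono fun y hy => ⟨hy.1, hy.2.trans_lt h.2⟩)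
    (fun u hu => I_deriv ⟨hu.1, by linarith [hu.2, h.2]⟩)
    (fun u hu => by linarith [c_le_one (x := u) ⟨hu.1.le, by linarith [hu.2, h.2]⟩])
  rw [I_zero] at this; linarith

/-- the sum -/
noncomputable def Q (n : ℕ) (x : ℝ) : ℝ := ∑ k ∈ Finset.Icc 1 n, c (k * x)
noncomputable def Q1 (n : ℕ) (x : ℝ) : ℝ := ∑ k ∈ Finset.Icc 1 n, h1 (k * x)
noncomputable def Q2 (n : ℕ) (x : ℝ) : ℝ := ∑ k ∈ Finset.Icc 1 n, h2 (k * x)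

lemma Q_succ (n : ℕ) (x : ℝ) : Q (n+1) x = Q n x + c ((n+1 : ℕ) * x) := by
  unfold Q; rw [Finset.sum_Icc_succ_top (by omega)]
lemma Q1_succ (n : ℕ) (x : ℝ) : Q1 (n+1) x = Q1 n x + h1 ((n+1 : ℕ) * x) := by
  unfold Q1; rw [Finset.sum_Icc_succ_top (by omega)]
lemma Q2_succ (n : ℕ) (x : ℝ) : Q2 (n+1) x = Q2 n x + h2 ((n+1 : ℕ) * x) := by
  unfold Q2; rw [Finset.sum_Icc_succ_top (by omega)]

lemma Q_ge (n : ℕ) {x : ℝ} (hx : 0 < x) (h : (n + 1/2) * x < π) :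
    I ((n + 1/2) * x) - x/2 ≤ x * Q n x := by
  induction n with
  | zero => 
    simp [Q]
    have := I_le (x := 2⁻¹ * x) ⟨by positivity, by simpa using h⟩
    linarith
  | succ n ih =>
    push_cast at h
    have hnn : (0:ℝ) ≤ n := by positivity
    have e1 := ih (by nlinarith)
    rw [Q_succ]; push_cast
    have := I_mid (x := ((n:ℝ)+1)*x) (d := x/2) (by linarith) (by positivity) (by nlinarith) (by nlinarith)
    rw [show ((n:ℝ)+1)*x + x/2 = (n + 1 + 1/2)*x by ring, show ((n:ℝ)+1)*x - x/2 = (n + 1/2)*x by ring] at this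
    linarith

lemma Q_le (n : ℕ) {x : ℝ} (hx : 0 < x) (h : n * x < π) :
    x * Q n x ≤ I (n * x) - x/2 + x/2 * c (n * x) := by
  induction n with
  | zero => simp [Q, I_zero, c_zero]
  | succ n ih =>
    push_cast at h
    have e1 := ih (by nlinarith)
    rw [Q_succ]; push_cast
    have := I_trap (x := n*x) (y := ((n:ℝ)+1)*x) (by positivity) (by nlinarith) (by nlinarith)
    nlinarith

/-- antiderivative of `h1` -/
noncomputable def H1 (x : ℝ) : ℝ := I x - x * c x
/-- antiderivative of `h2` -/
noncomputable def H2 (x : ℝ) : ℝ := x * c x + x / sinc x ^ 2 - 2 * I x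

lemma H1_cont : ContinuousOn H1 (Ico 0 π) := I_cont.sub (continuousOn_id.mul c_cont)
lemma H2_cont : ContinuousOn H2 (Ico 0 π) := by
  refine ((continuousOn_id.mul c_cont).add (continuousOn_id.div (continuous_sinc.continuousOn.pow 2) fun x hx => ?_)).sub (I_cont.const_mul 2)
  have := sinc_pos' hx; exact pow_ne_zero 2 this.ne'
lemma H1_zero : H1 0 = 0 := by simp [H1, I_zero]
lemma H2_zero : H2 0 = 0 := by simp [H2, I_zero]
lemma H1_deriv {x : ℝ} (h : x ∈ Ioo 0 π) : HasDerivAt H1 (h1 x) x := by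
  refine ((I_deriv h).sub ((hasDerivAt_id x).mul (c_deriv h))).congr_deriv ?_
  unfold h1; simp
lemma H2_eq {x : ℝ} (h : 0 < x) : H2 x = - x^2 * c1 x + 2 * (x * c x - I x) := by
  unfold H2 c1; rw [c_eq h, sinc_of_ne_zero h.ne']
  by_cases hs : sin x = 0
  · simp [hs]
  field_simp; ring
lemma H2_deriv {x : ℝ} (h : x ∈ Ioo 0 π) : HasDerivAt H2 (h2 x) x := by
  have h1 : HasDerivAt (fun x => - x^2 * c1 x + 2 * (x * c x - I x)) (h2 x) x := by
    refine (((((hasDerivAt_id x).pow 2).neg).mul (c1_deriv h)).add ((((hasDerivAt_id x).mul (c_deriv h)).sub (I_deriv h)).const_mul 2)).congr_deriv ?_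
    unfold h2; simp; ring
  refine h1.congr_of_eventuallyEq ?_
  filter_upwards [lt_mem_nhds h.1] with y hy using H2_eq hy

lemma sum_mono {H h : ℝ → ℝ} (hc : ContinuousOn H (Ico 0 π)) (hd : ∀ x ∈ Ioo 0 π, HasDerivAt H (h x) x)
    (hm : MonotoneOn h (Ioo 0 π)) (hp : ∀ x ∈ Ioo 0 π, 0 < h x) (h0 : H 0 = 0) {x : ℝ} (hx : 0 < x) (n : ℕ) (hn : n * x < π) :
    H (n * x) ≤ x * ∑ k ∈ Finset.Icc 1 n, h (k * x) ∧
    x * ∑ k ∈ Finset.Icc 1 n, h (k * x) ≤ H (n * x) + if n = 0 then 0 else x * h (n * x) := by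
  induction n with
  | zero => simp [h0]
  | succ n ih =>
    push_cast at hn
    have hnn : (0:ℝ) ≤ n := by positivity
    have e1 := ih (by nlinarith)
    rw [Finset.sum_Icc_succ_top (by omega)]; push_cast
    have q1 := int_lin (G := H) (g := h) (A := h ((n+1)*x)) (B := 0) (p := n * x) (q := (n+1)*x) (by nlinarith)
      (hc.mono fun y hy => ⟨by nlinarith [hy.1], hy.2.trans_lt hn⟩)
      (fun u hu => hd u ⟨by nlinarith [hu.1], hu.2.trans hn⟩)
      (fun u hu => by have := hm (a := u) ⟨by nlinarith [hu.1], hu.2.trans hn⟩ (b := (n+1)*x) ⟨by positivity, hn⟩ hu.2.le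
                      linarith)
    refine ⟨by nlinarith [e1.1], ?_⟩
    by_cases hn0 : n = 0
    · subst hn0; simp
      have q2 := int_lin (G := fun u => - H u) (g := fun u => - h u) (A := 0) (B := 0) (p := 0) (q := x) hx.le
        ((hc.mono fun y hy => ⟨hy.1, hy.2.trans_lt (by simpa using hn)⟩).neg)
        (fun u hu => (hd u ⟨hu.1, hu.2.trans (by simpa using hn)⟩).neg)
        (fun u hu => by have := hp u ⟨hu.1, hu.2.trans (by simpa using hn)⟩
                        linarith)
      simp only [h0] at q2; linarith
    · rw [if_neg hn0] at e1
      have hn1 : (0:ℝ) < n := by positivity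
      have q2 := int_lin (G := fun u => - H u) (g := fun u => - h u) (A := -h (n*x)) (B := 0) (p := n * x) (q := (n+1)*x) (by nlinarith)
        ((hc.mono fun y hy => ⟨by nlinarith [hy.1], hy.2.trans_lt hn⟩).neg)
        (fun u hu => (hd u ⟨by nlinarith [hu.1], hu.2.trans hn⟩).neg)
        (fun u hu => by have := hm (a := n * x) ⟨by positivity, by nlinarith⟩ (b := u) ⟨by nlinarith [hu.1], hu.2.trans hn⟩ hu.1.le
                        linarith)
      nlinarith [e1.2]

lemma Q1_ge (n : ℕ) {x : ℝ} (hx : 0 < x) (hn : n * x < π) : H1 (n * x) ≤ x * Q1 n x :=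
  (sum_mono H1_cont (fun _ h => H1_deriv h) h1_mono (fun _ h => h1_pos h) H1_zero hx n hn).1
lemma Q2_ge (n : ℕ) {x : ℝ} (hx : 0 < x) (hn : n * x < π) : H2 (n * x) ≤ x * Q2 n x :=
  (sum_mono H2_cont (fun _ h => H2_deriv h) h2_mono (fun _ h => h2_pos h) H2_zero hx n hn).1
lemma Q2_le (n : ℕ) (h0 : 0 < n) {x : ℝ} (hx : 0 < x) (hn : n * x < π) : x * Q2 n x ≤ H2 (n * x) + x * h2 (n * x) := by
  have := (sum_mono H2_cont (fun _ h => H2_deriv h) h2_mono (fun _ h => h2_pos h) H2_zero hx n hn).2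
  rwa [if_neg (by omega)] at this

lemma Q1_le (n : ℕ) {x : ℝ} (hx : 0 < x) (h : (n + 1/2) * x < π) : x * Q1 n x ≤ H1 ((n + 1/2) * x) := by
  induction n with
  | zero => 
    simp [Q1]
    have q2 := int_lin (G := fun u => - H1 u) (g := fun u => - h1 u) (A := 0) (B := 0) (p := 0) (q := 2⁻¹ * x) (by positivity)
        ((H1_cont.mono fun y hy => ⟨hy.1, hy.2.trans_lt (by simpa using h)⟩).neg)
        (fun u hu => (H1_deriv ⟨hu.1, hu.2.trans (by simpa using h)⟩).neg)
        (fun u hu => by have := h1_pos (x := u) ⟨hu.1, hu.2.trans (by simpa using h)⟩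
                        linarith)
    simp only [H1_zero] at q2; linarith
  | succ n ih =>
    push_cast at h
    have hnn : (0:ℝ) ≤ n := by positivity
    have e1 := ih (by nlinarith)
    rw [Q1_succ]; push_cast
    have := int_lin (G := fun u => - H1 u) (g := fun u => - h1 u) (A := -h1 ((n+1)*x)) (B := -(- c1 ((n+1)*x) - (n+1)*x * c2 ((n+1)*x))) (p := (n + 1/2) * x) (q := (n + 1 + 1/2) * x) (by nlinarith)
        ((H1_cont.mono fun y hy => ⟨by nlinarith [hy.1], hy.2.trans_lt h⟩).neg)
        (fun u hu => (H1_deriv ⟨by nlinarith [hu.1], hu.2.trans h⟩).neg)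
        (fun u hu => by
          have := tangent_le (convex_Ioo 0 π) (f := fun u => - h1 u) (f' := fun x => -(- c1 x - x * c2 x)) (fun x hx => (h1_deriv hx).neg) 
             (fun x hx y hy hxy => by
                have := c1_anti hx hy hxy
                have h1 := c2_anti hx hy hxy; have := c2_neg hx; have := c2_neg hy
                nlinarith [hx.1, hy.1]) (x := (n+1)*x) (u := u) ⟨by positivity, by nlinarith⟩ ⟨by nlinarith [hu.1], hu.2.trans h⟩
          have e : ((n + 1/2) * x + (n + 1 + 1/2) * x)/2 = (n+1)*x := by ring
          rw [e]; exact this)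
    nlinarith
end QP
end

section
namespace QP
open Real intervalIntegral Set

lemma I_pi2 : I (π/2) = π/2 * log 2 := by
  have hp := pi_pos
  have hcont : ContinuousOn (fun x => x * log (sin x)) (Icc 0 (π/2)) := by
    have h1 : ContinuousOn (fun x : ℝ => x * log x + x * log (sinc x)) (Icc 0 (π/2)) := by
      refine continuous_mul_log.continuousOn.add (continuousOn_id.mul (continuous_sinc.continuousOn.log fun x hx => ?_))
      exact (sinc_pos' ⟨hx.1, by linarith [hx.2]⟩).ne'
    refine h1.congr fun x hx => ?_
    rcases hx.1.eq_or_lt with h0 | h0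
    · subst h0; simp
    · have hs := sinpos ⟨h0, by linarith [hx.2]⟩
      simp only
      rw [sinc_of_ne_zero h0.ne', log_div hs.ne' h0.ne']; ring
  have hi : IntervalIntegrable c MeasureTheory.volume 0 (π/2) := c_int ⟨by positivity, by linarith⟩
  have key := intervalIntegral.integral_eq_sub_of_hasDerivAt_of_le (f := fun x => x * log (sin x)) (f' := fun x => log (sin x) + c x)
    (a := 0) (b := π/2) (by positivity) hcont (fun x hx => by
      have hs := sinpos (x := x) ⟨hx.1, by linarith [hx.2]⟩
      refine ((hasDerivAt_id x).mul ((hasDerivAt_sin x).log hs.ne')).congr_deriv ?_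
      rw [c_eq hx.1]; simp; ring) (intervalIntegrable_log_sin.add hi)
  have hls : IntervalIntegrable (fun x => log (sin x)) MeasureTheory.volume 0 (π/2) := intervalIntegrable_log_sin
  rw [intervalIntegral.integral_add hls hi, integral_log_sin_zero_pi_div_two] at key
  simp at key
  unfold I; linarith

/-- tangent shifted -/
noncomputable def T (x : ℝ) : ℝ := tan (x - π/2)

lemma cosT {x : ℝ} : cos x = - sin (x - π/2) := by rw [sin_sub_pi_div_two]; ring
lemma sinT {x : ℝ} : sin x = cos (x - π/2) := by rw [cos_sub_pi_div_two]

lemma c_T {x : ℝ} (h : x ∈ Ioo 0 π) : c x = - x * T x := by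
  rw [c_eq h.1, T, tan_eq_sin_div_cos, ← sinT, sin_sub_pi_div_two]; ring
lemma T_sq {x : ℝ} (h : x ∈ Ioo 0 π) : 1 / sin x ^ 2 = 1 + T x ^ 2 := by
  have := sinpos h
  rw [T, tan_eq_sin_div_cos, ← sinT, sin_sub_pi_div_two]
  have h2 := sin_sq_add_cos_sq x
  field_simp; linear_combination -h2
lemma c1_T {x : ℝ} (h : x ∈ Ioo 0 π) : c1 x = - T x - x * (1 + T x ^ 2) := by
  rw [← T_sq h, c1, T, tan_eq_sin_div_cos, ← sinT, sin_sub_pi_div_two]; ring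
lemma c2_T {x : ℝ} (h : x ∈ Ioo 0 π) : c2 x = - 2 * (1 + x * T x) * (1 + T x ^ 2) := by
  have := sinpos h
  rw [← T_sq h, c2, T, tan_eq_sin_div_cos, ← sinT, sin_sub_pi_div_two]; field_simp; ring
lemma h1_T {x : ℝ} (h : x ∈ Ioo 0 π) : h1 x = x * T x + x^2 * (1 + T x ^ 2) := by
  rw [h1, c1_T h]; ring
lemma h2_T {x : ℝ} (h : x ∈ Ioo 0 π) : h2 x = 2 * x^2 * (1 + x * T x) * (1 + T x ^ 2) := by
  rw [h2, c2_T h]; ring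
lemma H2_T {x : ℝ} (h : x ∈ Ioo 0 π) : H2 x = x^3 * (1 + T x ^ 2) - x^2 * T x - 2 * I x := by
  rw [H2_eq h.1, c1_T h, c_T h]; ring
lemma H1_T {x : ℝ} (h : x ∈ Ioo 0 π) : H1 x = x^2 * T x + I x := by
  rw [H1, c_T h]; ring

lemma T_mono : StrictMonoOn T (Ioo 0 π) := by
  intro x hx y hy hxy
  exact strictMonoOn_tan ⟨by linarith [hx.1], by linarith [hx.2]⟩ ⟨by linarith [hy.1], by linarith [hy.2]⟩ (by linarith)

/-! Taylor bounds -/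
lemma chain {f f' : ℝ → ℝ} (hd : ∀ x, HasDerivAt f (f' x) x) (h0 : f 0 = 0) (hp : ∀ x, 0 ≤ x → 0 ≤ f' x) {x : ℝ} (hx : 0 ≤ x) : 0 ≤ f x := by
  have := mono_of (convex_Ici 0) (f := f) (f' := f') (fun y _ => (hd y).continuousAt.continuousWithinAt) (fun y _ => hd y)
    (by rw [interior_Ici]; exact fun y hy => hp y (le_of_lt hy))
  rw [← h0]; exact this (by simp) hx hx

lemma s1 {x : ℝ} (hx : 0 ≤ x) : 0 ≤ x - sin x :=
  chain (f := fun x => x - sin x) (f' := fun x => 1 - cos x) (fun x => (hasDerivAt_id x).sub (hasDerivAt_sin x)) (by simp) (fun x _ => by linarith [cos_le_one x]) hx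
lemma k2 {x : ℝ} (hx : 0 ≤ x) : 0 ≤ cos x - (1 - x^2/2) :=
  chain (f := fun x => cos x - (1 - x^2/2)) (f' := fun x => x - sin x)
    (fun x => ((hasDerivAt_cos x).sub ((((hasDerivAt_id x).pow 2).div_const 2).const_sub 1)).congr_deriv (by simp; ring)) (by simp) (fun x h => s1 h) hx
lemma s3 {x : ℝ} (hx : 0 ≤ x) : 0 ≤ sin x - (x - x^3/6) :=
  chain (f := fun x => sin x - (x - x^3/6)) (f' := fun x => cos x - (1 - x^2/2))
    (fun x => ((hasDerivAt_sin x).sub ((hasDerivAt_id x).sub (((hasDerivAt_id x).pow 3).div_const 6))).congr_deriv (by simp; ring)) (by simp) (fun x h => k2 h) hx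
lemma k4 {x : ℝ} (hx : 0 ≤ x) : 0 ≤ (1 - x^2/2 + x^4/24) - cos x :=
  chain (f := fun x => (1 - x^2/2 + x^4/24) - cos x) (f' := fun x => sin x - (x - x^3/6))
    (fun x => ((((((hasDerivAt_id x).pow 2).div_const 2).const_sub 1).add (((hasDerivAt_id x).pow 4).div_const 24)).sub (hasDerivAt_cos x)).congr_deriv (by simp; ring)) (by simp) (fun x h => s3 h) hx
lemma s5 {x : ℝ} (hx : 0 ≤ x) : 0 ≤ (x - x^3/6 + x^5/120) - sin x :=
  chain (f := fun x => (x - x^3/6 + x^5/120) - sin x) (f' := fun x => (1 - x^2/2 + x^4/24) - cos x)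
    (fun x => ((((hasDerivAt_id x).sub (((hasDerivAt_id x).pow 3).div_const 6)).add (((hasDerivAt_id x).pow 5).div_const 120)).sub (hasDerivAt_sin x)).congr_deriv (by simp; ring)) (by simp) (fun x h => k4 h) hx
lemma k6 {x : ℝ} (hx : 0 ≤ x) : 0 ≤ cos x - (1 - x^2/2 + x^4/24 - x^6/720) :=
  chain (f := fun x => cos x - (1 - x^2/2 + x^4/24 - x^6/720)) (f' := fun x => (x - x^3/6 + x^5/120) - sin x)
    (fun x => ((hasDerivAt_cos x).sub ((((((hasDerivAt_id x).pow 2).div_const 2).const_sub 1).add (((hasDerivAt_id x).pow 4).div_const 24)).sub (((hasDerivAt_id x).pow 6).div_const 720))).congr_deriv (by simp; ring)) (by simp) (fun x h => s5 h) hx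
lemma s7 {x : ℝ} (hx : 0 ≤ x) : 0 ≤ sin x - (x - x^3/6 + x^5/120 - x^7/5040) :=
  chain (f := fun x => sin x - (x - x^3/6 + x^5/120 - x^7/5040)) (f' := fun x => cos x - (1 - x^2/2 + x^4/24 - x^6/720))
    (fun x => ((hasDerivAt_sin x).sub ((((hasDerivAt_id x).sub (((hasDerivAt_id x).pow 3).div_const 6)).add (((hasDerivAt_id x).pow 5).div_const 120)).sub (((hasDerivAt_id x).pow 7).div_const 5040))).congr_deriv (by simp; ring)) (by simp) (fun x h => k6 h) hx
lemma k8 {x : ℝ} (hx : 0 ≤ x) : 0 ≤ (1 - x^2/2 + x^4/24 - x^6/720 + x^8/40320) - cos x :=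
  chain (f := fun x => (1 - x^2/2 + x^4/24 - x^6/720 + x^8/40320) - cos x) (f' := fun x => sin x - (x - x^3/6 + x^5/120 - x^7/5040))
    (fun x => ((((((((hasDerivAt_id x).pow 2).div_const 2).const_sub 1).add (((hasDerivAt_id x).pow 4).div_const 24)).sub (((hasDerivAt_id x).pow 6).div_const 720)).add (((hasDerivAt_id x).pow 8).div_const 40320)).sub (hasDerivAt_cos x)).congr_deriv (by simp; ring)) (by simp) (fun x h => s7 h) hx
lemma s9 {x : ℝ} (hx : 0 ≤ x) : 0 ≤ (x - x^3/6 + x^5/120 - x^7/5040 + x^9/362880) - sin x :=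
  chain (f := fun x => (x - x^3/6 + x^5/120 - x^7/5040 + x^9/362880) - sin x) (f' := fun x => (1 - x^2/2 + x^4/24 - x^6/720 + x^8/40320) - cos x)
    (fun x => ((((((hasDerivAt_id x).sub (((hasDerivAt_id x).pow 3).div_const 6)).add (((hasDerivAt_id x).pow 5).div_const 120)).sub (((hasDerivAt_id x).pow 7).div_const 5040)).add (((hasDerivAt_id x).pow 9).div_const 362880)).sub (hasDerivAt_sin x)).congr_deriv (by simp; ring)) (by simp) (fun x h => k8 h) hx
lemma k10 {x : ℝ} (hx : 0 ≤ x) : 0 ≤ cos x - (1 - x^2/2 + x^4/24 - x^6/720 + x^8/40320 - x^10/3628800) :=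
  chain (f := fun x => cos x - (1 - x^2/2 + x^4/24 - x^6/720 + x^8/40320 - x^10/3628800)) (f' := fun x => (x - x^3/6 + x^5/120 - x^7/5040 + x^9/362880) - sin x)
    (fun x => ((hasDerivAt_cos x).sub ((((((((hasDerivAt_id x).pow 2).div_const 2).const_sub 1).add (((hasDerivAt_id x).pow 4).div_const 24)).sub (((hasDerivAt_id x).pow 6).div_const 720)).add (((hasDerivAt_id x).pow 8).div_const 40320)).sub (((hasDerivAt_id x).pow 10).div_const 3628800))).congr_deriv (by simp; ring)) (by simp) (fun x h => s9 h) hx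

lemma T_ge {x u r : ℝ} (hx : x ∈ Ioo 0 π) (hu : 0 ≤ u) (hux : u ≤ x - 3.141593/2) (hr : 0 ≤ r)
    (h : r * (1 - u^2/2 + u^4/24 - u^6/720 + u^8/40320) ≤ u - u^3/6 + u^5/120 - u^7/5040) : r ≤ T x := by
  have hpi := pi_lt_d6
  have hu2 : u < π/2 := by linarith [hx.2]
  have hc : 0 < cos u := cos_pos_of_mem_Ioo ⟨by linarith, hu2⟩
  have : r ≤ tan u := by
    rw [tan_eq_sin_div_cos, le_div_iff₀ hc]
    have h1 := k8 hu; have h2 := s7 hu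
    nlinarith
  refine this.trans ?_
  exact (strictMonoOn_tan.monotoneOn) ⟨by linarith, hu2⟩ ⟨by linarith, by linarith [hx.2]⟩ (by linarith)

lemma T_le {x u r : ℝ} (hx : x ∈ Ioo 0 π) (hu : 0 ≤ u) (hu2 : u < 1.57) (hux : x - 3.141592/2 ≤ u) (hr : 0 ≤ r)
    (h : u - u^3/6 + u^5/120 - u^7/5040 + u^9/362880 ≤ r * (1 - u^2/2 + u^4/24 - u^6/720 + u^8/40320 - u^10/3628800)) : T x ≤ r := by
  have hpi := pi_gt_d6
  have hc : 0 < cos u := cos_pos_of_mem_Ioo ⟨by linarith, by linarith⟩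
  have : tan u ≤ r := by
    rw [tan_eq_sin_div_cos, div_le_iff₀ hc]
    have h1 := k10 hu; have h2 := s9 hu
    nlinarith
  refine le_trans ?_ this
  exact (strictMonoOn_tan.monotoneOn) ⟨by linarith [hx.1], by linarith [hx.2]⟩ ⟨by linarith, by linarith⟩ (by linarith)

lemma tan_lo {u : ℝ} (hu : 0 ≤ u) (hu2 : u < π/2) :
    u + u^3/3 + 2*u^5/15 + 17*u^7/315 + 62*u^9/2835 ≤ tan u := by
  have h := chain (f := fun u => u - arctan (u + u^3/3 + 2*u^5/15 + 17*u^7/315 + 62*u^9/2835))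
    (f' := fun u => 1 - (1 + u^2 + 2*u^4/3+17*u^6/45 + 62*u^8/315)/(1 + (u + u^3/3 + 2*u^5/15 + 17*u^7/315 + 62*u^9/2835)^2))
    (fun x => by
      refine HasDerivAt.sub (hasDerivAt_id x) (HasDerivAt.congr_deriv (HasDerivAt.arctan
       (((((hasDerivAt_id x).add (((hasDerivAt_id x).pow 3).div_const 3)).add ((((hasDerivAt_id x).pow 5).const_mul 2).div_const 15)).add ((((hasDerivAt_id x).pow 7).const_mul 17).div_const 315)).add ((((hasDerivAt_id x).pow 9).const_mul 62).div_const 2835))) ?_)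
      simp; field_simp; ring) (by simp) (fun x hx => by
      rw [sub_nonneg, div_le_one (by positivity), ← sub_nonneg]
      have : (1 + (x + x^3/3 + 2*x^5/15 + 17*x^7/315 + 62*x^9/2835)^2) - (1 + x^2 + 2*x^4/3+17*x^6/45 + 62*x^8/315) = x^10 * (1382/14175 + 176/6075 * x^2 + 2603/297675 * x^4+2108/893025 * x^6 + 3844/8037225*x^8) := by ring
      rw [this]; positivity) hu
  have h2 := tan_arctan (u + u^3/3 + 2*u^5/15 + 17*u^7/315 + 62*u^9/2835)
  rw [← h2]
  exact strictMonoOn_tan.monotoneOn ⟨neg_pi_div_two_lt_arctan _, arctan_lt_pi_div_two _⟩ ⟨by linarith [pi_pos], hu2⟩ (by linarith)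

lemma tan_hi {u : ℝ} (hu : 0 ≤ u) (hu2 : u ≤ 0.92) :
    tan u ≤ u + u^3/3 + 2*u^5/15 + 0.11 * u^7 := by
  have h := le_of_deriv (f := fun u => u - arctan (u + u^3/3 + 2*u^5/15 + 0.11*u^7))
    (f' := fun u => 1 - (1 + u^2 + 2*u^4/3+0.77*u^6)/(1 + (u + u^3/3 + 2*u^5/15 + 0.11*u^7)^2)) hu (by fun_prop)
    (fun x _ => by
      refine HasDerivAt.sub (hasDerivAt_id x) (HasDerivAt.congr_deriv (HasDerivAt.arctan
       ((((hasDerivAt_id x).add (((hasDerivAt_id x).pow 3).div_const 3)).add ((((hasDerivAt_id x).pow 5).const_mul 2).div_const 15)).add (((hasDerivAt_id x).pow 7).const_mul 0.11))) ?_)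
      simp; field_simp; ring) (fun x hx => by
      rw [sub_nonpos, one_le_div (by positivity), ← sub_nonneg]
      have e : (1 + x^2 + 2*x^4/3+0.77*x^6) - (1 + (x + x^3/3 + 2*x^5/15 + 0.11*x^7)^2) = x^6 * (0.77-17/45 - (0.22+4/45)*x^2 - (4/225+0.22/3)*x^4 - 0.44/15*x^6-0.0121*x^8) := by ring
      rw [e]
      have hx2 : x^2 ≤ 0.85 := by nlinarith [hx.1, hx.2]
      have hx4 : x^4 ≤ 0.85^2 := by rw [show x^4 = (x^2)^2 by ring]; gcongr
      have hx6 : x^6 ≤ 0.85^3 := by rw [show x^6 = (x^2)^3 by ring]; gcongr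
      have hx8 : x^8 ≤ 0.85^4 := by rw [show x^8 = (x^2)^4 by ring]; gcongr
      have := hx.1
      apply mul_nonneg (by positivity)
      norm_num at *; linarith)
  simp only [zero_sub] at h
  simp at h
  have h2 := tan_arctan (u + u^3/3 + 2*u^5/15 + 0.11*u^7)
  rw [← h2]
  exact strictMonoOn_tan.monotoneOn ⟨by linarith [pi_pos], by linarith [pi_gt_three]⟩ ⟨neg_pi_div_two_lt_arctan _, arctan_lt_pi_div_two _⟩ (by linarith)

lemma I_up {v : ℝ} (hv : 0 ≤ v) (hv2 : v < π/2) : I (π/2 + v) ≤ π/2 * log 2 -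
   ((π/2)*(v^2/2+v^4/12+v^6/45+17*v^8/2520+62*v^10/28350)+ (v^3/3+v^5/15+2*v^7/105+17*v^9/2835+62*v^11/31185)) := by
  have hpi := pi_pos
  have := le_of_deriv (f := fun v => I (π/2 + v) + ((π/2)*(v^2/2+v^4/12+v^6/45+17*v^8/2520+62*v^10/28350)+ (v^3/3+v^5/15+2*v^7/105+17*v^9/2835+62*v^11/31185)))
    (f' := fun v => c (π/2+v) + (π/2 + v) * (v + v^3/3 + 2*v^5/15 + 17*v^7/315 + 62*v^9/2835)) hv
    (by
      apply ContinuousOn.add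
      · exact I_cont.comp (by fun_prop) fun x hx => ⟨by linarith [hx.1], by linarith [hx.2]⟩
      · fun_prop)
    (fun x hx => by
      have h1 : HasDerivAt (fun v => I (π/2 + v)) (c (π/2 + x)) x := by
        exact ((I_deriv (x := π/2 + x) ⟨by linarith [hx.1], by linarith [hx.2]⟩).comp x ((hasDerivAt_id x).const_add (π/2))).congr_deriv (by simp)
      refine HasDerivAt.add h1 (HasDerivAt.congr_deriv (HasDerivAt.add (HasDerivAt.const_mul (π/2) 
        ((((((hasDerivAt_id x).pow 2).div_const 2).add (((hasDerivAt_id x).pow 4).div_const 12)).add (((hasDerivAt_id x).pow 6).div_const 45)).add ((((hasDerivAt_id x).pow 8).const_mul 17).div_const 2520) |>.add ((((hasDerivAt_id x).pow 10).const_mul 62).div_const 28350)))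
        ((((((hasDerivAt_id x).pow 3).div_const 3).add (((hasDerivAt_id x).pow 5).div_const 15)).add ((((hasDerivAt_id x).pow 7).const_mul 2).div_const 105)).add ((((hasDerivAt_id x).pow 9).const_mul 17).div_const 2835) |>.add ((((hasDerivAt_id x).pow 11).const_mul 62).div_const 31185))) ?_)
      simp; ring)
    (fun x hx => by
      rw [c_T ⟨by linarith [hx.1], by linarith [hx.2]⟩, T, add_sub_cancel_left]
      have := tan_lo (u := x) hx.1.le (by linarith [hx.2])
      nlinarith [hx.1])
  simp [I_pi2] at this
  linarith

lemma I_lo {v : ℝ} (hv : 0 ≤ v) (hv2 : v ≤ 0.92) : π/2 * log 2 -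
   ((π/2)*(v^2/2+v^4/12+v^6/45+0.01375*v^8)+ (v^3/3+v^5/15+2*v^7/105+0.11*v^9/9)) ≤ I (π/2 + v) := by
  have hpi := pi_gt_three
  have := le_of_deriv (f := fun v => -(I (π/2 + v) + ((π/2)*(v^2/2+v^4/12+v^6/45+0.01375*v^8)+ (v^3/3+v^5/15+2*v^7/105+0.11*v^9/9))))
    (f' := fun v => -(c (π/2+v) + (π/2 + v) * (v + v^3/3 + 2*v^5/15 + 0.11*v^7))) hv
    (by
      apply ContinuousOn.neg
      apply ContinuousOn.add
      · exact I_cont.comp (by fun_prop) fun x hx => ⟨by linarith [hx.1], by linarith [hx.2]⟩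
      · fun_prop)
    (fun x hx => by
      have h1 : HasDerivAt (fun v => I (π/2 + v)) (c (π/2 + x)) x := by
        exact ((I_deriv (x := π/2 + x) ⟨by linarith [hx.1], by linarith [hx.2]⟩).comp x ((hasDerivAt_id x).const_add (π/2))).congr_deriv (by simp)
      refine (HasDerivAt.add h1 (HasDerivAt.congr_deriv (HasDerivAt.add (HasDerivAt.const_mul (π/2) 
        (((((hasDerivAt_id x).pow 2).div_const 2).add (((hasDerivAt_id x).pow 4).div_const 12)).add (((hasDerivAt_id x).pow 6).div_const 45) |>.add (((hasDerivAt_id x).pow 8).const_mul 0.01375)))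
        (((((hasDerivAt_id x).pow 3).div_const 3).add (((hasDerivAt_id x).pow 5).div_const 15)).add ((((hasDerivAt_id x).pow 7).const_mul 2).div_const 105) |>.add ((((hasDerivAt_id x).pow 9).const_mul 0.11).div_const 9))) ?_)).neg
      simp; ring)
    (fun x hx => by
      rw [c_T ⟨by linarith [hx.1], by linarith [hx.2]⟩, T, add_sub_cancel_left]
      have := tan_hi (u := x) hx.1.le (by linarith [hx.2])
      nlinarith [hx.1])
  simp [I_pi2] at this
  linarith

lemma I_2488 : I 2.488 ≤ 0 := by
  have p1 := pi_gt_d6; have p2 := pi_lt_d6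
  have l1 := log_two_lt_d9
  have h := I_up (v := 2.488 - π/2) (by linarith) (by linarith)
  rw [show π/2 + (2.488 - π/2) = 2.488 by ring] at h
  have hv : (0.9172035:ℝ) ≤ 2.488 - π/2 := by linarith
  have : (π/2)*(0.9172035^2/2+0.9172035^4/12+0.9172035^6/45+17*0.9172035^8/2520+62*0.9172035^10/28350)+ (0.9172035^3/3+0.9172035^5/15+2*0.9172035^7/105+17*0.9172035^9/2835+62*0.9172035^11/31185)
    ≤ (π/2)*((2.488 - π/2)^2/2+(2.488 - π/2)^4/12+(2.488 - π/2)^6/45+17*(2.488 - π/2)^8/2520+62*(2.488 - π/2)^10/28350)+ ((2.488 - π/2)^3/3+(2.488 - π/2)^5/15+2*(2.488 - π/2)^7/105+17*(2.488 - π/2)^9/2835+62*(2.488 - π/2)^11/31185) := by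
    gcongr
  refine (h.trans (sub_le_sub_left this _)).trans ?_
  norm_num at *
  nlinarith

lemma I_24824 : 0.0045 ≤ I 2.4824 := by
  have p1 := pi_gt_d6; have p2 := pi_lt_d6
  have l1 := log_two_gt_d9
  have h := I_lo (v := 2.4824 - π/2) (by linarith) (by linarith)
  rw [show π/2 + (2.4824 - π/2) = 2.4824 by ring] at h
  have hv : 2.4824 - π/2 ≤ (0.911604:ℝ) := by linarith
  have hv0 : 0 ≤ 2.4824 - π/2 := by linarith
  have : (π/2)*((2.4824 - π/2)^2/2+(2.4824 - π/2)^4/12+(2.4824 - π/2)^6/45+0.01375*(2.4824 - π/2)^8)+ ((2.4824 - π/2)^3/3+(2.4824 - π/2)^5/15+2*(2.4824 - π/2)^7/105+0.11*(2.4824 - π/2)^9/9)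
   ≤ (π/2)*(0.911604^2/2+0.911604^4/12+0.911604^6/45+0.01375*0.911604^8)+ (0.911604^3/3+0.911604^5/15+2*0.911604^7/105+0.11*0.911604^9/9) := by
    gcongr
  refine le_trans ?_ ((sub_le_sub_left this _).trans h)
  norm_num at *
  nlinarith
end QP
end

section
namespace QP
open Real intervalIntegral Set

noncomputable def F (n e : ℕ) (x : ℝ) : ℝ := Q n x + e * c x
noncomputable def F1 (n e : ℕ) (x : ℝ) : ℝ := ∑ k ∈ Finset.Icc 1 n, k * c1 (k * x) + e * c1 x
noncomputable def F2 (n e : ℕ) (x : ℝ) : ℝ := ∑ k ∈ Finset.Icc 1 n, k^2 * c2 (k * x) + e * c2 x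
noncomputable def A1 (n e : ℕ) (x : ℝ) : ℝ := Q1 n x + e * h1 x
noncomputable def A2 (n e : ℕ) (x : ℝ) : ℝ := Q2 n x + e * h2 x
noncomputable def f (n e : ℕ) (x : ℝ) : ℝ := S n x * sin x ^ e

lemma A1_eq (n e : ℕ) (x : ℝ) : A1 n e x = - x * F1 n e x := by
  unfold A1 F1 Q1 h1; rw [mul_add, Finset.mul_sum]; congr 1
  · refine Finset.sum_congr rfl fun k _ => by ring
  · ring
lemma A2_eq (n e : ℕ) (x : ℝ) : A2 n e x = - x^2 * F2 n e x := by
  unfold A2 F2 Q2 h2; rw [mul_add, Finset.mul_sum]; congr 1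
  · refine Finset.sum_congr rfl fun k _ => by ring
  · ring

lemma dom {n : ℕ} {x : ℝ} (hx : x ∈ Ioo 0 (π/n)) {k : ℕ} (hk : k ∈ Finset.Icc 1 n) : (k:ℝ) * x ∈ Ioo 0 π := by
  simp at hk
  have hn : (0:ℝ) < n := by have : 0 < n := by omega
                            positivity
  have h1 : (1:ℝ) ≤ k := by exact_mod_cast hk.1
  have h2 : (k:ℝ) ≤ n := by exact_mod_cast hk.2
  have h3 := hx.2
  rw [lt_div_iff₀ hn] at h3
  have := hx.1
  exact ⟨by positivity, by nlinarith⟩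

lemma dom1 {n : ℕ} (hn : 0 < n) {x : ℝ} (hx : x ∈ Ioo 0 (π/n)) : x ∈ Ioo 0 π := by
  have := dom hx (k := 1) (by simp; omega)
  simpa using this

lemma F_deriv {n e : ℕ} (hn : 0 < n) {x : ℝ} (hx : x ∈ Ioo 0 (π/n)) : HasDerivAt (F n e) (F1 n e x) x := by
  unfold F F1 Q
  refine HasDerivAt.add (HasDerivAt.fun_sum fun k hk => ?_) ((c_deriv (dom1 hn hx)).const_mul _)
  exact ((c_deriv (dom hx hk)).comp x ((hasDerivAt_id x).const_mul (k:ℝ))).congr_deriv (by simp; ring)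

lemma F1_deriv {n e : ℕ} (hn : 0 < n) {x : ℝ} (hx : x ∈ Ioo 0 (π/n)) : HasDerivAt (F1 n e) (F2 n e x) x := by
  unfold F1 F2
  refine HasDerivAt.add (HasDerivAt.fun_sum fun k hk => ?_) ((c1_deriv (dom1 hn hx)).const_mul _)
  exact (((c1_deriv (dom hx hk)).comp x ((hasDerivAt_id x).const_mul (k:ℝ))).const_mul (k:ℝ)).congr_deriv (by simp; ring)

lemma F2_anti {n e : ℕ} (hn : 0 < n) : AntitoneOn (F2 n e) (Ioo 0 (π/n)) := by
  intro x hx y hy hxy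
  unfold F2
  refine add_le_add (Finset.sum_le_sum fun k hk => ?_) ?_
  · have := c2_anti (dom hx hk) (dom hy hk) (by gcongr)
    gcongr
  · have := c2_anti (dom1 hn hx) (dom1 hn hy) hxy
    gcongr

lemma F2_neg {n e : ℕ} (hn : 0 < n) {x : ℝ} (hx : x ∈ Ioo 0 (π/n)) : F2 n e x < 0 := by
  unfold F2
  have h1 : ∑ k ∈ Finset.Icc 1 n, (k:ℝ)^2 * c2 (k * x) < 0 := by
    apply Finset.sum_neg
    · intro k hk
      have := c2_neg (dom hx hk)
      simp at hk
      have hk0 : (0:ℝ) < k := by have : 0 < k := by omega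
                                 positivity
      exact mul_neg_of_pos_of_neg (by positivity) this
    · exact ⟨1, by simp; omega⟩
  have h2 := c2_neg (dom1 hn hx)
  have : (0:ℝ) ≤ e := by positivity
  nlinarith

lemma F1_neg {n e : ℕ} (hn : 0 < n) {x : ℝ} (hx : x ∈ Ioo 0 (π/n)) : F1 n e x < 0 := by
  unfold F1
  have h1 : ∑ k ∈ Finset.Icc 1 n, (k:ℝ) * c1 (k * x) < 0 := by
    apply Finset.sum_neg
    · intro k hk
      have := c1_neg (dom hx hk)
      simp at hk
      have hk0 : (0:ℝ) < k := by have : 0 < k := by omega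
                                 positivity
      exact mul_neg_of_pos_of_neg (by positivity) this
    · exact ⟨1, by simp; omega⟩
  have h2 := c1_neg (dom1 hn hx)
  have : (0:ℝ) ≤ e := by positivity
  nlinarith

lemma F1_anti {n e : ℕ} (hn : 0 < n) : AntitoneOn (F1 n e) (Ioo 0 (π/n)) := by
  apply anti_of (convex_Ioo _ _) (fun x hx => (F1_deriv hn hx).continuousAt.continuousWithinAt) (f' := F2 n e) <;> rw [interior_Ioo]
  · exact fun x hx => F1_deriv hn hx
  · exact fun x hx => (F2_neg hn hx).le

lemma F_anti {n e : ℕ} (hn : 0 < n) : AntitoneOn (F n e) (Ioo 0 (π/n)) := by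
  apply anti_of (convex_Ioo _ _) (fun x hx => (F_deriv hn hx).continuousAt.continuousWithinAt) (f' := F1 n e) <;> rw [interior_Ioo]
  · exact fun x hx => F_deriv hn hx
  · exact fun x hx => (F1_neg hn hx).le

lemma S_pos {n : ℕ} {x : ℝ} (hx : x ∈ Ioo 0 (π/n)) : 0 < S n x := by
  unfold S; exact Finset.prod_pos fun k hk => by have := sinpos (dom hx hk); positivity

lemma f_pos {n e : ℕ} (hn : 0 < n) {x : ℝ} (hx : x ∈ Ioo 0 (π/n)) : 0 < f n e x := by
  have := S_pos hx; have := sinpos (dom1 hn hx); unfold f; positivity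

lemma f_cont (n e : ℕ) : Continuous (f n e) := by
  have := S_cont n; unfold f; fun_prop

lemma logf_deriv {n e : ℕ} (hn : 0 < n) {x : ℝ} (hx : x ∈ Ioo 0 (π/n)) :
    HasDerivAt (fun x => log (f n e x)) (F n e x / x) x := by
  have h0 := hx.1
  have hg : HasDerivAt (fun x => ∑ k ∈ Finset.Icc 1 n, log (2 * sin (k * x)) + e * log (sin x)) (F n e x / x) x := by
    unfold F Q
    rw [add_div, Finset.sum_div]
    refine HasDerivAt.add (HasDerivAt.fun_sum fun k hk => ?_) ?_
    · have hs := sinpos (dom hx hk)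
      refine ((((hasDerivAt_id x).const_mul (k:ℝ)).sin.const_mul 2).log (by simp; exact hs.ne')).congr_deriv ?_
      rw [c_eq (dom hx hk).1]; simp; field_simp
    · have hs := sinpos (dom1 hn hx)
      refine (((hasDerivAt_sin x).log hs.ne').const_mul (e:ℝ)).congr_deriv ?_
      rw [c_eq h0]; field_simp
  refine hg.congr_of_eventuallyEq ?_
  filter_upwards [isOpen_Ioo.mem_nhds hx] with y hy
  have hsy := sinpos (dom1 hn hy)
  unfold f
  rw [log_mul (S_pos hy).ne' (by positivity), log_pow, S, log_prod (fun k hk => ?_)]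
  have := sinpos (dom hy hk); positivity

lemma f_deriv {n e : ℕ} (hn : 0 < n) {x : ℝ} (hx : x ∈ Ioo 0 (π/n)) :
    HasDerivAt (f n e) (f n e x * (F n e x / x)) x := by
  have h := (logf_deriv (e := e) hn hx).exp
  rw [exp_log (f_pos hn hx)] at h
  refine h.congr_of_eventuallyEq ?_
  filter_upwards [isOpen_Ioo.mem_nhds hx] with y hy
  rw [exp_log (f_pos hn hy)]

lemma c_ge_cos {x : ℝ} (h : x ∈ Ioo 0 (π/2)) : 1 - x^2/2 ≤ c x := by
  have hs := sinpos (x := x) ⟨h.1, by linarith [h.2, pi_pos]⟩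
  have hc : 0 ≤ cos x := cos_nonneg_of_mem_Icc ⟨by linarith [h.1, pi_pos], h.2.le⟩
  have h1 := k2 h.1.le
  have h2 := s1 h.1.le
  have : cos x ≤ c x := by
    rw [c_eq h.1, le_div_iff₀ hs]; nlinarith
  linarith

lemma h1_small {x : ℝ} (h : x ∈ Ioo 0 (π/4)) : h1 x ≤ 2 * x^2 := by
  have hp := pi_pos
  have := tangent_le (convex_Ioo 0 π) (fun x hx => c_deriv hx) c1_anti (x := x) (u := 2*x) ⟨h.1, by linarith [h.2]⟩ ⟨by linarith [h.1], by linarith [h.2]⟩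
  have h2 := c_ge_cos (x := 2*x) ⟨by linarith [h.1], by linarith [h.2]⟩
  have h3 := c_le_one (x := x) ⟨h.1.le, by linarith [h.2]⟩
  unfold h1; nlinarith

lemma h2_small {x : ℝ} (h : x ∈ Ioo 0 (π/8)) : h2 x ≤ 4 * x^2 := by
  have hp := pi_pos; have h0 := h.1
  have := tangent_le (convex_Ioo 0 π) (fun x hx => c1_deriv hx) c2_anti (x := x) (u := 2*x) ⟨h.1, by linarith [h.2]⟩ ⟨by linarith [h.1], by linarith [h.2]⟩
  have h2 := h1_small (x := 2*x) ⟨by linarith [h.1], by linarith [h.2]⟩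
  have h3 := c1_neg (x := x) ⟨h.1, by linarith [h.2]⟩
  unfold QP.h2; unfold h1 at h2
  have e : x * (c2 x * (2 * x - x)) = x^2 * c2 x := by ring
  nlinarith

/-! numeric values of `T` -/
lemma mp {x : ℝ} (h0 : 0 < x) (h : x ≤ 3.14) : x ∈ Ioo 0 π := ⟨h0, by linarith [pi_gt_d2]⟩

lemma T22577 : 0.8201 ≤ T 2.2577 ∧ T 2.2577 ≤ 0.8203 :=
  ⟨T_ge (u := 0.6869035) (mp (by norm_num) (by norm_num)) (by norm_num) (by norm_num) (by norm_num) (by norm_num),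
   T_le (u := 0.6869040) (mp (by norm_num) (by norm_num)) (by norm_num) (by norm_num) (by norm_num) (by norm_num) (by norm_num)⟩
lemma T22641 : 0.8308 ≤ T 2.2641 ∧ T 2.2641 ≤ 0.8310 :=
  ⟨T_ge (u := 0.6933035) (mp (by norm_num) (by norm_num)) (by norm_num) (by norm_num) (by norm_num) (by norm_num),
   T_le (u := 0.6933040) (mp (by norm_num) (by norm_num)) (by norm_num) (by norm_num) (by norm_num) (by norm_num) (by norm_num)⟩
lemma T2481 : 1.2868 ≤ T 2.481 ∧ T 2.481 ≤ 1.2870 :=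
  ⟨T_ge (u := 0.9102035) (mp (by norm_num) (by norm_num)) (by norm_num) (by norm_num) (by norm_num) (by norm_num),
   T_le (u := 0.9102040) (mp (by norm_num) (by norm_num)) (by norm_num) (by norm_num) (by norm_num) (by norm_num) (by norm_num)⟩
lemma T24824 : 1.2906 ≤ T 2.4824 ∧ T 2.4824 ≤ 1.2907 :=
  ⟨T_ge (u := 0.9116035) (mp (by norm_num) (by norm_num)) (by norm_num) (by norm_num) (by norm_num) (by norm_num),
   T_le (u := 0.9116040) (mp (by norm_num) (by norm_num)) (by norm_num) (by norm_num) (by norm_num) (by norm_num) (by norm_num)⟩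
lemma T2488 : 1.3056 ≤ T 2.488 ∧ T 2.488 ≤ 1.3058 :=
  ⟨T_ge (u := 0.9172035) (mp (by norm_num) (by norm_num)) (by norm_num) (by norm_num) (by norm_num) (by norm_num),
   T_le (u := 0.9172040) (mp (by norm_num) (by norm_num)) (by norm_num) (by norm_num) (by norm_num) (by norm_num) (by norm_num)⟩
lemma T24894 : 1.3094 ≤ T 2.4894 ∧ T 2.4894 ≤ 1.3096 :=
  ⟨T_ge (u := 0.9186035) (mp (by norm_num) (by norm_num)) (by norm_num) (by norm_num) (by norm_num) (by norm_num),
   T_le (u := 0.9186040) (mp (by norm_num) (by norm_num)) (by norm_num) (by norm_num) (by norm_num) (by norm_num) (by norm_num)⟩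
lemma T25378 : 1.4498 ≤ T 2.5378 ∧ T 2.5378 ≤ 1.4500 :=
  ⟨T_ge (u := 0.9670035) (mp (by norm_num) (by norm_num)) (by norm_num) (by norm_num) (by norm_num) (by norm_num),
   T_le (u := 0.9670040) (mp (by norm_num) (by norm_num)) (by norm_num) (by norm_num) (by norm_num) (by norm_num) (by norm_num)⟩
lemma T25876 : 1.6164 ≤ T 2.5876 ∧ T 2.5876 ≤ 1.6166 :=
  ⟨T_ge (u := 1.0168035) (mp (by norm_num) (by norm_num)) (by norm_num) (by norm_num) (by norm_num) (by norm_num),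
   T_le (u := 1.0168040) (mp (by norm_num) (by norm_num)) (by norm_num) (by norm_num) (by norm_num) (by norm_num) (by norm_num)⟩
lemma T26249 : 1.7599 ≤ T 2.6249 ∧ T 2.6249 ≤ 1.7601 :=
  ⟨T_ge (u := 1.0541035) (mp (by norm_num) (by norm_num)) (by norm_num) (by norm_num) (by norm_num) (by norm_num),
   T_le (u := 1.0541040) (mp (by norm_num) (by norm_num)) (by norm_num) (by norm_num) (by norm_num) (by norm_num) (by norm_num)⟩
lemma T26622 : 1.9236 ≤ T 2.6622 ∧ T 2.6622 ≤ 1.9238 :=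
  ⟨T_ge (u := 1.0914035) (mp (by norm_num) (by norm_num)) (by norm_num) (by norm_num) (by norm_num) (by norm_num),
   T_le (u := 1.0914040) (mp (by norm_num) (by norm_num)) (by norm_num) (by norm_num) (by norm_num) (by norm_num) (by norm_num)⟩
end QP
end

section
open Real Set
namespace QP

/-- `α` is the point where `F n e` takes the value `v`. -/
structure Rt (n e : ℕ) (v α : ℝ) : Prop where
  hn : 901 ≤ n
  he : e ≤ 1
  v0 : 0 ≤ v
  v2 : v ≤ 1 + e
  lo : 2.481 ≤ n * α
  hi : n * α ≤ 2.488
  eq : F n e α = v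

lemma nR {n : ℕ} (hn : 901 ≤ n) : (901:ℝ) ≤ n := by exact_mod_cast hn

lemma inIoo {n : ℕ} (hn : 901 ≤ n) {x : ℝ} (h0 : 0 < x) (h : n * x ≤ 3.14) : x ∈ Ioo 0 (π/n) := by
  have := nR hn
  refine ⟨h0, ?_⟩
  rw [lt_div_iff₀ (by linarith)]; linarith [pi_gt_d2]

lemma xsmall {n : ℕ} (hn : 901 ≤ n) {x : ℝ} (h : n * x ≤ 3.14) : x ≤ 0.0035 := by
  have := nR hn
  by_contra hx
  push Not at hx
  nlinarith

lemma cc_T {x : ℝ} (h0 : 0 < x) (h : x ≤ 3.14) : c x = - x * T x := c_T (mp h0 h)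

lemma c_mono {x y : ℝ} (h0 : 0 < x) (hxy : x ≤ y) (h : y ≤ 3.14) : c y ≤ c x :=
  c_anti ⟨h0.le, by linarith [pi_gt_d2]⟩ ⟨by linarith, by linarith [pi_gt_d2]⟩ hxy

lemma T_le_of {x y : ℝ} (h0 : 0 < x) (hxy : x ≤ y) (h : y ≤ 3.14) : T x ≤ T y :=
  T_mono.monotoneOn (mp h0 (by linarith)) (mp (by linarith) h) hxy

lemma I_anti {x y : ℝ} (h0 : π/2 ≤ x) (hxy : x ≤ y) (h : y ≤ 3.14) : I y ≤ I x := by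
  have hp := pi_gt_d2
  refine le_of_deriv hxy (I_cont.mono fun u hu => ⟨by linarith [hu.1], by linarith [hu.2]⟩) (f' := c)
    (fun u hu => I_deriv ⟨by linarith [hu.1], by linarith [hu.2]⟩) (fun u hu => ?_)
  have hu1 : 0 < u := by linarith [hu.1]
  rw [c_eq hu1]
  have := sinpos (x := u) ⟨hu1, by linarith [hu.2]⟩
  have h3 : cos u ≤ 0 := cos_nonpos_of_pi_div_two_le_of_le (by linarith [hu.1]) (by linarith [hu.2])
  apply div_nonpos_of_nonpos_of_nonneg _ this.le
  nlinarith

lemma F_cont {n e : ℕ} (hn : 0 < n) : ContinuousOn (F n e) (Ioo 0 (π/n)) :=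
  fun x hx => (F_deriv hn hx).continuousAt.continuousWithinAt

lemma exists_root (n e : ℕ) (hn : 901 ≤ n) (he : e ≤ 1) (v : ℝ) (v0 : 0 ≤ v) (v2 : v ≤ 1 + e) : ∃ α, Rt n e v α := by
  have hR := nR hn
  have hp := pi_gt_d2
  have heR : (e:ℝ) ≤ 1 := by exact_mod_cast he
  have he0 : (0:ℝ) ≤ e := by positivity
  have hnp : (0:ℝ) < n := by linarith
  have e1 : n * (2.481 / (n:ℝ)) = 2.481 := by field_simp
  have e2 : n * (2.488 / (n:ℝ)) = 2.488 := by field_simp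
  have p1 : 0 < 2.481/(n:ℝ) := by positivity
  have p2 : 0 < 2.488/(n:ℝ) := by positivity
  have hle : 2.481/(n:ℝ) ≤ 2.488/(n:ℝ) := by gcongr; norm_num
  have m1 := inIoo hn p1 (by rw [e1]; norm_num)
  have m2 := inIoo hn p2 (by rw [e2]; norm_num)
  have q1 := xsmall hn (x := 2.481/(n:ℝ)) (by rw [e1]; norm_num)
  have q2 := xsmall hn (x := 2.488/(n:ℝ)) (by rw [e2]; norm_num)
  have up : F n e (2.488/n) ≤ v := by
    have h := Q_le n p2 (by rw [e2]; linarith)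
    rw [e2] at h
    have h1 := c_le_one (x := 2.488/(n:ℝ)) ⟨p2.le, by linarith⟩
    have h2 := cc_T (x := 2.488) (by norm_num) (by norm_num)
    have h3 := T2488
    have h4 := I_2488
    have h5 : (2.488/(n:ℝ)) * Q n (2.488/n) ≤ (2.488/n) * (-1) := by nlinarith
    have h6 := le_of_mul_le_mul_left h5 p2
    have : (e:ℝ) * c (2.488/n) ≤ 1 := by
      rcases Nat.le_one_iff_eq_zero_or_eq_one.1 he with rfl | rfl <;> simp; linarith
    unfold F; linarith
  have lo : v ≤ F n e (2.481/n) := by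
    have e3 : (n + 1/2) * (2.481/(n:ℝ)) = 2.481 + (2.481/n)/2 := by field_simp
    have h := Q_ge n p1 (by rw [e3]; linarith)
    rw [e3] at h
    have hx : 2.481/(n:ℝ) ≤ 2.481/901 := by gcongr
    have hx' : (2.481:ℝ)/901 ≤ 0.00276 := by norm_num
    have h7 := I_anti (x := 2.481 + (2.481/(n:ℝ))/2) (y := 2.4824) (by linarith [pi_lt_d2]) (by linarith) (by norm_num)
    have h4 := I_24824
    have hc := c_ge_cos (x := 2.481/(n:ℝ)) ⟨p1, by linarith⟩
    have h5 : (2.481/(n:ℝ)) * (1.125) ≤ (2.481/n) * Q n (2.481/n) := by nlinarith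
    have h6 := le_of_mul_le_mul_left h5 p1
    unfold F; nlinarith
  obtain ⟨α, hα, h⟩ := intermediate_value_Icc' hle ((F_cont (e := e) (by omega)).mono fun x hx => ⟨by linarith [hx.1], by linarith [hx.2, m2.2]⟩) ⟨up, lo⟩
  refine ⟨α, hn, he, v0, v2, ?_, ?_, h⟩
  · rw [← e1]; exact mul_le_mul_of_nonneg_left hα.1 hnp.le
  · rw [← e2]; exact mul_le_mul_of_nonneg_left hα.2 hnp.le

namespace Rt
variable {n e : ℕ} {v α : ℝ}
lemma R (h : Rt n e v α) : (901:ℝ) ≤ n := nR h.hn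
lemma n0 (h : Rt n e v α) : 0 < n := by have := h.hn; omega
lemma pos (h : Rt n e v α) : 0 < α := by
  have := h.R; have := h.lo
  by_contra hx
  push Not at hx
  nlinarith
lemma mem (h : Rt n e v α) : α ∈ Ioo 0 (π/n) := inIoo h.hn h.pos (by linarith [h.hi])
lemma small (h : Rt n e v α) : α ≤ 0.00277 := by
  have := h.R; have := h.hi
  by_contra hx
  push Not at hx
  nlinarith
lemma e0 (_h : Rt n e v α) : (0:ℝ) ≤ e := by positivity
lemma e1 (h : Rt n e v α) : (e:ℝ) ≤ 1 := by exact_mod_cast h.he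
lemma hat_lo (h : Rt n e v α) : 2.481 ≤ (n+1/2)*α := by linarith [h.lo, h.pos]
lemma hat_hi (h : Rt n e v α) : (n+1/2)*α ≤ 2.4894 := by linarith [h.hi, h.small]

lemma I0 (h : Rt n e v α) : 0 ≤ I (n*α) := by
  have hp := pi_gt_d2
  have h1 := Q_le n h.pos (by linarith [h.hi])
  have h2 := c_mono (x := 2.481) (y := n*α) (by norm_num) h.lo (by linarith [h.hi])
  have h3 := cc_T (x := 2.481) (by norm_num) (by norm_num)
  have h4 := T2481
  have h5 := c_le_one (x := α) ⟨h.pos.le, by linarith [h.small]⟩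
  have h6 : c (n*α) ≤ -1 := by nlinarith
  have h7 : Q n α = v - e * c α := by have := h.eq; unfold F at this; linarith
  rw [h7] at h1
  have h8 : (e:ℝ) * c α ≤ 1 := by
    rcases Nat.le_one_iff_eq_zero_or_eq_one.1 h.he with rfl | rfl <;> simp; linarith
  have := h.pos; have := h.v0
  nlinarith

lemma s_ge_c (h : Rt n e v α) : - n * c (n*α) ≤ A1 n e α := by
  have hp := pi_gt_d2
  have h1 := Q1_ge n h.pos (by linarith [h.hi])
  have h2 := h.I0
  unfold H1 at h1
  have h3 := h1_pos (x := α) ⟨h.pos, by linarith [h.small]⟩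
  have : - n * c (n*α) ≤ Q1 n α := by
    refine le_of_mul_le_mul_left (a := α) ?_ h.pos
    nlinarith
  unfold A1
  nlinarith [h.e0]

lemma s_lo (h : Rt n e v α) : 3.192 * n ≤ A1 n e α := by
  have h1 := h.s_ge_c
  have h2 := c_mono (x := 2.481) (y := n*α) (by norm_num) h.lo (by linarith [h.hi])
  have h3 := cc_T (x := 2.481) (by norm_num) (by norm_num)
  have h4 := T2481
  have := h.R
  nlinarith

lemma s_le_c (h : Rt n e v α) : A1 n e α ≤ v + 1/2 - e * 0.9999 + 0.0001 - (n+1/2) * c ((n+1/2)*α) := by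
  have hp := pi_gt_d2
  have h0 := h.pos
  have hs := h.small
  have h1 := Q1_le n h.pos (by linarith [h.hat_hi])
  have h2 := Q_ge n h.pos (by linarith [h.hat_hi])
  have h7 : Q n α = v - e * c α := by have := h.eq; unfold F at this; linarith
  have h3 := h1_small (x := α) ⟨h.pos, by linarith⟩
  have h4 := c_ge_cos (x := α) ⟨h.pos, by linarith⟩
  unfold H1 at h1
  rw [h7] at h2
  have h5 : Q1 n α ≤ v - e * c α + 1/2 - (n+1/2) * c ((n+1/2)*α) := by
    refine le_of_mul_le_mul_left (a := α) ?_ h.pos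
    nlinarith
  unfold A1
  have h8 : 0.99999 ≤ c α := by nlinarith
  have h9 : QP.h1 α ≤ 0.00002 := by nlinarith
  nlinarith [h.e0, h.e1]

lemma c_hat (h : Rt n e v α) : -3.2602 ≤ c ((n+1/2)*α) := by
  have h2 := c_mono (x := (n+1/2)*α) (y := 2.4894) (by linarith [h.hat_lo]) h.hat_hi (by norm_num)
  have h3 := cc_T (x := 2.4894) (by norm_num) (by norm_num)
  have h4 := T24894
  linarith

lemma s_hi (h : Rt n e v α) : A1 n e α ≤ 3.2652 * n := by
  have h1 := h.s_le_c
  have h2 := h.c_hat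
  have := h.R; have := h.e1; have := h.e0; have := h.v2
  nlinarith
end Rt

lemma A2_ge {n e : ℕ} (hn : 901 ≤ n) {x : ℝ} (h0 : 0 < x) (h : n * x ≤ 3.14) : H2 (n*x) / x ≤ A2 n e x := by
  have hp := pi_gt_d2
  have h1 := Q2_ge n h0 (by linarith)
  have h3 := h2_pos (x := x) ⟨h0, by linarith [xsmall hn h]⟩
  rw [div_le_iff₀ h0]
  unfold A2
  have : 0 ≤ (e:ℝ) * h2 x * x := by positivity
  nlinarith

lemma A2_le {n e : ℕ} (hn : 901 ≤ n) (he : e ≤ 1) {x : ℝ} (h0 : 0 < x) (h : n * x ≤ 3.14) : A2 n e x ≤ H2 (n*x) / x + h2 (n*x) + 1 := by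
  have hp := pi_gt_d2
  have hs := xsmall hn h
  have h1 := Q2_le n (by omega) h0 (by linarith)
  have h3 := h2_small (x := x) ⟨h0, by linarith [xsmall hn h]⟩
  have h4 : h2 x ≤ 1 := by nlinarith
  have h5 : (e:ℝ) ≤ 1 := by exact_mod_cast he
  have h6 := h2_pos (x := x) ⟨h0, by linarith [xsmall hn h]⟩
  have : Q2 n x ≤ H2 (n*x) / x + h2 (n*x) := by
    rw [← sub_le_iff_le_add, le_div_iff₀ h0]; nlinarith
  unfold A2
  nlinarith
end QP
end

section
open Real Set
namespace QP

lemma mu {a b A B C : ℝ} (ha : 0 ≤ a) (hA : a ≤ A) (hb : 0 ≤ b) (hB : b ≤ B) (h : A*B ≤ C) : a*b ≤ C :=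
  (mul_le_mul hA hB hb (ha.trans hA)).trans h
lemma ml {a b A B C : ℝ} (hA0 : 0 ≤ A) (hA : A ≤ a) (hB0 : 0 ≤ B) (hB : B ≤ b) (h : C ≤ A*B) : C ≤ a*b :=
  h.trans (mul_le_mul hA hB hB0 (hA0.trans hA))
lemma T246 : 1.22 ≤ T 2.46 :=
  T_ge (u := 0.8892) (mp (by norm_num) (by norm_num)) (by norm_num) (by norm_num) (by norm_num) (by norm_num)

lemma F_add4 (m e : ℕ) (x : ℝ) : F (m+4) e x = F m e x + (c ((m+1)*x) + c ((m+2)*x) + c ((m+3)*x) + c ((m+4)*x)) := by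
  have e1 := Q_succ m x
  have e2 := Q_succ (m+1) x
  have e3 := Q_succ (m+2) x
  have e4 := Q_succ (m+3) x
  push_cast at e1 e2 e3 e4
  rw [show (m:ℝ)+1+1 = m+2 by ring] at e2
  rw [show (m:ℝ)+2+1 = m+3 by ring] at e3
  rw [show (m:ℝ)+3+1 = m+4 by ring] at e4
  unfold F
  rw [e4, e3, e2, e1]; ring

lemma F_tangent {n e : ℕ} (hn : 0 < n) {x u : ℝ} (hx : x ∈ Ioo 0 (π/n)) (hu : u ∈ Ioo 0 (π/n)) :
    F n e u ≤ F n e x + F1 n e x * (u - x) :=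
  tangent_le (convex_Ioo _ _) (fun _ hx => F_deriv hn hx) (F1_anti hn) hx hu

lemma four_c {y d : ℝ} (hy : y ∈ Ioo 0 π) (h0 : 0 ≤ d) (h1 : 0 < y - 1.5*d) (h2 : y + 1.5*d < π) :
    c (y - 1.5*d) + c (y - 0.5*d) + c (y + 0.5*d) + c (y+1.5*d) ≤ 4 * c y := by
  have t := fun u (hu : u ∈ Ioo 0 π) => tangent_le (convex_Ioo 0 π) (fun x hx => c_deriv hx) c1_anti (x := y) (u := u) hy hu
  have a1 := t (y - 1.5*d) ⟨h1, by linarith⟩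
  have a2 := t (y - 0.5*d) ⟨by linarith, by linarith⟩
  have a3 := t (y + 0.5*d) ⟨by linarith, by linarith⟩
  have a4 := t (y + 1.5*d) ⟨by linarith, by linarith⟩
  nlinarith

set_option maxHeartbeats 2000000 in
lemma gap_lo {m : ℕ} {a b : ℝ} (ha : Rt m 1 2 a) (hb : Rt (m+4) 1 0 b) : π/(2*a) + 2.1 ≤ π/(2*b) := by
  have hp := pi_gt_d4
  have hp2 := pi_lt_d4
  have a0 := ha.pos
  have as := ha.small
  have R := ha.R
  set g := 4.2/π with hg
  have g1 : 1.3368 ≤ g := by rw [hg, le_div_iff₀ (by positivity)]; linarith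
  have g2 : g ≤ 1.337 := by rw [hg, div_le_iff₀ (by positivity)]; linarith
  set l := 1/(1+g*a) with hl
  have hD : 0 < 1+g*a := by positivity
  have l0 : 0 < l := by positivity
  have ga0 : 0 < g*a := by positivity
  have l1 : l ≤ 1 := by rw [hl, div_le_one hD]; linarith
  have l2 : 1 - l = l*(g*a) := by rw [hl]; field_simp; ring
  have la0 : 0 < l*a := by positivity
  have la1 : l*a ≤ a := by simpa using mul_le_mul_of_nonneg_right l1 a0.le
  set th := (m+1/2)*a with hth
  have th1 := ha.hat_lo
  have th2 := ha.hat_hi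
  rw [← hth] at th1 th2
  have key : F (m+4) 1 (l*a) < 0 := by
    rw [F_add4]
    have f1 := F_tangent (e := 1) ha.n0 ha.mem (u := l*a) ⟨la0, la1.trans_lt ha.mem.2⟩
    have f2 := A1_eq m 1 a
    have f3 := ha.s_le_c
    rw [← hth] at f3
    rw [ha.eq] at f1
    have f4 : F1 m 1 a * (l*a - a) = (1-l) * A1 m 1 a := by rw [f2]; ring
    rw [f4] at f1
    set C := c th with hC
    have cT := cc_T (x := th) (by linarith) (by linarith)
    have t1 := T_le_of (x := 2.481) (y := th) (by norm_num) th1 (by linarith)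
    have t2 := T_le_of (x := th) (y := 2.4894) (by linarith) th2 (by norm_num)
    have t3 := T2481.1
    have t4 := T24894.2
    set de := l*a*(g*th-2) with hde
    have q1 : 1.316 ≤ g*th-2 := by have := ml (by norm_num) g1 (by norm_num) th1 (C := 3.316) (by norm_num); linarith
    have q2 : g*th-2 ≤ 1.3284 := by have := mu (by linarith) g2 (by linarith) th2 (C := 3.3284) (by norm_num); linarith
    have d0 : 0 ≤ de := by positivity
    have d1 : de ≤ 0.00368 := by
      have : l*a ≤ 0.00277 := by linarith
      rw [hde]; exact mu la0.le this (by linarith) q2 (by norm_num)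
    have e1 : th - de = l*((m+2.5)*a) := by
      rw [hde]
      have : th * (1-l) = th * (l*(g*a)) := by rw [l2]
      have : th = (m+1/2)*a := hth
      linear_combination (norm := skip) this + (‹th * (1-l) = th * (l*(g*a))›) - (1-l)*this
      ring_nf
    have e2 : ∀ j : ℝ, (m+j)*(l*a) = (th-de) + (j-2.5)*(l*a) := by intro j; rw [e1]; ring
    have fc := four_c (y := th-de) (d := l*a) ⟨by linarith, by linarith⟩ la0.le (by linarith) (by linarith)
    rw [e2 1, e2 2, e2 3, e2 4]
    norm_num at fc ⊢
    rw [show th - de + -(3/2*(l*a)) = th - de - 3/2*(l*a) by ring, show th - de + -(1/2*(l*a)) = th - de - 1/2*(l*a) by ring]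
    have tg := tangent_le (convex_Ioo 0 π) (fun x hx => c_deriv hx) c1_anti (x := th) (u := th-de) ⟨by linarith, by linarith⟩ ⟨by linarith, by linarith⟩
    have cT1 := c1_T (x := th) ⟨by linarith, by linarith⟩
    have w1 : - c1 th ≤ 8.075 := by
      rw [cT1]
      have h1 : T th ^2 ≤ 1.7153 := by rw [sq]; exact mu (by linarith) (t2.trans t4) (by linarith) (t2.trans t4) (by norm_num)
      have h2 := mu (C := 6.761) (by linarith) th2 (by positivity) (show 1 + T th ^ 2 ≤ 2.7153 by linarith) (by norm_num)
      linarith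
    have w2 : c1 th * (th - de - th) ≤ 0.0298 := by
      have := mu (C := 0.0298) (by have := c1_neg (x := th) ⟨by linarith, by linarith⟩; linarith) w1 d0 d1 (by norm_num)
      linarith
    have w3 : (1-l) * A1 m 1 a ≤ 0.0056 + l*(g*th)*(-C) := by
      have : (1-l) * A1 m 1 a ≤ (1-l)*(1.5002 - (m+1/2)*C) := by
        refine mul_le_mul_of_nonneg_left ?_ (by linarith)
        norm_num at f3 ⊢; linarith
      have h5 : (1-l)*((m+1/2)*C) = l*(g*th)*C := by rw [l2, hth]; ring
      have h6 : 1 - l ≤ 0.00371 := by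
        rw [l2]; exact mu l0.le l1 ga0.le (mu (by linarith) g2 a0.le as le_rfl) (by norm_num)
      have h7 : (1-l)*1.5002 ≤ 0.0056 := by linarith
      linarith
    have w4 : 3.1925 ≤ -C := by rw [hC, cT]; have := ml (C := 3.1925) (by norm_num) th1 (by norm_num) (t3.trans t1) (by norm_num); linarith
    have w5 : l*(g*th) ≤ 3.3284 := mu l0.le l1 (by linarith) (show g*th ≤ 3.3284 by linarith) (by norm_num)
    have w6 : l*(g*th)*(-C) ≤ 3.3284*(-C) := mul_le_mul_of_nonneg_right w5 (by linarith)
    linarith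
  have hb2 : b ≤ l*a := by
    by_contra hx
    push Not at hx
    have := F_anti (e := 1) hb.n0 (a := l*a) (b := b) ⟨la0, hx.trans hb.mem.2⟩ hb.mem hx.le
    rw [hb.eq] at this; linarith
  have b0 := hb.pos
  have : π/(2*(l*a)) ≤ π/(2*b) := by gcongr
  have e : π/(2*(l*a)) = π/(2*a) + 2.1 := by
    rw [hl, hg]; field_simp; ring
  linarith

set_option maxHeartbeats 2000000 in
lemma gap_hi {m : ℕ} {a b : ℝ} (ha : Rt m 1 0 a) (hb : Rt (m+4) 1 2 b) : π/(2*b) ≤ π/(2*a) + 3.9 := by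
  have hp := pi_gt_d4
  have hp2 := pi_lt_d4
  have a0 := ha.pos
  have as := ha.small
  have R := ha.R
  have lo := ha.lo
  have hi := ha.hi
  set g := 7.8/π with hg
  have g1 : 2.48 ≤ g := by rw [hg, le_div_iff₀ (by positivity)]; linarith
  have g2 : g ≤ 2.49 := by rw [hg, div_le_iff₀ (by positivity)]; linarith
  set l := 1/(1+g*a) with hl
  have hD : 0 < 1+g*a := by positivity
  have l0 : 0 < l := by positivity
  have ga0 : 0 < g*a := by positivity
  have l1 : l ≤ 1 := by rw [hl, div_le_one hD]; linarith
  have l2 : 1 - l = l*(g*a) := by rw [hl]; field_simp; ring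
  have la0 : 0 < l*a := by positivity
  have la1 : l*a ≤ a := by simpa using mul_le_mul_of_nonneg_right l1 a0.le
  have l3 : 1 - l ≤ 0.0069 := by
    rw [l2]; exact mu l0.le l1 ga0.le (mu (by linarith) g2 a0.le as le_rfl) (by norm_num)
  have key : 2 < F (m+4) 1 (l*a) := by
    rw [F_add4]
    have mla : l*a ∈ Ioo 0 (π/m) := ⟨la0, la1.trans_lt ha.mem.2⟩
    have f1 := F_tangent (e := 1) ha.n0 mla (u := a) ha.mem
    have f2 := A1_eq m 1 (l*a)
    rw [ha.eq] at f1
    have x1 : 2.46 ≤ m*(l*a) := by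
      have := ml (C := 2.46) (by norm_num) (show 0.9931 ≤ l by linarith) (by norm_num) lo (by norm_num)
      linarith
    have x2 : m*(l*a) ≤ m*a := mul_le_mul_of_nonneg_left la1 (by linarith)
    have k1 := Q1_ge m la0 (by linarith)
    rw [H1_T (mp (by linarith) (by linarith))] at k1
    have k2 := I_anti (x := m*(l*a)) (y := m*a) (by linarith) x2 (by linarith)
    have k3 := ha.I0
    have k4 := T_le_of (x := 2.46) (y := m*(l*a)) (by norm_num) x1 (by linarith)
    have k5 := T246
    have k6 : 7.3 ≤ l*a*Q1 m (l*a) := by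
      have h1 : 6.05 ≤ (m*(l*a))^2 := by rw [sq]; exact ml (by norm_num) x1 (by norm_num) x1 (by norm_num)
      have := ml (C := 7.3) (by norm_num) h1 (by norm_num) (k5.trans k4) (by norm_num)
      linarith
    have k7 := h1_pos (x := l*a) ⟨la0, by linarith⟩
    have k8 : 7.3 ≤ l*a*A1 m 1 (l*a) := by unfold A1; push_cast; rw [mul_add]; have := mul_pos la0 k7; linarith
    have f4 : l * (F1 m 1 (l*a) * (a - l*a)) = - (1-l) * A1 m 1 (l*a) := by rw [f2]; ring
    have f5 : F1 m 1 (l*a) * (a - l*a) = - g * (l*a*A1 m 1 (l*a)) / l := by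
      rw [eq_div_iff l0.ne', mul_comm, f4, l2]; ring
    have f6 : 18.1 ≤ g * (l*a*A1 m 1 (l*a)) / l := by
      rw [le_div_iff₀ l0]; have := ml (C := 18.1) (by norm_num) g1 (by norm_num) k8 (by norm_num); linarith
    have cs : ∀ j : ℝ, 0 ≤ j → j ≤ 4 → -3.26 ≤ c ((m+j)*(l*a)) := by
      intro j j0 j4
      have : (m+j)*(l*a) ≤ m*a := by
        have : m * a * (1-l) = m*a*(l*(g*a)) := by rw [l2]
        have h6 : 4 ≤ m*a*g := ml (by norm_num) lo (by norm_num) g1 (by norm_num)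
        have h7 : 4*(l*a) ≤ m*a*g*(l*a) := mul_le_mul_of_nonneg_right h6 la0.le
        have h8 : j*(l*a) ≤ 4*(l*a) := mul_le_mul_of_nonneg_right j4 la0.le
        linarith
      have h1 := c_mono (x := (m+j)*(l*a)) (y := 2.488) (by positivity) (by linarith) (by norm_num)
      have h2 := cc_T (x := 2.488) (by norm_num) (by norm_num)
      have h3 := T2488.2
      linarith
    have c1' := cs 1 (by norm_num) (by norm_num)
    have c2' := cs 2 (by norm_num) (by norm_num)
    have c3' := cs 3 (by norm_num) (by norm_num)
    have c4' := cs 4 (by norm_num) (by norm_num)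
    rw [f5] at f1
    have : - g * (l*a*A1 m 1 (l*a)) / l = - (g * (l*a*A1 m 1 (l*a)) / l) := by ring
    linarith
  have hb2 : l*a ≤ b := by
    by_contra hx
    push Not at hx
    have m4 : ((m+4 : ℕ):ℝ) = m + 4 := by push_cast; ring
    have hl4 : l*a ∈ Ioo 0 (π/((m+4:ℕ):ℝ)) := by
      refine inIoo (by have := ha.hn; omega) la0 ?_
      rw [m4]; have := mul_le_mul_of_nonneg_left la1 (show (0:ℝ) ≤ m by linarith); linarith
    have := F_anti (e := 1) hb.n0 (a := b) (b := l*a) hb.mem hl4 hx.le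
    rw [hb.eq] at this; linarith
  have b0 := hb.pos
  have : π/(2*b) ≤ π/(2*(l*a)) := by gcongr
  have e : π/(2*(l*a)) = π/(2*a) + 3.9 := by
    rw [hl, hg]; field_simp; ring
  linarith
end QP
end

section
open Real Set
namespace QP

lemma taylor_le {g g1 g2 : ℝ → ℝ} {x u M : ℝ} (d1 : ∀ ξ ∈ uIcc x u, HasDerivAt g (g1 ξ) ξ)
    (d2 : ∀ ξ ∈ uIcc x u, HasDerivAt g1 (g2 ξ) ξ) (hM : ∀ ξ ∈ uIcc x u, g2 ξ ≤ M) :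
    g u ≤ g x + g1 x * (u - x) + M * (u-x)^2/2 := by
  have := tangent_le (f := fun u => g u - M * u^2/2) (f' := fun u => g1 u - M * u) (convex_uIcc x u)
    (fun ξ hξ => ((d1 ξ hξ).sub ((((hasDerivAt_id ξ).pow 2).const_mul M).div_const 2)).congr_deriv (by simp; ring))
    (anti_of (convex_uIcc x u) (f' := fun u => g2 u - M) (fun ξ hξ => ((d2 ξ hξ).continuousAt.continuousWithinAt.sub (by fun_prop)))
      (fun ξ hξ => ((d2 ξ (interior_subset hξ)).sub ((hasDerivAt_id ξ).const_mul M)).congr_deriv (by simp))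
      (fun ξ hξ => by linarith [hM ξ (interior_subset hξ)]))
    (x := x) (u := u) left_mem_uIcc right_mem_uIcc
  nlinarith

lemma taylor_ge {g g1 g2 : ℝ → ℝ} {x u M : ℝ} (d1 : ∀ ξ ∈ uIcc x u, HasDerivAt g (g1 ξ) ξ)
    (d2 : ∀ ξ ∈ uIcc x u, HasDerivAt g1 (g2 ξ) ξ) (hM : ∀ ξ ∈ uIcc x u, M ≤ g2 ξ) :
    g x + g1 x * (u - x) + M * (u-x)^2/2 ≤ g u := by
  have := taylor_le (g := fun x => - g x) (g1 := fun x => - g1 x) (g2 := fun x => - g2 x) (M := -M)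
    (fun ξ hξ => (d1 ξ hξ).neg) (fun ξ hξ => (d2 ξ hξ).neg) (fun ξ hξ => neg_le_neg (hM ξ hξ))
  nlinarith

section
variable {n e : ℕ} {x u p : ℝ}
lemma uI (_hn : 0 < n) (hx : x ∈ Ioo 0 (π/n)) (hu : u ∈ Ioo 0 (π/n)) : ∀ ξ ∈ uIcc x u, ξ ∈ Ioo 0 (π/n) := by
  intro ξ hξ
  have := (convex_Ioo 0 (π/(n:ℝ))).ordConnected
  exact this.uIcc_subset hx hu hξ

lemma F_T1 (hn : 0 < n) (hx : x ∈ Ioo 0 (π/n)) (hu : u ∈ Ioo 0 (π/n)) (hp : p ∈ Ioo 0 (π/n)) (h1 : p ≤ x) (h2 : p ≤ u) :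
    F n e u ≤ F n e x + F1 n e x * (u - x) + F2 n e p * (u-x)^2/2 :=
  taylor_le (fun ξ h => F_deriv hn (uI hn hx hu ξ h)) (fun ξ h => F1_deriv hn (uI hn hx hu ξ h))
    (fun ξ h => F2_anti hn hp (uI hn hx hu ξ h) ((le_min h1 h2).trans h.1))

lemma F_T2 (hn : 0 < n) (hx : x ∈ Ioo 0 (π/n)) (hu : u ∈ Ioo 0 (π/n)) (hp : p ∈ Ioo 0 (π/n)) (h1 : x ≤ p) (h2 : u ≤ p) :
    F n e x + F1 n e x * (u - x) + F2 n e p * (u-x)^2/2 ≤ F n e u :=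
  taylor_ge (fun ξ h => F_deriv hn (uI hn hx hu ξ h)) (fun ξ h => F1_deriv hn (uI hn hx hu ξ h))
    (fun ξ h => F2_anti hn (uI hn hx hu ξ h) hp (h.2.trans (max_le h1 h2)))
end

lemma scal1 {n e : ℕ} {a : ℝ} (_h : 0 < a) : F1 n e a * a = - A1 n e a := by rw [A1_eq]; ring
lemma scal2 {n e : ℕ} {p : ℝ} (h : 0 < p) : F2 n e p  = - A2 n e p / p^2 := by rw [A2_eq]; field_simp

/-- scaled upper Taylor bound: `u = a z`, `p = a r` -/
lemma F_U {n e : ℕ} (hn : 0 < n) {a z r : ℝ} (h0 : 0 < a) (hr : 0 < r) (hr1 : r ≤ 1) (hrz : r ≤ z) (h1 : a < π/n) (h2 : a*z < π/n) :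
    F n e (a*z) ≤ F n e a + A1 n e a * (1-z) - A2 n e (a*r)/r^2 * (1-z)^2/2 := by
  have := F_T1 (e := e) hn (x := a) (u := a*z) (p := a*r) ⟨h0, h1⟩ ⟨by have := hr.trans_le hrz; positivity, h2⟩
    ⟨by positivity, by nlinarith⟩ (by nlinarith) (by nlinarith)
  have e1 : F1 n e a * (a*z - a) = A1 n e a * (1-z) := by
    rw [show F1 n e a * (a*z - a) = F1 n e a * a * (z-1) by ring, scal1 h0]; ring
  rw [e1, scal2 (by positivity : 0 < a*r)] at this
  refine this.trans (le_of_eq ?_)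
  field_simp
  ring

lemma F_D {n e : ℕ} (hn : 0 < n) {a z r : ℝ} (h0 : 0 < a) (hz : 0 < z) (hr1 : 1 ≤ r) (hrz : z ≤ r) (h1 : a*r < π/n) :
    F n e a + A1 n e a * (1-z) - A2 n e (a*r)/r^2 * (1-z)^2/2 ≤ F n e (a*z) := by
  have hr : 0 < r := by linarith
  have := F_T2 (e := e) hn (x := a) (u := a*z) (p := a*r) ⟨h0, by nlinarith⟩ ⟨by positivity, by nlinarith⟩
    ⟨by positivity, h1⟩ (by nlinarith) (by nlinarith)
  have e1 : F1 n e a * (a*z - a) = A1 n e a * (1-z) := by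
    rw [show F1 n e a * (a*z - a) = F1 n e a * a * (z-1) by ring, scal1 h0]; ring
  rw [e1, scal2 (by positivity : 0 < a*r)] at this
  refine le_trans (le_of_eq ?_) this
  field_simp
  ring

lemma exp541 : 0.57 ≤ exp (-0.541) := by
  have h : 1 - 0.541/8 ≤ exp (-(0.541/8)) := one_sub_le_exp_neg _
  have : exp (-0.541) = exp (-(0.541/8))^8 := by rw [← exp_nat_mul]; norm_num
  rw [this]
  calc (0.57:ℝ) ≤ (1 - 0.541/8)^8 := by norm_num
    _ ≤ _ := by gcongr

/-- lower bound of `f` in a window to the left of the root -/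
lemma f_window {n e : ℕ} {v a Y : ℝ} (h : Rt n e v a) (hY0 : 0 < Y) (hY : Y ≤ 0.0184) (hYn : Y^2 * n ≤ 0.3025) {x : ℝ}
    (hx : x ∈ Icc (a*(1-Y)) a) : 0.57 * f n e a ≤ f n e x := by
  have a0 := h.pos
  have hm := h.mem
  have hA := A1_eq n e a
  have sh := h.s_hi
  have sl := h.s_lo
  have R := h.R
  set s := A1 n e a with hs
  have h1Y : 0 < 1 - Y := by linarith
  have dm : ∀ u ∈ Icc x a, u ∈ Ioo 0 (π/n) := fun u hu => ⟨lt_of_lt_of_le (by positivity) (hx.1.trans hu.1), hu.2.trans_lt hm.2⟩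
  have key := le_of_deriv (f := fun u => log (f n e u) + (v + s*Y/2)/(1-Y)* ((a-u)/a) + s/(2*(1-Y))*(((a-u)/a)^2 - Y*((a-u)/a)))
    (f' := fun u => F n e u / u - (v + s*Y/2)/(1-Y)/a - s/(2*(1-Y))*(2*((a-u)/a) - Y)/a) hx.2
    (fun u hu => by
      have := (logf_deriv (e := e) h.n0 (dm u hu)).continuousAt
      exact (((this).add (by fun_prop)).add (by fun_prop)).continuousWithinAt)
    (fun u hu => by
      have d := logf_deriv (e := e) h.n0 (dm u ⟨hu.1.le, hu.2.le⟩)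
      have d2 : HasDerivAt (fun u => (a-u)/a) (-1/a) u := ((hasDerivAt_id u).const_sub a).div_const a
      refine ((d.add (d2.const_mul _)).add (((d2.pow 2).sub (d2.const_mul Y)).const_mul _)).congr_deriv ?_
      simp; ring)
    (fun u hu => by
      have du := dm u ⟨hu.1.le, hu.2.le⟩
      have t := F_tangent (e := e) h.n0 hm du
      rw [h.eq] at t
      have e1 : F1 n e a * (u - a) = s * ((a-u)/a) := by rw [hA]; field_simp; ring
      rw [e1] at t
      have hu1 : a*(1-Y) ≤ u := hx.1.trans hu.1.le
      have p1 : 0 ≤ (a-u)/a := div_nonneg (by linarith [hu.2]) a0.le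
      have p2 : 0 ≤ v + s*((a-u)/a) := by have := h.v0; have : 0 ≤ s := by linarith
                                          positivity
      have : F n e u / u ≤ (v + s*((a-u)/a))/(a*(1-Y)) := by
        calc F n e u / u ≤ (v + s*((a-u)/a))/u := by have := du.1; gcongr
          _ ≤ _ := by gcongr
      have e2 : (v + s*((a-u)/a))/(a*(1-Y)) = (v + s*Y/2)/(1-Y)/a + s/(2*(1-Y))*(2*((a-u)/a) - Y)/a := by
        field_simp; ring
      linarith)
  simp only [sub_self, zero_div] at key
  have fx := f_pos (e := e) h.n0 (dm x ⟨le_rfl, hx.2⟩)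
  have fa := f_pos (e := e) h.n0 hm
  set y := (a-x)/a with hy
  have y0 : 0 ≤ y := div_nonneg (by linarith [hx.2]) a0.le
  have y1 : y ≤ Y := by rw [hy, div_le_iff₀ a0]; linarith [hx.1]
  have hv2 : v ≤ 2 := by linarith [h.v2, h.e1]
  have s0 : 0 ≤ s := by linarith
  have b1 : s * Y^2 ≤ 0.98773 := by have := mul_le_mul_of_nonneg_right sh (sq_nonneg Y); nlinarith
  have b2 : (v + s*Y/2)/(1-Y)* y + s/(2*(1-Y))*(y^2 - Y*y) ≤ 0.541 := by
    have : (v + s*Y/2)/(1-Y)* y + s/(2*(1-Y))*(y^2 - Y*y) = (v*y + s*y^2/2)/(1-Y) := by field_simp; ring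
    rw [this, div_le_iff₀ h1Y]
    have : v*y ≤ 2*0.0184 := by have := h.v0; exact mul_le_mul hv2 (y1.trans hY) y0 (by norm_num)
    have : s*y^2 ≤ s*Y^2 := by gcongr
    linarith
  have b3 : log (f n e a) - 0.541 ≤ log (f n e x) := by norm_num at key; linarith
  have b4 := exp_le_exp.2 b3
  rw [exp_log fx, sub_eq_add_neg, exp_add, exp_log fa] at b4
  have := exp541
  nlinarith
end QP
end

section
open Real Set
namespace QP

lemma H2_mono' {x y : ℝ} (h0 : 0 < x) (hxy : x ≤ y) (h : y ≤ 3.14) : H2 x ≤ H2 y := by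
  have hp := pi_gt_d2
  have := mono_of (convex_Icc x y) (f := H2) (f' := h2) (H2_cont.mono fun u hu => ⟨by linarith [hu.1], by linarith [hu.2]⟩)
    (fun u hu => by rw [interior_Icc] at hu; exact H2_deriv ⟨by linarith [hu.1], by linarith [hu.2]⟩)
    (fun u hu => by rw [interior_Icc] at hu; exact (h2_pos ⟨by linarith [hu.1], by linarith [hu.2]⟩).le)
  exact this ⟨le_rfl, hxy⟩ ⟨hxy, le_rfl⟩ hxy

lemma I_up_2488 {x : ℝ} (h0 : 0 < x) (h : x < 2.488) : I x ≤ (2.488 - x) * ((x * T x + 3.2489)/2) := by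
  have h1 := I_trap h0.le h (by linarith [pi_gt_d2])
  have h2 := cc_T (x := 2.488) (by norm_num) (by norm_num)
  have h3 := cc_T (x := x) h0 (by linarith)
  have h4 := T2488.2
  have h5 := I_2488
  have h6 : -3.2489 ≤ c 2.488 := by linarith
  have := mul_le_mul_of_nonneg_left h6 (show 0 ≤ 2.488 - x by linarith)
  rw [h3] at h1
  linarith

lemma H2_22577 : 13.88 ≤ H2 2.2577 := by
  rw [H2_T (mp (by norm_num) (by norm_num))]
  have h1 := I_up_2488 (x := 2.2577) (by norm_num) (by norm_num)
  have ⟨h2, h3⟩ := T22577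
  have : 0.82^2 ≤ T 2.2577 ^2 := by gcongr; linarith
  norm_num at this h1 h2 h3 ⊢
  nlinarith

lemma H2_2481 : 32 ≤ H2 2.481 := by
  rw [H2_T (mp (by norm_num) (by norm_num))]
  have h1 := I_up_2488 (x := 2.481) (by norm_num) (by norm_num)
  have ⟨h2, h3⟩ := T2481
  have : 1.286^2 ≤ T 2.481 ^2 := by gcongr; linarith
  norm_num at this h1 h2 h3 ⊢
  nlinarith

namespace Rt
variable {n e : ℕ} {v a : ℝ}

lemma A2_lo (h : Rt n e v a) : 2 * A1 n e a ≤ A2 n e a := by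
  have h1 := A2_ge (e := e) h.hn h.pos (by linarith [h.hi])
  have h2 := H2_mono' (x := 2.481) (y := n*a) (by norm_num) h.lo (by linarith [h.hi])
  have h3 := H2_2481
  have h4 : 6.6 * n ≤ H2 (n*a)/a := by
    rw [le_div_iff₀ h.pos]; nlinarith [h.hi]
  have := h.s_hi
  have := h.R
  linarith

lemma A2_91 (h : Rt n e v a) : 1.0372 * (2 * A1 n e a) ≤ A2 n e (a*0.91) / 0.91^2 := by
  have e1 : n * (a*0.91) = (n*a)*0.91 := by ring
  have h1 := A2_ge (e := e) h.hn (x := a*0.91) (by linarith [h.pos]) (by linarith [h.hi])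
  have h2 := H2_mono' (x := 2.2577) (y := n*(a*0.91)) (by norm_num) (by linarith [h.lo]) (by linarith [h.hi])
  have h3 := H2_22577
  have h4 : 6.13 * n ≤ H2 (n*(a*0.91))/(a*0.91) := by
    rw [le_div_iff₀ (by linarith [h.pos])]; linarith [h.hi]
  have := h.s_hi
  have := h.R
  norm_num
  linarith

lemma A2_hi (h : Rt n e v a) : A2 n e a ≤ 13.78 * n := by
  have h1 := A2_le (e := e) h.hn h.he h.pos (by linarith [h.hi])
  have lo := h.lo
  have hi := h.hi
  have R := h.R
  have m1 : n*a ∈ Ioo 0 π := mp (by linarith) (by linarith)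
  have i0 := h.I0
  rw [H2_T m1, h2_T m1] at h1
  have t1 := T_le_of (x := 2.481) (y := n*a) (by norm_num) lo (by linarith)
  have t2 := T_le_of (x := n*a) (y := 2.488) (by linarith) hi (by norm_num)
  have t3 := T2481.1
  have t4 := T2488.2
  set t := n*a with ht
  set w := T t with hw
  have w1 : 1.2868 ≤ w := t3.trans t1
  have w2 : w ≤ 1.3058 := t2.trans t4
  have t0 : 0 ≤ t := by linarith
  have b1 : w^2 ≤ 1.3058^2 := by gcongr
  have b2 : t^3 ≤ 2.488^3 := by gcongr
  have b3 : t^2 ≤ 2.488^2 := by gcongr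
  have b4 : 2.481^2 ≤ t^2 := by gcongr
  have c1 := mu (C := 41.67) (by positivity) b2 (by positivity) (show 1 + w^2 ≤ 1+1.3058^2 by linarith) (by norm_num)
  have c2 := ml (C := 7.92) (by norm_num) b4 (by norm_num) w1 (by norm_num)
  have c3 := mu (C := 3.2489) t0 hi (by linarith) w2 (by norm_num)
  have c4 := mu (C := 53) (show 0 ≤ 2*t^2 by positivity) (show 2*t^2 ≤ 2*2.488^2 by linarith) (show 0 ≤ 1 + t*w by have := mul_nonneg t0 (by linarith : 0 ≤ w); linarith) (show 1 + t*w ≤ 4.2489 by linarith) (by norm_num)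
  have c5 := mu (C := 144) (show 0 ≤ 2*t^2*(1+t*w) by have := mul_nonneg t0 (by linarith : 0 ≤ w); positivity) c4 (by positivity) (show 1 + w^2 ≤ 1+1.3058^2 by linarith) (by norm_num)
  have d1 : (t^3 * (1+w^2) - t^2*w - 2 * I t)/a ≤ 13.61*n := by
    rw [div_le_iff₀ h.pos]
    have : 13.61*n*a = 13.61*t := by rw [ht]; ring
    linarith
  linarith

/-- `f` drops exponentially from the root to `0.91` times the root -/
lemma f_drop (h : Rt n e v a) : f n e (a*0.91) ≤ f n e a * exp (-(0.0112*n)) := by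
  have a0 := h.pos
  have sl := h.s_lo
  have qh := h.A2_hi
  have R := h.R
  set s := A1 n e a with hs
  set q := A2 n e a with hq
  have dm : ∀ u ∈ Icc (a*0.91) a, u ∈ Ioo 0 (π/n) := fun u hu => ⟨lt_of_lt_of_le (by positivity) (hu.1), hu.2.trans_lt h.mem.2⟩
  have key := le_of_deriv (f := fun u => -log (f n e u) - (s * ((a-u)/a)^2/2 - q * ((a-u)/a)^3/6))
    (f' := fun u => - (F n e u / u) + (s * ((a-u)/a) - q * ((a-u)/a)^2/2)/a) (p := a*0.91) (q := a) (by linarith)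
    (fun u hu => by
      have := (logf_deriv (e := e) h.n0 (dm u hu)).continuousAt
      exact (this.neg.sub (by fun_prop)).continuousWithinAt)
    (fun u hu => by
      have d := logf_deriv (e := e) h.n0 (dm u ⟨hu.1.le, hu.2.le⟩)
      have d2 : HasDerivAt (fun u => (a-u)/a) (-1/a) u := ((hasDerivAt_id u).const_sub a).div_const a
      refine (d.neg.sub ((((d2.pow 2).const_mul s).div_const 2).sub (((d2.pow 3).const_mul q).div_const 6))).congr_deriv ?_
      simp; ring)
    (fun u hu => by
      have du := dm u ⟨hu.1.le, hu.2.le⟩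
      have t := F_D (e := e) h.n0 a0 (z := u/a) (r := 1) (div_pos du.1 a0) le_rfl ((div_le_one a0).2 hu.2.le) (by simpa using h.mem.2)
      rw [h.eq, mul_div_cancel₀ _ a0.ne', mul_one, ← hs, ← hq] at t
      have e1 : 1 - u/a = (a-u)/a := by field_simp
      rw [e1] at t
      set y := (a-u)/a with hy
      have y0 : 0 ≤ y := div_nonneg (by linarith [hu.2]) a0.le
      have y1 : y ≤ 0.09 := by rw [hy, div_le_iff₀ a0]; linarith [hu.1]
      have v0 := h.v0
      have b1 : s*y - q*y^2/2 ≤ F n e u := by norm_num at t; linarith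
      have b2 : 0 ≤ s*y - q*y^2/2 := by
        have : q*y ≤ s := by
          have := mul_le_mul_of_nonneg_right qh y0
          have : 13.78*n*y ≤ 13.78*n*0.09 := by gcongr
          linarith
        have := mul_le_mul_of_nonneg_right this y0
        have : 0 ≤ s*y := by have : 0 ≤ s := by linarith
                             positivity
        nlinarith
      have : (s*y - q*y^2/2)/a ≤ F n e u/u := by
        have := du.1; have := hu.2
        calc (s*y - q*y^2/2)/a ≤ (s*y - q*y^2/2)/u := by gcongr
          _ ≤ _ := by gcongr
      linarith)
  simp only [sub_self, zero_div] at key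
  have e2 : (a - a*0.91)/a = 0.09 := by field_simp; norm_num
  rw [e2] at key
  have f1 := f_pos (e := e) h.n0 (dm (a*0.91) ⟨le_rfl, by linarith⟩)
  have f2 := f_pos (e := e) h.n0 h.mem
  have : log (f n e (a*0.91)) ≤ log (f n e a) + -(0.0112*n) := by norm_num at key ⊢; linarith
  have := exp_le_exp.2 this
  rwa [exp_add, exp_log f1, exp_log f2] at this

lemma point_i (h : Rt n e 0 a) {z : ℝ} (hz : 0.91 ≤ z) (hz2 : a*z < π/n) :
    (π/2)/A1 n e a * F n e (a*z) ≤ z * cos (π*z/2) := by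
  have a0 := h.pos
  have sl := h.s_lo
  have R := h.R
  have s0 : 0 < A1 n e a := by linarith
  have hp := pi_pos
  have hp4 := pi_lt_d4
  rw [div_mul_eq_mul_div, div_le_iff₀ s0]
  rcases le_total 1 z with h1 | h1
  · have t := F_U (e := e) h.n0 a0 (z := z) (r := 1) one_pos le_rfl h1 h.mem.2 hz2
    rw [h.eq, mul_one] at t
    have q := h.A2_lo
    have e1 : cos (π*z/2) = - sin (π*(z-1)/2) := by
      rw [← cos_add_pi_div_two]; congr 1; ring
    have s1' := s1 (x := π*(z-1)/2) (by have : 0 ≤ z-1 := by linarith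
                                        positivity)
    rw [e1]
    have w1 : F n e (a*z) ≤ -(A1 n e a * (z*(z-1))) := by
      have := mul_le_mul_of_nonneg_right q (sq_nonneg (1-z))
      norm_num at t; nlinarith
    have w2 : π/2 * F n e (a*z) ≤ π/2 * -(A1 n e a * (z*(z-1))) := by gcongr
    have w3 : z * sin (π*(z-1)/2) ≤ z*(π*(z-1)/2) := by gcongr; linarith
    have w4 := mul_le_mul_of_nonneg_right w3 s0.le
    linarith
  · have t := F_U (e := e) h.n0 a0 (z := z) (r := 0.91) (by norm_num) (by norm_num) hz h.mem.2 hz2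
    rw [h.eq] at t
    have q := h.A2_91
    set y := 1 - z with hy
    have y0 : 0 ≤ y := by linarith
    have y1 : y ≤ 0.09 := by linarith
    have e1 : cos (π*z/2) = sin (π*y/2) := by
      rw [← cos_pi_div_two_sub]; congr 1; rw [hy]; ring
    have sx := s3 (x := π*y/2) (by positivity)
    rw [e1]
    have w0 := mul_le_mul_of_nonneg_right q (sq_nonneg y)
    have w1 : F n e (a*z) ≤ A1 n e a * (y - 1.0372*y^2) := by linarith
    have w2 : π/2 * F n e (a*z) ≤ π/2 * (A1 n e a * (y - 1.0372*y^2)) := by gcongr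
    have pp : π^2 ≤ 9.87 := by nlinarith
    have w3 : π/2*(y*(1-0.4113*y^2)) ≤ sin (π*y/2) := by
      have : (π*y/2)^3/6 ≤ π/2*(y*(0.4113*y^2)) := by
        have : (π*y/2)^3/6 = π^2*(π*y^3)/48 := by ring
        rw [this]
        have : π^2*(π*y^3) ≤ 9.87*(π*y^3) := by gcongr
        have : 0 ≤ π*y^3 := by positivity
        linarith
      linarith
    have w4 : z*(π/2*(y*(1-0.4113*y^2))) ≤ z * sin (π*y/2) := by gcongr
    have w5 : y - 1.0372*y^2 ≤ z*(y*(1-0.4113*y^2)) := by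
      have : z = 1 - y := by linarith
      rw [this]
      have : 0 ≤ y^2*(0.0372 - 0.4113*y) := mul_nonneg (sq_nonneg y) (by linarith)
      have : 0 ≤ y^4 := by positivity
      nlinarith
    have w6 : π/2 * (A1 n e a * (y - 1.0372*y^2)) ≤ π/2 * (A1 n e a * (z*(y*(1-0.4113*y^2)))) := by gcongr
    have w7 := mul_le_mul_of_nonneg_right w4 s0.le
    linarith
end Rt
end QP
end

section
open Real Set MeasureTheory
namespace QP

lemma f_nonneg {n e : ℕ} (hn : 0 < n) {x : ℝ} (hx : x ∈ Icc 0 (π/n)) : 0 ≤ f n e x := by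
  have hn' : (0:ℝ) < n := by exact_mod_cast hn
  have hn1 : (1:ℝ) ≤ n := by exact_mod_cast hn
  have h2 := hx.2
  rw [le_div_iff₀ hn'] at h2
  unfold f S
  refine mul_nonneg (Finset.prod_nonneg fun k hk => ?_) (pow_nonneg ?_ _)
  · simp at hk
    have hk2 : (k:ℝ) ≤ n := by exact_mod_cast hk.2
    have : 0 ≤ sin (k*x) := sin_nonneg_of_nonneg_of_le_pi (mul_nonneg (by positivity) hx.1) (by nlinarith [hx.1])
    positivity
  · exact sin_nonneg_of_nonneg_of_le_pi hx.1 (by nlinarith [hx.1])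

lemma expdec {n : ℕ} (hn : 901 ≤ n) {k : ℝ} (hk : 1/901 ≤ k) : exp (-(k*n)) ≤ exp (-(k*901)) * (901/n) := by
  have R := nR hn
  have h1 : -(k*n) = -(k*901) + -(k*(n-901)) := by ring
  rw [h1, exp_add]
  gcongr
  rw [exp_neg, inv_le_comm₀ (exp_pos _) (by positivity), inv_div]
  have := add_one_le_exp (k*((n:ℝ)-901))
  have h2 : (n:ℝ)/901 ≤ k*(n-901) + 1 := by
    have : 1/901*((n:ℝ)-901) ≤ k*(n-901) := by gcongr
    linarith
  linarith

lemma sq_facts {n : ℕ} (hn : 901 ≤ n) : (30.01:ℝ) ≤ √n ∧ √n * √n = n ∧ 901/(n:ℝ) ≤ 30.03/√n := by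
  have R := nR hn
  have h1 : (30.01:ℝ) ≤ √n := by apply le_sqrt_of_sq_le; norm_num; linarith
  have h2 : √n * √n = (n:ℝ) := mul_self_sqrt (by linarith)
  refine ⟨h1, h2, ?_⟩
  rw [div_le_div_iff₀ (by linarith) (by linarith)]
  nlinarith

lemma expm1 : exp (-1) ≤ 0.36788 := by
  rw [exp_neg, inv_le_comm₀ (exp_pos _) (by norm_num)]
  have := exp_one_gt_d9
  norm_num at *; linarith

lemma exp_m {x : ℝ} (k : ℕ) (h : k ≤ x) : exp (-x) ≤ 0.36788^k := by
  have : exp (-x) ≤ exp (-1)^k := by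
    rw [← exp_nat_mul]; apply exp_le_exp.2; linarith
  exact this.trans (pow_le_pow_left₀ (exp_pos _).le expm1 k)

lemma cosdiff {B h : ℝ} (h1 : 1.5 ≤ B) (h2 : B ≤ 1.64) (h0 : 0 ≤ h) (hh : h ≤ 0.001) : 0.99*h ≤ cos (B-h) - cos B := by
  have hp := pi_gt_d2
  have hp2 := pi_lt_d2
  have a1 : 1 - (B-π/2)^2/2 ≤ sin B := by
    rw [← cos_sub_pi_div_two]; exact one_sub_sq_div_two_le_cos
  have a2 : (B-π/2)^2 ≤ 0.0064 := by nlinarith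
  have a3 := s3 h0
  have a4 := k2 h0
  have a5 := cos_le_one h
  have a6 := cos_le_one B
  rw [cos_sub]
  have b1 : cos B*(1 - cos h) ≤ 1*(1-cos h) := by gcongr
  have b2 : h^2 ≤ 0.001*h := by nlinarith
  have b3 : h^3 ≤ 0.001*h := by nlinarith
  have b4 : 0.9968*(0.999*h) ≤ sin B * sin h := by
    apply mul_le_mul <;> linarith
  linarith

lemma fc_cont (n e : ℕ) (y : ℝ) : Continuous fun t => f n e t * cos (y*t) := by
  have := f_cont n e; fun_prop

lemma fc_int (n e : ℕ) (y p q : ℝ) : IntervalIntegrable (fun t => f n e t * cos (y*t)) volume p q :=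
  (fc_cont n e y).intervalIntegrable _ _

/-- the gain -/
lemma gain {n : ℕ} {v a : ℝ} (h : Rt n 1 v a) {D : ℝ → ℝ} (Dc : Continuous D) (D0 : ∀ t ∈ Icc 0 (π/n), 0 ≤ D t)
    (D1 : ∀ t ∈ Icc (a*(1-0.0184)) a, 0.0495*t*f n 1 t ≤ D t) :
    0.0377/(n*√n)*(a * f n 1 a) ≤ ∫ t in (0:ℝ)..(π/n), D t := by
  have a0 := h.pos
  have R := h.R
  obtain ⟨r1, r2, r3⟩ := sq_facts h.hn
  set Y := 0.55/√n with hY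
  have Y0 : 0 < Y := by positivity
  have Y1 : Y ≤ 0.0184 := by rw [hY, div_le_iff₀ (by linarith)]; linarith
  have Y2 : Y^2*n ≤ 0.3025 := by
    rw [hY, div_pow, sq (√(n:ℝ)), r2]; field_simp; norm_num
  have fa := f_pos (e := 1) h.n0 h.mem
  have hw : ∀ t ∈ Icc (a*(1-Y)) a, 0.0495*(a*0.9816)*(0.57*f n 1 a) ≤ D t := by
    intro t ht
    have ht1 : a*(1-0.0184) ≤ t := le_trans (by gcongr) ht.1
    refine le_trans ?_ (D1 t ⟨ht1, ht.2⟩)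
    have := f_window h Y0 Y1 Y2 ht
    have : 0 ≤ t := le_trans (by norm_num; positivity) ht1
    gcongr
    linarith
  have haY : a*(1-Y) ≤ a := by nlinarith
  have i1 : (a - a*(1-Y)) * (0.0495*(a*0.9816)*(0.57*f n 1 a)) ≤ ∫ t in (a*(1-Y))..a, D t := by
    have := intervalIntegral.integral_mono_on (μ := volume) (f := fun _ => 0.0495*(a*0.9816)*(0.57*f n 1 a)) (g := D) haY
      intervalIntegrable_const (Dc.intervalIntegrable _ _) hw
    rw [intervalIntegral.integral_const, smul_eq_mul] at this; exact this
  have i2 : ∫ t in (a*(1-Y))..a, D t ≤ ∫ t in (0:ℝ)..(π/n), D t := by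
    refine intervalIntegral.integral_mono_interval (by apply mul_nonneg a0.le; linarith) haY h.mem.2.le ?_ (Dc.intervalIntegrable _ _)
    filter_upwards [ae_restrict_mem measurableSet_Ioc] with t ht
    exact D0 t ⟨ht.1.le, ht.2⟩
  refine le_trans ?_ (i1.trans i2)
  have e1 : (a - a*(1-Y)) * (0.0495*(a*0.9816)*(0.57*f n 1 a)) = (0.0495*0.9816*0.57*0.55) * (a/√n) * (a*f n 1 a) := by
    rw [hY]; field_simp; ring
  rw [e1]
  have e2 : 2.481/(n*√n) ≤ a/√n := by
    rw [div_le_div_iff₀ (by positivity) (by linarith)]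
    have := mul_le_mul_of_nonneg_right h.lo (show 0 ≤ √(n:ℝ) by linarith)
    linarith
  have : 0.0377/(n*√n) ≤ (0.0495*0.9816*0.57*0.55) * (a/√n) := by
    calc 0.0377/(n*√n) ≤ (0.0495*0.9816*0.57*0.55)*(2.481/(n*√n)) := by
            rw [← mul_div_assoc]; gcongr; norm_num
      _ ≤ _ := by gcongr
  gcongr

theorem main_pos {n : ℕ} {a y : ℝ} (h : Rt n 1 0 a) (hy0 : 0 ≤ y) (hy : y ≤ π/(2*a) - 0.05) :
    0.036/(n*√n)*(a * f n 1 a) ≤ ∫ t in (0:ℝ)..(π/n), f n 1 t * cos (y*t) := by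
  have a0 := h.pos
  have R := h.R
  have hp := pi_gt_d2
  have hp2 := pi_lt_d4
  set Y := π/(2*a) with hY
  have b0 : 0 < π/(n:ℝ) := by positivity
  have hYa : Y * a = π/2 := by rw [hY]; field_simp
  have hYb : Y * (π/n) ≤ 2 := by
    have : Y*(π/n) = π^2/(2*(n*a)) := by rw [hY]; field_simp
    rw [this, div_le_iff₀ (by linarith [h.lo])]; nlinarith [h.lo]
  have Y0 : 0 < Y := by positivity
  have bt : ∀ t ∈ Icc 0 (π/n), Y*t ≤ 2 := fun t ht => (mul_le_mul_of_nonneg_left ht.2 Y0.le).trans hYb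
  -- step A
  have A : ∫ t in (0:ℝ)..(π/n), f n 1 t * cos ((Y-0.05)*t) ≤ ∫ t in (0:ℝ)..(π/n), f n 1 t * cos (y*t) := by
    refine intervalIntegral.integral_mono_on b0.le (fc_int _ _ _ _ _) (fc_int _ _ _ _ _) fun t ht => ?_
    refine mul_le_mul_of_nonneg_left ?_ (f_nonneg h.n0 ht)
    have := bt t ht
    have h3 : y*t ≤ (Y-0.05)*t := mul_le_mul_of_nonneg_right hy ht.1
    exact cos_le_cos_of_nonneg_of_le_pi (mul_nonneg hy0 ht.1) (by linarith [ht.1]) h3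
  -- step B
  have B := gain h (D := fun t => f n 1 t * cos ((Y-0.05)*t) - f n 1 t * cos (Y*t)) ((fc_cont _ _ _).sub (fc_cont _ _ _))
    (fun t ht => by
      have h1 := bt t ht
      rw [← mul_sub]
      refine mul_nonneg (f_nonneg h.n0 ht) ?_
      have : 0.05 ≤ Y := by linarith
      have := cos_le_cos_of_nonneg_of_le_pi (x := (Y-0.05)*t) (y := Y*t) (mul_nonneg (by linarith) ht.1) (by linarith) (by linarith [ht.1])
      linarith)
    (fun t ht => by
      have t0 : 0 < t := lt_of_lt_of_le (by norm_num; exact a0) ht.1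
      have h1 : Y*t ≤ π/2 := by rw [← hYa]; gcongr; exact ht.2
      have h2 : Y*(a*(1-0.0184)) ≤ Y*t := by gcongr; exact ht.1
      have h3 := cosdiff (B := Y*t) (h := 0.05*t) (by nlinarith) (by linarith) (by positivity) (by linarith [ht.2, h.small])
      have h4 := f_nonneg (e := 1) h.n0 (x := t) ⟨t0.le, ht.2.trans h.mem.2.le⟩
      have := mul_le_mul_of_nonneg_left h3 h4
      rw [← sub_mul] at this
      linarith)
  rw [intervalIntegral.integral_sub (fc_int _ _ _ _ _) (fc_int _ _ _ _ _)] at B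
  -- step C
  set s := A1 n 1 a with hs
  have sl := h.s_lo
  rw [← hs] at sl
  have s0 : 0 < s := by linarith
  have C : -((π/2)/s*a * f n 1 (a*0.91)) ≤ ∫ t in (0:ℝ)..(π/n), f n 1 t * cos (Y*t) := by
    rw [← intervalIntegral.integral_add_adjacent_intervals (fc_int n 1 Y 0 (a*0.91)) (fc_int n 1 Y (a*0.91) (π/n))]
    have hm91 : a*0.91 ≤ π/n := by linarith [h.mem.2]
    have c1 : 0 ≤ ∫ t in (0:ℝ)..(a*0.91), f n 1 t * cos (Y*t) := by
      refine intervalIntegral.integral_nonneg (by positivity) fun t ht => ?_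
      refine mul_nonneg (f_nonneg h.n0 ⟨ht.1, ht.2.trans hm91⟩) ?_
      apply cos_nonneg_of_mem_Icc
      have : Y*t ≤ Y*a := by gcongr; linarith [ht.2]
      have : 0 ≤ Y*t := mul_nonneg Y0.le ht.1
      constructor <;> linarith
    have c2 := intervalIntegral.sub_le_integral_of_hasDeriv_right_of_le (g := fun t => (π/2)/s*a * f n 1 t)
      (g' := fun t => (π/2)/s*a*(f n 1 t * (F n 1 t/t))) (φ := fun t => f n 1 t * cos (Y*t)) hm91
      (by have := f_cont n 1; fun_prop)
      (fun t ht => ((f_deriv h.n0 ⟨lt_trans (by positivity) ht.1, ht.2⟩).const_mul _).hasDerivWithinAt)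
      ((fc_cont n 1 Y).continuousOn.integrableOn_compact isCompact_Icc)
      (fun t ht => by
        have t0 : 0 < t := lt_trans (by positivity) ht.1
        have p := h.point_i (z := t/a) (by rw [le_div_iff₀ a0]; linarith [ht.1]) (by rw [mul_div_cancel₀ _ a0.ne']; exact ht.2)
        rw [mul_div_cancel₀ _ a0.ne', ← hs] at p
        have e1 : π*(t/a)/2 = Y*t := by rw [hY]; field_simp
        rw [e1] at p
        have f0 := f_pos (e := 1) h.n0 (x := t) ⟨t0, ht.2⟩
        have p2 := mul_le_mul_of_nonneg_left p (show 0 ≤ f n 1 t * (a/t) by positivity)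
        have e2 : f n 1 t * (a/t) * (π/2/s*F n 1 t) = (π/2)/s*a*(f n 1 t * (F n 1 t/t)) := by ring
        have e3 : f n 1 t * (a/t) * (t/a*cos (Y*t)) = f n 1 t * cos (Y*t) := by field_simp
        rw [e2, e3] at p2
        exact p2)
    have c3 : 0 ≤ (π/2)/s*a*f n 1 (π/n) := by
      have := f_nonneg (e := 1) h.n0 (x := π/n) ⟨b0.le, le_rfl⟩
      positivity
    linarith
  have fd := h.f_drop
  have fa := f_pos (e := 1) h.n0 h.mem
  obtain ⟨r1, r2, r3⟩ := sq_facts h.hn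
  have ex := expdec h.hn (k := 0.0112) (by norm_num)
  have e10 := exp_m (x := 0.0112*901) 10 (by norm_num)
  have k1 : (π/2)/s ≤ 0.4922/n := by
    rw [div_le_div_iff₀ s0 (by linarith)]; nlinarith
  have k2 : exp (-(0.0112*n)) ≤ 0.00137/√n := by
    have r0 : (0:ℝ) ≤ 30.03/√n := by positivity
    calc exp (-(0.0112*n)) ≤ 0.36788^10*(30.03/√n) := by
          refine ex.trans (mul_le_mul e10 r3 (by positivity) (by norm_num))
      _ ≤ _ := by rw [← mul_div_assoc]; gcongr; norm_num
  have L : (π/2)/s*a * f n 1 (a*0.91) ≤ 0.001/(n*√n)*(a*f n 1 a) := by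
    have q1 : f n 1 (a*0.91) ≤ f n 1 a * (0.00137/√n) := fd.trans (by gcongr)
    calc (π/2)/s*a * f n 1 (a*0.91) ≤ 0.4922/n*a*(f n 1 a * (0.00137/√n)) := by
          have := f_nonneg (e := 1) h.n0 (x := a*0.91) ⟨by positivity, by linarith [h.mem.2]⟩
          gcongr
      _ = (0.4922*0.00137)/(n*√n)*(a*f n 1 a) := by field_simp
      _ ≤ _ := by gcongr; norm_num
  have : 0.036/(n*√n)*(a * f n 1 a) ≤ 0.0377/(n*√n)*(a * f n 1 a) - 0.001/(n*√n)*(a*f n 1 a) := by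
    have : 0 ≤ 1/(n*√n)*(a * f n 1 a) := by positivity
    have e : ∀ k:ℝ, k/(n*√n)*(a * f n 1 a) = k*(1/(n*√n)*(a * f n 1 a)) := by intro k; ring
    rw [e, e 0.0377, e 0.001]; linarith
  linarith
end QP
end

section
open Real Set MeasureTheory
namespace QP

lemma H2_up {X t tl : ℝ} (h0 : 2.4824 < X) (h1 : X ≤ 3) (ht : T X ≤ t) (htl : tl ≤ T X) (l0 : 0 ≤ tl) :
    H2 X ≤ X^3*(1+t^2) - X^2*tl - 2*(0.0045 - (X-2.4824)*((2.4824*1.2907 + X*t)/2)) ∧ h2 X ≤ 2*X^2*(1+X*t)*(1+t^2) := by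
  have X0 : 0 < X := by linarith
  have m := mp X0 (by linarith)
  have i1 := I_trap (x := 2.4824) (by norm_num) h0 (by linarith [pi_gt_d2])
  rw [cc_T (by norm_num) (by norm_num), cc_T X0 (by linarith)] at i1
  have i2 := I_24824
  have t2 := T24824.2
  have t0 : 0 ≤ T X := l0.trans htl
  have b1 : T X^2 ≤ t^2 := by gcongr
  have b2 : X*T X ≤ X*t := by gcongr
  constructor
  · rw [H2_T m]
    have c1 : X^3*(1+T X^2) ≤ X^3*(1+t^2) := by gcongr
    have c2 : X^2*tl ≤ X^2*T X := by gcongr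
    have c3 : (X-2.4824)*((2.4824*T 2.4824 + X*T X)/2) ≤ (X-2.4824)*((2.4824*1.2907 + X*t)/2) := by
      have : 0 ≤ X - 2.4824 := by linarith
      gcongr
    linarith
  · have : 0 ≤ t := t0.trans ht
    rw [h2_T m]; gcongr

namespace Rt
variable {n e : ℕ} {v a : ℝ}

lemma A2_up (h : Rt n e v a) {r X P R ρ : ℝ} (hr : 1 ≤ r) (hX : 2.488*r ≤ X) (hX3 : X ≤ 3.14) (hP : H2 X ≤ P) (hR : h2 X ≤ R)
    (P0 : 0 ≤ P) (hρ : P/(2.481*r) + (R+1)/901 ≤ 3.192*ρ*r^2) (ρ0 : 0 ≤ ρ) (R0 : 0 ≤ R) : A2 n e (a*r)/r^2 ≤ ρ * A1 n e a := by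
  have a0 := h.pos
  have nn := h.R
  have lo := h.lo
  have hi := h.hi
  have e1 : n*(a*r) = (n*a)*r := by ring
  have l1 : n*a*r ≤ 2.488*r := by gcongr
  have l2 : 2.481*r ≤ n*a*r := by gcongr
  have h1 := A2_le (e := e) h.hn h.he (x := a*r) (by positivity) (by linarith)
  have h3 := H2_mono' (x := n*(a*r)) (y := X) (by positivity) (by linarith) hX3
  have h4 := h2_mono (mp (x := n*(a*r)) (by positivity) (by linarith)) (mp (x := X) (by linarith) hX3) (by linarith)
  rw [div_le_iff₀ (by positivity)]
  have k1 : H2 (n*(a*r))/(a*r) ≤ P/(2.481*r)*n := by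
    rw [div_mul_eq_mul_div, div_le_div_iff₀ (by positivity) (by positivity)]
    calc H2 (n*(a*r))*(2.481*r) ≤ P*(n*a*r) := by
          apply mul_le_mul (h3.trans hP) l2 (by positivity) P0
      _ = _ := by ring
  have k2 : R + 1 ≤ (R+1)/901*n := by
    rw [div_mul_eq_mul_div, le_div_iff₀ (by norm_num)]; gcongr
  have k3 := mul_le_mul_of_nonneg_right hρ (show (0:ℝ) ≤ n by linarith)
  have k4 : ρ*r^2*(3.192*n) ≤ ρ*r^2*A1 n e a := by gcongr; exact h.s_lo
  linarith

lemma A2_steps (h : Rt n e v a) : A2 n e (a*1.02)/1.02^2 ≤ 5.04*A1 n e a ∧ A2 n e (a*1.04)/1.04^2 ≤ 6.14*A1 n e a ∧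
    A2 n e (a*1.055)/1.055^2 ≤ 7.24*A1 n e a ∧ A2 n e (a*1.07)/1.07^2 ≤ 8.065*A1 n e a := by
  refine ⟨?_, ?_, ?_, ?_⟩
  · obtain ⟨p, q⟩ := H2_up (X := 2.5378) (by norm_num) (by norm_num) T25378.2 T25378.1 (by norm_num)
    exact h.A2_up (X := 2.5378) (P := 41.76) (R := 187.5) (by norm_num) (by norm_num) (by norm_num) (p.trans (by norm_num)) (q.trans (by norm_num)) (by norm_num) (by norm_num) (by norm_num) (by norm_num)
  · obtain ⟨p, q⟩ := H2_up (X := 2.5876) (by norm_num) (by norm_num) T25876.2 T25876.1 (by norm_num)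
    exact h.A2_up (X := 2.5876) (P := 52.8) (R := 252) (by norm_num) (by norm_num) (by norm_num) (p.trans (by norm_num)) (q.trans (by norm_num)) (by norm_num) (by norm_num) (by norm_num) (by norm_num)
  · obtain ⟨p, q⟩ := H2_up (X := 2.6249) (by norm_num) (by norm_num) T26249.2 T26249.1 (by norm_num)
    exact h.A2_up (X := 2.6249) (P := 63.5) (R := 320) (by norm_num) (by norm_num) (by norm_num) (p.trans (by norm_num)) (q.trans (by norm_num)) (by norm_num) (by norm_num) (by norm_num) (by norm_num)
  · obtain ⟨p, q⟩ := H2_up (X := 2.6622) (by norm_num) (by norm_num) T26622.2 T26622.1 (by norm_num)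
    exact h.A2_up (X := 2.6622) (P := 76.8) (R := 410) (by norm_num) (by norm_num) (by norm_num) (p.trans (by norm_num)) (q.trans (by norm_num)) (by norm_num) (by norm_num) (by norm_num) (by norm_num)

lemma r107 (h : Rt n e v a) {r : ℝ} (r0 : 0 < r) (hr : r ≤ 1.07) : a*r ∈ Ioo 0 (π/n) := by
  have a0 := h.pos
  refine ⟨by positivity, ?_⟩
  have nn := h.R
  rw [lt_div_iff₀ (by linarith)]
  have : n*a*r ≤ 2.488*1.07 := by
    have := h.hi
    have := h.lo
    gcongr
  linarith [pi_gt_d2]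

lemma F2_up (h : Rt n e v a) {w : ℝ} (hw0 : 0 ≤ w) (hw : w ≤ 0.07) : -(A1 n e a*(5.04+55*w)) ≤ F2 n e (a*(1+w))*a^2 := by
  have a0 := h.pos
  have s0 : 0 ≤ A1 n e a := by linarith [h.s_lo, h.R]
  obtain ⟨q1, q2, q3, q4⟩ := h.A2_steps
  have key : ∀ r ρ : ℝ, 1+w ≤ r → r ≤ 1.07 → A2 n e (a*r)/r^2 ≤ ρ*A1 n e a → ρ ≤ 5.04+55*w →
      -(A1 n e a*(5.04+55*w)) ≤ F2 n e (a*(1+w))*a^2 := by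
    intro r ρ h1 h2 h3 h4
    have r0 : 0 < r := by linarith
    have m := F2_anti (e := e) h.n0 (h.r107 (r := 1+w) (by linarith) (by linarith)) (h.r107 r0 h2) (by gcongr)
    rw [scal2 (by positivity)] at m
    have m2 := mul_le_mul_of_nonneg_right m (sq_nonneg a)
    have e1 : -A2 n e (a*r)/(a*r)^2*a^2 = -(A2 n e (a*r)/r^2) := by field_simp
    rw [e1] at m2
    have := mul_le_mul_of_nonneg_right h4 s0
    linarith
  rcases le_total w 0.02 with g | g
  · exact key 1.02 5.04 (by linarith) (by norm_num) q1 (by linarith)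
  rcases le_total w 0.04 with g2 | g2
  · exact key 1.04 6.14 (by linarith) (by norm_num) q2 (by linarith)
  rcases le_total w 0.055 with g3 | g3
  · exact key 1.055 7.24 (by linarith) (by norm_num) q3 (by linarith)
  · exact key 1.07 8.065 (by linarith) (by norm_num) q4 (by linarith)

lemma F_right (h : Rt n e v a) {w : ℝ} (hw0 : 0 ≤ w) (hw : w ≤ 0.07) :
    v - A1 n e a*(w+2.52*w^2+55/6*w^3) ≤ F n e (a*(1+w)) := by
  have a0 := h.pos
  set s := A1 n e a with hs
  have hle : a ≤ a*(1+w) := by nlinarith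
  have hm : ∀ ξ ∈ uIcc a (a*(1+w)), ∃ y, 0 ≤ y ∧ y ≤ 0.07 ∧ ξ = a*(1+y) := by
    intro ξ hξ
    rw [uIcc_of_le hle] at hξ
    refine ⟨(ξ-a)/a, div_nonneg (by linarith [hξ.1]) a0.le, ?_, by field_simp; ring⟩
    rw [div_le_iff₀ a0]; nlinarith [hξ.2]
  have hm2 : ∀ ξ ∈ uIcc a (a*(1+w)), ξ ∈ Ioo 0 (π/n) := by
    intro ξ hξ
    obtain ⟨y, y0, y1, rfl⟩ := hm ξ hξ
    exact h.r107 (by linarith) (by linarith)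
  have dd : ∀ ξ:ℝ, HasDerivAt (fun ξ => (ξ-a)/a) (1/a) ξ := fun ξ => ((hasDerivAt_id ξ).sub_const a).div_const a
  have t := taylor_ge (g := fun ξ => F n e ξ + s*(2.52*((ξ-a)/a)^2 + 55/6*((ξ-a)/a)^3))
    (g1 := fun ξ => F1 n e ξ + s*(5.04*((ξ-a)/a) + 55/2*((ξ-a)/a)^2)/a)
    (g2 := fun ξ => F2 n e ξ + s*(5.04 + 55*((ξ-a)/a))/a^2) (x := a) (u := a*(1+w)) (M := 0)
    (fun ξ hξ => by
      refine ((F_deriv h.n0 (hm2 ξ hξ)).add (((((dd ξ).pow 2).const_mul 2.52).add (((dd ξ).pow 3).const_mul (55/6))).const_mul s)).congr_deriv ?_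
      simp; ring)
    (fun ξ hξ => by
      refine ((F1_deriv h.n0 (hm2 ξ hξ)).add ((((((dd ξ)).const_mul 5.04).add (((dd ξ).pow 2).const_mul (55/2))).const_mul s).div_const a)).congr_deriv ?_
      simp; field_simp)
    (fun ξ hξ => by
      obtain ⟨y, y0, y1, rfl⟩ := hm ξ hξ
      have e1 : (a*(1+y)-a)/a = y := by field_simp; ring
      rw [e1]
      have := h.F2_up y0 y1
      rw [← hs] at this
      have h2 : -(s*(5.04+55*y))/a^2 ≤ F2 n e (a*(1+y)) := by rwa [div_le_iff₀ (by positivity)]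
      rw [neg_div] at h2
      linarith)
  have e1 : (a*(1+w)-a)/a = w := by field_simp; ring
  have e2 := scal1 (n := n) (e := e) a0
  rw [← hs] at e2
  simp only [e1, sub_self, zero_div] at t
  rw [h.eq] at t
  have e3 : F1 n e a * (a*(1+w)-a) = -s*w := by rw [← e2]; ring
  norm_num at t ⊢
  rw [e3] at t
  linarith

lemma point_ii (h : Rt n e 2 a) {z : ℝ} (hz : 0.91 ≤ z) (hz2 : z ≤ 1.07) :
    z^3 * cos (π*z/2) ≤ (π/2)/A1 n e a * (F n e (a*z) - 2) := by
  have a0 := h.pos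
  have sl := h.s_lo
  have R := h.R
  have s0 : 0 < A1 n e a := by linarith
  have hp := pi_pos
  have hp4 := pi_lt_d4
  rw [div_mul_eq_mul_div, le_div_iff₀ s0]
  rcases le_total 1 z with h1 | h1
  · obtain ⟨w, hw⟩ : ∃ w, z = 1 + w := ⟨z-1, by ring⟩
    subst hw
    have w0 : 0 ≤ w := by linarith
    have t := h.F_right w0 (by linarith)
    have e1 : cos (π*(1+w)/2) = - sin (π*w/2) := by
      rw [← cos_add_pi_div_two]; congr 1; ring
    have sx := s3 (x := π*w/2) (by positivity)
    have pp : π^2 ≤ 9.87 := by nlinarith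
    have w3 : π/2*(w*(1-0.4113*w^2)) ≤ sin (π*w/2) := by
      have : (π*w/2)^3/6 ≤ π/2*(w*(0.4113*w^2)) := by
        have : (π*w/2)^3/6 = π^2*(π*w^3)/48 := by ring
        rw [this]
        have : π^2*(π*w^3) ≤ 9.87*(π*w^3) := by gcongr
        have : 0 ≤ π*w^3 := by positivity
        linarith
      linarith
    have w4 : (1+w)^3*(π/2*(w*(1-0.4113*w^2))) ≤ (1+w)^3*sin (π*w/2) := by gcongr
    have w5 : w+2.52*w^2+55/6*w^3 ≤ (1+w)^3*(w*(1-0.4113*w^2)) := by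
      have k1 : 0 ≤ w^2*(0.48 - 6.65*w) := mul_nonneg (sq_nonneg w) (by linarith)
      have k2 : w^4 ≤ 0.07*w^3 := by
        have : w^3*w ≤ w^3*0.07 := by gcongr; linarith
        linarith
      have k3 : w^5 ≤ 0.07*w^4 := by
        have : w^4*w ≤ w^4*0.07 := by gcongr; linarith
        linarith
      have k4 : w^6 ≤ 0.07*w^5 := by
        have : w^5*w ≤ w^5*0.07 := by gcongr; linarith
        linarith
      have k5 : 0 ≤ w^3 := by positivity
      nlinarith
    have w6 : A1 n e a*(w+2.52*w^2+55/6*w^3) ≤ A1 n e a*((1+w)^3*(w*(1-0.4113*w^2))) := by gcongr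
    have w7 := mul_le_mul_of_nonneg_right w4 s0.le
    have w8 : π/2*(2 - A1 n e a*((1+w)^3*(w*(1-0.4113*w^2))) - 2) ≤ π/2*(F n e (a*(1+w)) - 2) := by
      gcongr; linarith
    rw [e1]
    linarith
  · have t := F_D (e := e) h.n0 a0 (z := z) (r := 1) (by linarith) le_rfl h1 (by simpa using h.mem.2)
    rw [h.eq, mul_one] at t
    have q := h.A2_hi
    obtain ⟨y, hy⟩ : ∃ y, z = 1 - y := ⟨1-z, by ring⟩
    subst hy
    have y0 : 0 ≤ y := by linarith
    have y1 : y ≤ 0.09 := by linarith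
    have e1 : cos (π*(1-y)/2) = sin (π*y/2) := by
      rw [← cos_pi_div_two_sub]; congr 1; ring
    have sx := s1 (x := π*y/2) (by positivity)
    rw [e1]
    have q2 : A2 n e a ≤ 4.3172*A1 n e a := by linarith
    have w0 := mul_le_mul_of_nonneg_right q2 (sq_nonneg y)
    have w1 : A1 n e a * (y - 2.1586*y^2) ≤ F n e (a*(1-y)) - 2 := by
      norm_num at t; linarith
    have w2 : π/2 * (A1 n e a * (y - 2.1586*y^2)) ≤ π/2 * (F n e (a*(1-y)) - 2) := by gcongr
    have w4 : (1-y)^3*sin (π*y/2) ≤ (1-y)^3*(π*y/2) := by gcongr; linarith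
    have w5 : (1-y)^3*y ≤ y - 2.1586*y^2 := by
      have : 0 ≤ y^2*(0.8414 - 3*y) := mul_nonneg (sq_nonneg y) (by linarith)
      have : 0 ≤ y^4 := by positivity
      nlinarith
    have w6 : π/2 * (A1 n e a * ((1-y)^3*y)) ≤ π/2 * (A1 n e a * (y - 2.1586*y^2)) := by gcongr
    have w7 := mul_le_mul_of_nonneg_right w4 s0.le
    linarith
end Rt
end QP
end

section
open Real Set MeasureTheory
namespace QP

lemma Rt.f2_drop {n e : ℕ} {a : ℝ} (h : Rt n e 2 a) : f n e (a*1.07)/(a*1.07)^2 ≤ f n e a/a^2 * exp (-(0.00782*n)) := by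
  have a0 := h.pos
  have sl := h.s_lo
  have R := h.R
  set s := A1 n e a with hs
  have hm : ∀ u ∈ Icc a (a*1.07), u ∈ Ioo 0 (π/n) := fun u hu =>
    ⟨a0.trans_le hu.1, hu.2.trans_lt (h.r107 (r := 1.07) (by norm_num) (by norm_num)).2⟩
  have key := le_of_deriv (f := fun u => log (f n e u) - 2*log u + s * ((u-a)/a)^2/2)
    (f' := fun u => F n e u / u - 2*u⁻¹ + s * ((u-a)/a)/a) (p := a) (q := a*1.07) (by linarith)
    (fun u hu => by
      have := (logf_deriv (e := e) h.n0 (hm u hu)).continuousAt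
      have l := (hasDerivAt_log (hm u hu).1.ne').continuousAt
      exact ((this.sub (l.const_mul 2)).add (by fun_prop)).continuousWithinAt)
    (fun u hu => by
      have d := logf_deriv (e := e) h.n0 (hm u ⟨hu.1.le, hu.2.le⟩)
      have l := (hasDerivAt_log (hm u ⟨hu.1.le, hu.2.le⟩).1.ne')
      have d2 : HasDerivAt (fun u => (u-a)/a) (1/a) u := ((hasDerivAt_id u).sub_const a).div_const a
      refine ((d.sub (l.const_mul 2)).add (((d2.pow 2).const_mul s).div_const 2)).congr_deriv ?_
      simp; ring)
    (fun u hu => by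
      have du := hm u ⟨hu.1.le, hu.2.le⟩
      have t := F_U (e := e) h.n0 a0 (z := u/a) (r := 1) one_pos le_rfl (by rw [le_div_iff₀ a0]; linarith [hu.1]) h.mem.2 (by rw [mul_div_cancel₀ _ a0.ne']; exact du.2)
      rw [h.eq, mul_div_cancel₀ _ a0.ne', mul_one, ← hs] at t
      have q := h.A2_lo
      have e1 : 1 - u/a = -((u-a)/a) := by field_simp; ring
      rw [e1] at t
      have e2 : u = a*(1+(u-a)/a) := by field_simp; ring
      set y := (u-a)/a with hy
      have y0 : 0 ≤ y := div_nonneg (by linarith [hu.1]) a0.le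
      have b1 : F n e u - 2 ≤ -(s*y*(1+y)) := by
        have := mul_le_mul_of_nonneg_right q (sq_nonneg y)
        norm_num at t; rw [← hs] at this; linarith
      have b2 : (F n e u - 2)/u ≤ -(s*y*(1+y))/u := by have := du.1; gcongr
      have b3 : -(s*y*(1+y))/u = -(s*y/a) := by
        have : 0 < 1 + y := by linarith
        rw [e2]; field_simp
      have b4 : (F n e u - 2)/u = F n e u/u - 2*u⁻¹ := by ring
      linarith)
  simp only [sub_self, zero_div] at key
  have e2 : (a*1.07-a)/a = 0.07 := by field_simp; norm_num
  rw [e2] at key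
  have f1 := f_pos (e := e) h.n0 (hm (a*1.07) ⟨by linarith, le_rfl⟩)
  have f2 := f_pos (e := e) h.n0 h.mem
  have l1 : log (f n e (a*1.07)/(a*1.07)^2) = log (f n e (a*1.07)) - 2*log (a*1.07) := by
    rw [log_div f1.ne' (by positivity), log_pow]; norm_num
  have l2 : log (f n e a/a^2) = log (f n e a) - 2*log a := by
    rw [log_div f2.ne' (by positivity), log_pow]; norm_num
  have : log (f n e (a*1.07)/(a*1.07)^2) ≤ log (f n e a/a^2) + -(0.00782*n) := by
    rw [l1, l2]; norm_num at key ⊢; linarith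
  have := exp_le_exp.2 this
  rwa [exp_add, exp_log (by positivity), exp_log (by positivity)] at this

/-- mass to the left of a point with positive logarithmic slope -/
lemma left_mass {n e : ℕ} (hn : 0 < n) {p : ℝ} (hp : p ∈ Ioo 0 (π/n)) (hF : 0 < F n e p) :
    ∫ t in (0:ℝ)..p, f n e t ≤ p * f n e p / F n e p := by
  have p0 := hp.1
  have c2 := intervalIntegral.integral_le_sub_of_hasDeriv_right_of_le (g := fun t => p/F n e p * f n e t)
      (g' := fun t => p/F n e p*(f n e t * (F n e t/t))) (φ := fun t => f n e t) p0.le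
      (by have := f_cont n e; fun_prop)
      (fun t ht => ((f_deriv hn ⟨ht.1, ht.2.trans hp.2⟩).const_mul _).hasDerivWithinAt)
      ((f_cont n e).continuousOn.integrableOn_compact isCompact_Icc)
      (fun t ht => by
        have t0 := ht.1
        have m : t ∈ Ioo 0 (π/n) := ⟨ht.1, ht.2.trans hp.2⟩
        have F1 := F_anti (e := e) hn m hp ht.2.le
        have f0 := f_pos (e := e) hn m
        have : 1 ≤ p/F n e p*(F n e t/t) := by
          rw [div_mul_div_comm, one_le_div (by positivity)]
          rw [mul_comm]; exact mul_le_mul ht.2.le F1 hF.le p0.le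
        have := mul_le_mul_of_nonneg_left this f0.le
        linarith)
  have := f_nonneg (e := e) hn (x := 0) ⟨le_rfl, (hp.1.trans hp.2).le⟩
  have : 0 ≤ p/F n e p * f n e 0 := by positivity
  have e1 : p * f n e p / F n e p = p/F n e p * f n e p := by ring
  linarith

theorem main_neg {n : ℕ} {a y : ℝ} (h : Rt n 1 2 a) (hy : π/(2*a) + 0.05 ≤ y) (hy2 : y ≤ 1.35*n) :
    ∫ t in (0:ℝ)..(π/n), f n 1 t * cos (y*t) ≤ -(0.018/(n*√n)*(a * f n 1 a)) := by
  have a0 := h.pos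
  have R := h.R
  have hp := pi_gt_d2
  have hp2 := pi_lt_d4
  set Y := π/(2*a) with hY
  have b0 : 0 < π/(n:ℝ) := by positivity
  have hYa : Y * a = π/2 := by rw [hY]; field_simp
  have hYb : Y * (π/n) ≤ 2 := by
    have : Y*(π/n) = π^2/(2*(n*a)) := by rw [hY]; field_simp
    rw [this, div_le_iff₀ (by linarith [h.lo])]; nlinarith [h.lo]
  have Y0 : 0 < Y := by positivity
  have bt : ∀ t ∈ Icc 0 (π/n), Y*t ≤ 2 := fun t ht => (mul_le_mul_of_nonneg_left ht.2 Y0.le).trans hYb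
  have hpn : π/(n:ℝ) ≤ 0.01 := by rw [div_le_iff₀ (by linarith)]; linarith
  -- step A
  have A : ∫ t in (0:ℝ)..(π/n), f n 1 t * cos (y*t) ≤ ∫ t in (0:ℝ)..(π/n), f n 1 t * cos ((Y+0.05)*t) := by
    refine intervalIntegral.integral_mono_on b0.le (fc_int _ _ _ _ _) (fc_int _ _ _ _ _) fun t ht => ?_
    refine mul_le_mul_of_nonneg_left ?_ (f_nonneg h.n0 ht)
    have h1 := bt t ht
    have h4 := ht.1
    have h3 : (Y+0.05)*t ≤ y*t := mul_le_mul_of_nonneg_right hy ht.1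
    have h6 : y*t ≤ 1.35*π := by
      have := ht.2
      rw [le_div_iff₀ (by linarith)] at this
      calc y*t ≤ 1.35*n*t := by gcongr
        _ ≤ _ := by linarith
    have h5 : (Y+0.05)*t ≤ 2.01 := by linarith [ht.2]
    have h7 : 0 ≤ (Y+0.05)*t := by positivity
    rcases le_total (y*t) π with g | g
    · exact cos_le_cos_of_nonneg_of_le_pi h7 g h3
    · rw [← cos_two_pi_sub (y*t)]
      exact cos_le_cos_of_nonneg_of_le_pi h7 (by linarith) (by linarith)
  -- step B
  have B := gain h (D := fun t => f n 1 t * cos (Y*t) - f n 1 t * cos ((Y+0.05)*t)) ((fc_cont _ _ _).sub (fc_cont _ _ _))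
    (fun t ht => by
      have h1 := bt t ht
      have h4 := ht.1
      rw [← mul_sub]
      refine mul_nonneg (f_nonneg h.n0 ht) ?_
      have := cos_le_cos_of_nonneg_of_le_pi (x := Y*t) (y := (Y+0.05)*t) (by positivity) (by linarith [ht.2]) (by linarith [ht.1])
      linarith)
    (fun t ht => by
      have t0 : 0 < t := lt_of_lt_of_le (by norm_num; exact a0) ht.1
      have h1 : Y*t ≤ π/2 := by rw [← hYa]; gcongr; exact ht.2
      have h2 : Y*(a*(1-0.0184)) ≤ Y*t := by gcongr; exact ht.1
      have h3 := cosdiff (B := Y*t+0.05*t) (h := 0.05*t) (by nlinarith) (by linarith [ht.2, h.small]) (by positivity) (by linarith [ht.2, h.small])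
      have h4 := f_nonneg (e := 1) h.n0 (x := t) ⟨t0.le, ht.2.trans h.mem.2.le⟩
      have := mul_le_mul_of_nonneg_left h3 h4
      rw [← add_mul, add_mul, add_sub_cancel_right] at this
      rw [add_mul]
      linarith)
  rw [intervalIntegral.integral_sub (fc_int _ _ _ _ _) (fc_int _ _ _ _ _)] at B
  -- step C
  set s := A1 n 1 a with hs
  have sl := h.s_lo
  rw [← hs] at sl
  have s0 : 0 < s := by linarith
  have m1 := h.r107 (r := 0.91) (by norm_num) (by norm_num)
  have m2 := h.r107 (r := 1.07) (by norm_num) (by norm_num)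
  have fp := f_pos (e := 1) h.n0 m1
  have fa := f_pos (e := 1) h.n0 h.mem
  have fb := f_pos (e := 1) h.n0 m2
  have Fp : 0.2314*n ≤ F n 1 (a*0.91) := by
    have t := F_D (e := 1) h.n0 a0 (z := 0.91) (r := 1) (by norm_num) le_rfl (by norm_num) (by simpa using h.mem.2)
    rw [h.eq, mul_one, ← hs] at t
    have := h.A2_hi
    norm_num at t ⊢; linarith
  have C : ∫ t in (0:ℝ)..(π/n), f n 1 t * cos (Y*t) ≤ a*0.91*f n 1 (a*0.91)/F n 1 (a*0.91) + (π/2)/s*a^3 * (f n 1 (a*1.07)/(a*1.07)^2) := by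
    rw [← intervalIntegral.integral_add_adjacent_intervals (fc_int n 1 Y 0 (a*0.91)) (fc_int n 1 Y (a*0.91) (π/n)),
      ← intervalIntegral.integral_add_adjacent_intervals (fc_int n 1 Y (a*0.91) (a*1.07)) (fc_int n 1 Y (a*1.07) (π/n))]
    have c1 : ∫ t in (0:ℝ)..(a*0.91), f n 1 t * cos (Y*t) ≤ a*0.91*f n 1 (a*0.91)/F n 1 (a*0.91) := by
      refine le_trans ?_ (left_mass h.n0 m1 (by linarith))
      refine intervalIntegral.integral_mono_on m1.1.le (fc_int _ _ _ _ _) ((f_cont _ _).intervalIntegrable _ _) fun t ht => ?_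
      have := f_nonneg (e := 1) h.n0 (x := t) ⟨ht.1, ht.2.trans m1.2.le⟩
      nlinarith [cos_le_one (Y*t)]
    have c3 : ∫ t in (a*1.07)..(π/n), f n 1 t * cos (Y*t) ≤ 0 := by
      have : 0 ≤ ∫ t in (a*1.07)..(π/n), -(f n 1 t * cos (Y*t)) := by
        refine intervalIntegral.integral_nonneg m2.2.le fun t ht => ?_
        have k1 := f_nonneg (e := 1) h.n0 (x := t) ⟨m2.1.le.trans ht.1, ht.2⟩
        have k2 := bt t ⟨m2.1.le.trans ht.1, ht.2⟩
        have k3 : Y*a ≤ Y*t := by gcongr; linarith [ht.1]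
        have : cos (Y*t) ≤ 0 := cos_nonpos_of_pi_div_two_le_of_le (by linarith) (by linarith)
        nlinarith
      rw [intervalIntegral.integral_neg] at this
      linarith
    have c2 := intervalIntegral.integral_le_sub_of_hasDeriv_right_of_le (g := fun t => (π/2)/s*a^3 * (f n 1 t/t^2))
      (g' := fun t => (π/2)/s*a^3*(f n 1 t * (F n 1 t-2)/t^3)) (φ := fun t => f n 1 t * cos (Y*t)) (a := a*0.91) (b := a*1.07) (by linarith)
      (by
        have := f_cont n 1
        refine ContinuousOn.mul continuousOn_const (this.continuousOn.div (by fun_prop) fun t ht => ?_)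
        have : 0 < t := m1.1.trans_le ht.1
        positivity)
      (fun t ht => by
        have t0 : 0 < t := m1.1.trans ht.1
        refine ((((f_deriv (e := 1) h.n0 ⟨t0, ht.2.trans m2.2⟩).div (hasDerivAt_pow 2 t) (by positivity)).const_mul _).congr_deriv ?_).hasDerivWithinAt
        field_simp; norm_num; ring)
      ((fc_cont n 1 Y).continuousOn.integrableOn_compact isCompact_Icc)
      (fun t ht => by
        have t0 : 0 < t := m1.1.trans ht.1
        have p := h.point_ii (z := t/a) (by rw [le_div_iff₀ a0]; linarith [ht.1]) (by rw [div_le_iff₀ a0]; linarith [ht.2])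
        rw [mul_div_cancel₀ _ a0.ne', ← hs] at p
        have e1 : π*(t/a)/2 = Y*t := by rw [hY]; field_simp
        rw [e1] at p
        have f0 := f_pos (e := 1) h.n0 (x := t) ⟨t0, ht.2.trans m2.2⟩
        have p2 := mul_le_mul_of_nonneg_left p (show 0 ≤ f n 1 t * (a/t)^3 by positivity)
        have e2 : f n 1 t * (a/t)^3 * (π/2/s*(F n 1 t - 2)) = (π/2)/s*a^3*(f n 1 t * (F n 1 t - 2)/t^3) := by field_simp
        have e3 : f n 1 t * (a/t)^3 * ((t/a)^3*cos (Y*t)) = f n 1 t * cos (Y*t) := by field_simp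
        rw [e2, e3] at p2
        exact p2)
    have c4 : 0 ≤ (π/2)/s*a^3*(f n 1 (a*0.91)/(a*0.91)^2) := by positivity
    linarith
  have fd := h.f_drop
  have fd2 := h.f2_drop
  obtain ⟨r1, r2, r3⟩ := sq_facts h.hn
  have k1 : (π/2)/s ≤ 0.4922/n := by
    rw [div_le_div_iff₀ s0 (by linarith)]; nlinarith
  have r0 : (0:ℝ) ≤ 30.03/√n := by positivity
  have k2 : exp (-(0.0112*n)) ≤ 0.00137/√n := by
    calc exp (-(0.0112*n)) ≤ 0.36788^10*(30.03/√n) := by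
          refine (expdec h.hn (k := 0.0112) (by norm_num)).trans (mul_le_mul (exp_m (x := 0.0112*901) 10 (by norm_num)) r3 (by positivity) (by norm_num))
      _ ≤ _ := by rw [← mul_div_assoc]; gcongr; norm_num
  have k3 : exp (-(0.00782*n)) ≤ 0.0274/√n := by
    calc exp (-(0.00782*n)) ≤ 0.36788^7*(30.03/√n) := by
          refine (expdec h.hn (k := 0.00782) (by norm_num)).trans (mul_le_mul (exp_m (x := 0.00782*901) 7 (by norm_num)) r3 (by positivity) (by norm_num))
      _ ≤ _ := by rw [← mul_div_assoc]; gcongr; norm_num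
  have L1 : a*0.91*f n 1 (a*0.91)/F n 1 (a*0.91) ≤ 0.0055/(n*√n)*(a*f n 1 a) := by
    have q1 : f n 1 (a*0.91) ≤ f n 1 a * (0.00137/√n) := fd.trans (by gcongr)
    calc a*0.91*f n 1 (a*0.91)/F n 1 (a*0.91) ≤ a*0.91*(f n 1 a * (0.00137/√n))/(0.2314*n) := by gcongr
      _ = (0.91*0.00137/0.2314)/(n*√n)*(a*f n 1 a) := by field_simp
      _ ≤ _ := by gcongr; norm_num
  have L2 : (π/2)/s*a^3 * (f n 1 (a*1.07)/(a*1.07)^2) ≤ 0.0136/(n*√n)*(a*f n 1 a) := by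
    have q1 : f n 1 (a*1.07)/(a*1.07)^2 ≤ f n 1 a/a^2 * (0.0274/√n) := fd2.trans (by gcongr)
    calc (π/2)/s*a^3 * (f n 1 (a*1.07)/(a*1.07)^2) ≤ 0.4922/n*a^3*(f n 1 a/a^2 * (0.0274/√n)) := by gcongr
      _ = (0.4922*0.0274)/(n*√n)*(a*f n 1 a) := by field_simp
      _ ≤ _ := by gcongr; norm_num
  have : 0.018/(n*√n)*(a * f n 1 a) ≤ 0.0377/(n*√n)*(a * f n 1 a) - 0.0055/(n*√n)*(a*f n 1 a) - 0.0136/(n*√n)*(a*f n 1 a) := by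
    have : 0 ≤ 1/(n*√n)*(a * f n 1 a) := by positivity
    have e : ∀ k:ℝ, k/(n*√n)*(a * f n 1 a) = k*(1/(n*√n)*(a * f n 1 a)) := by intro k; ring
    rw [e, e 0.0377, e 0.0055, e 0.0136]; linarith
  linarith
end QP
end

section
open Real Set MeasureTheory
namespace QP

/-- truncated Fourier series of `-log |1 - r e^{ix}|` -/
noncomputable def PF (r : ℝ) (J : ℕ) (x : ℝ) : ℝ := ∑ j ∈ Finset.range J, r^(j+1)/(j+1) * cos ((j+1)*x)

lemma logpoly {r : ℝ} (h0 : 0 ≤ r) (h1 : r < 1) (J : ℕ) (x : ℝ) :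
    |log (1 + r^2 - 2*r*cos x)/2 + PF r J x| ≤ r^(J+1)/((J+1)*(1-r)) := by
  set z : ℂ := -(r * Complex.exp (x*Complex.I)) with hz
  have nz : ‖z‖ = r := by
    rw [hz, norm_neg, norm_mul, Complex.norm_exp_ofReal_mul_I]; simp [abs_of_nonneg h0]
  have t := Complex.norm_log_sub_logTaylor_le J (z := z) (by rw [nz]; exact h1)
  rw [nz] at t
  have t2 := (Complex.abs_re_le_norm _).trans t
  have e1 : (Complex.log (1+z)).re = log (1 + r^2 - 2*r*cos x)/2 := by
    rw [Complex.log_re]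
    have : ‖1+z‖^2 = 1 + r^2 - 2*r*cos x := by
      rw [← Complex.normSq_eq_norm_sq, Complex.normSq_apply]
      simp only [hz, Complex.exp_mul_I]
      simp [Complex.cos_ofReal_re, Complex.sin_ofReal_re, Complex.cos_ofReal_im, Complex.sin_ofReal_im]
      nlinarith [sin_sq_add_cos_sq x]
    rw [← this, log_pow]; push_cast; ring
  have e2 : (Complex.logTaylor (J+1) z).re = - PF r J x := by
    unfold Complex.logTaylor PF
    rw [Finset.sum_range_succ', Complex.add_re, Complex.re_sum, ← Finset.sum_neg_distrib]
    simp only [CharP.cast_eq_zero, div_zero, Complex.zero_re, add_zero]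
    refine Finset.sum_congr rfl fun j _ => ?_
    have : (-1:ℂ)^(j+1+1) * z^(j+1) / ((j+1:ℕ):ℂ) = ((-(r^(j+1)/(j+1)) : ℝ) : ℂ) * Complex.exp (((j+1)*x : ℝ)*Complex.I) := by
      have h : Complex.exp (((j+1)*x : ℝ)*Complex.I) = Complex.exp (x*Complex.I)^(j+1) := by
        rw [← Complex.exp_nat_mul]; congr 1; push_cast; ring
      rw [h, hz, neg_pow ((r:ℂ) * _), mul_pow]
      have hh : (-1:ℂ)^(j+1+1) * (-1)^(j+1) = -1 := by
        rw [← pow_add, show j+1+1+(j+1) = 2*(j+1)+1 by ring, pow_succ, pow_mul]; simp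
      push_cast
      linear_combination ((r:ℂ)^(j+1) * Complex.exp (x*Complex.I)^(j+1)/(j+1)) * hh
    rw [this, Complex.re_ofReal_mul, Complex.exp_ofReal_mul_I_re]; ring
  rw [Complex.sub_re, e1, e2, sub_neg_eq_add] at t2
  refine t2.trans (le_of_eq ?_)
  have : 1 - r ≠ 0 := by linarith
  field_simp

/-- integrated series -/
noncomputable def TF (r : ℝ) (J : ℕ) (x : ℝ) : ℝ := ∑ j ∈ Finset.range J, r^(j+1)/(j+1) * (-(sin ((j+1)*x)/(j+1)))

lemma TF_deriv (r : ℝ) (J : ℕ) (x : ℝ) : HasDerivAt (TF r J) (-PF r J x) x := by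
  unfold TF PF
  rw [← Finset.sum_neg_distrib]
  refine HasDerivAt.fun_sum fun j _ => ?_
  have h := (((hasDerivAt_id x).const_mul ((j:ℝ)+1)).sin.div_const ((j:ℝ)+1)).neg.const_mul (r^(j+1)/((j:ℝ)+1))
  refine h.congr_deriv ?_
  have : (j:ℝ)+1 ≠ 0 := by positivity
  simp; field_simp; simp

lemma TF_cont (r : ℝ) (J : ℕ) : Continuous (TF r J) := by unfold TF; fun_prop

lemma TF_zero (r : ℝ) (J : ℕ) : TF r J 0 = 0 := by simp [TF]

lemma TF_pi (r : ℝ) (J : ℕ) : TF r J π = 0 := by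
  unfold TF
  refine Finset.sum_eq_zero fun j _ => ?_
  have := sin_nat_mul_pi (j+1); push_cast at this
  rw [this]; simp

lemma TF_per (r : ℝ) (J k : ℕ) (x : ℝ) : TF r J (x + k*(2*π)) = TF r J x := by
  unfold TF
  refine Finset.sum_congr rfl fun j _ => ?_
  have : ((j:ℝ)+1)*(x+k*(2*π)) = (j+1)*x + ((j+1)*k:ℕ)*(2*π) := by push_cast; ring
  rw [this, sin_add_nat_mul_two_pi]

lemma log_le_D2 {y : ℝ} (h : 0 < y) : log y/2 ≤ 0.34658 + y/4 - 1/2 := by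
  have h1 := log_le_sub_one_of_pos (show 0 < y/2 by positivity)
  rw [log_div h.ne' (by norm_num)] at h1
  have := log_two_lt_d9
  linarith

lemma pos_quad {r : ℝ} (h1 : r < 1) (h0 : 0 ≤ r) (x : ℝ) : 0 < 1 + r^2 - 2*r*cos x := by
  nlinarith [mul_le_mul_of_nonneg_left (cos_le_one x) h0]

section
variable {r : ℝ} {J : ℕ} {ε : ℝ}

lemma TF_low (h0 : 0 ≤ r) (h1 : r ≤ 0.9) (hε : r^(J+1)/((J+1)*(1-r)) ≤ ε) (hε2 : ε ≤ r^2/4) {s : ℝ}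
    (hs0 : 0 ≤ s) (hs : s ≤ π) : TF r J s ≤ (-0.15342 + (1+r^2)/4 + ε - 0.3183*r)*s ∨ TF r J s ≤ 0 := by
  have hp := pi_pos
  have hp4 := pi_lt_d4
  rcases le_total s (π/2) with g | g
  · left
    have k := le_of_deriv (f := fun u => TF r J u - ((-0.15342 + (1+r^2)/4 + ε)*u - r/2*sin u))
      (f' := fun u => -PF r J u - ((-0.15342 + (1+r^2)/4 + ε) - r/2*cos u)) hs0
      (((TF_cont r J).sub (by fun_prop)).continuousOn)
      (fun u _ => by
        refine ((TF_deriv r J u).sub (((hasDerivAt_id u).const_mul _).sub ((hasDerivAt_sin u).const_mul _))).congr_deriv ?_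
        simp)
      (fun u _ => by
        have t := abs_le.1 (logpoly h0 (by linarith) J u)
        have l := log_le_D2 (pos_quad (r := r) (by linarith) h0 u)
        linarith [t.1])
    simp only [TF_zero, mul_zero, sin_zero, sub_zero] at k
    have j := mul_le_sin hs0 g
    have : 0.6366*s ≤ 2/π*s := by
      gcongr; rw [le_div_iff₀ hp]; linarith
    have : r/2*(0.6366*s) ≤ r/2*sin s := by gcongr; linarith
    linarith
  · right
    have k := le_of_deriv (f := fun u => -TF r J u) (f' := fun u => PF r J u) hs
      ((TF_cont r J).neg.continuousOn)
      (fun u _ => (TF_deriv r J u).neg.congr_deriv (by simp))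
      (fun u hu => by
        have t := abs_le.1 (logpoly h0 (by linarith) J u)
        have c0 : cos u ≤ 0 := cos_nonpos_of_pi_div_two_le_of_le (by linarith [hu.1]) (by linarith [hu.2])
        have l := one_sub_inv_le_log_of_pos (pos_quad (r := r) (by linarith) h0 u)
        have l2 : (1 + r^2 - 2*r*cos u)⁻¹ ≤ (1+r^2)⁻¹ := by
          gcongr; nlinarith
        have l3 : (1+r^2)⁻¹ ≤ 1 - r^2/2 := by
          rw [inv_le_iff_one_le_mul₀ (by positivity)]
          have : r^2 ≤ 1 := by nlinarith
          nlinarith [sq_nonneg r]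
        linarith [t.2])
    rw [TF_pi] at k
    linarith

lemma TF_high (h0 : 0 ≤ r) (h1 : r ≤ 0.9) (hε : r^(J+1)/((J+1)*(1-r)) ≤ ε) {τ : ℝ}
    (hs0 : 0 ≤ τ) : TF r J (π+τ) ≤ (-0.15342 + (1+r^2)/4 + ε)*τ + r/2*sin τ := by
  have k := le_of_deriv (f := fun u => TF r J u - ((-0.15342 + (1+r^2)/4 + ε)*(u-π) - r/2*sin u))
      (f' := fun u => -PF r J u - ((-0.15342 + (1+r^2)/4 + ε) - r/2*cos u)) (p := π) (q := π+τ) (by linarith)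
      (((TF_cont r J).sub (by fun_prop)).continuousOn)
      (fun u _ => by
        refine ((TF_deriv r J u).sub ((((hasDerivAt_id u).sub_const π).const_mul _).sub ((hasDerivAt_sin u).const_mul _))).congr_deriv ?_
        simp)
      (fun u _ => by
        have t := abs_le.1 (logpoly h0 (by linarith) J u)
        have l := log_le_D2 (pos_quad (r := r) (by linarith) h0 u)
        linarith [t.1])
  simp only [TF_pi, sub_self, sin_pi, mul_zero, add_sub_cancel_left] at k
  have : sin (π+τ) = - sin τ := by rw [add_comm, sin_add_pi]
  rw [this] at k
  linarith

lemma sin_quad {τ : ℝ} (h0 : 0 ≤ τ) (h1 : τ ≤ π) : sin τ ≤ 1 - 0.2026*(τ-π/2)^2 := by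
  have p2 := pi_lt_d4
  have p0 := pi_pos
  rw [← cos_sub_pi_div_two]
  have h := cos_le_one_sub_mul_cos_sq (x := τ-π/2) (by rw [abs_le]; constructor <;> linarith)
  have : 0.2026*(τ-π/2)^2 ≤ 2/π^2*(τ-π/2)^2 := by
    gcongr
    rw [le_div_iff₀ (by positivity)]; nlinarith
  linarith

/-- main bound for `TF`; `o` = offset -/
lemma TF_bound (h0 : 0 ≤ r) (h1 : r ≤ 0.9) (hε : r^(J+1)/((J+1)*(1-r)) ≤ ε) (hε2 : ε ≤ r^2/4) {l : ℝ} (l0 : 0 ≤ l) (k : ℕ)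
    (c1 : -0.15342 + (1+r^2)/4 + ε - 0.3183*r ≤ l)
    (c2 : ∀ τ : ℝ, 0 ≤ τ → τ ≤ π → (-0.15342 + (1+r^2)/4 + ε)*τ + r/2*sin τ ≤ l*(τ+π+k*(2*π))) {s : ℝ} (hs : k*(2*π) ≤ s) :
    TF r J s ≤ l * s := by
  have hp := pi_pos
  set K := ⌊s/(2*π)⌋₊ with hK
  have s0 : 0 ≤ s := le_trans (by positivity) hs
  have hk : k ≤ K := by rw [hK]; apply Nat.le_floor; rw [le_div_iff₀ (by positivity)]; exact hs
  have f1 : K*(2*π) ≤ s := by rw [← le_div_iff₀ (by positivity)]; exact Nat.floor_le (by positivity)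
  have f2 : s < (K+1)*(2*π) := by rw [← div_lt_iff₀ (by positivity)]; exact Nat.lt_floor_add_one _
  obtain ⟨u, hu⟩ : ∃ u, s = u + K*(2*π) := ⟨s - K*(2*π), by ring⟩
  have hk' : k*(2*π) ≤ K*(2*π) := by gcongr
  rw [hu, TF_per]
  rw [hu] at f1 f2
  rcases le_total u π with g | g
  · have lu : l*u ≤ l*(u+K*(2*π)) := by gcongr; linarith [show 0 ≤ K*(2*π) by positivity]
    rcases TF_low h0 h1 hε hε2 (s := u) (by linarith) g with q | q
    · have : (-0.15342 + (1+r^2)/4 + ε - 0.3183*r)*u ≤ l*u := by gcongr; linarith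
      linarith
    · have : 0 ≤ l*u := mul_nonneg l0 (by linarith)
      linarith
  · have t := TF_high h0 h1 hε (τ := u - π) (by linarith)
    have t2 := c2 (u-π) (by linarith) (by linarith)
    rw [add_sub_cancel] at t
    have : l*(u - π + π + k*(2*π)) ≤ l*(u+K*(2*π)) := by gcongr; linarith
    linarith
end
end QP
end

section
open Real Set MeasureTheory
namespace QP

/-- Dirichlet-type sum -/
noncomputable def DD (n : ℕ) (x : ℝ) : ℝ := ∑ k ∈ Finset.Icc 1 n, cos (k*x)

lemma DD_eq (n : ℕ) (x : ℝ) : 2 * sin (x/2) * DD n x = sin ((n+1/2)*x) - sin (x/2) := by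
  induction n with
  | zero => simp [DD]; ring_nf
  | succ n ih =>
    unfold DD at *
    rw [Finset.sum_Icc_succ_top (by omega), mul_add, ih]
    have h1 : ((n:ℝ)+1/2)*x = (n+1)*x - x/2 := by ring
    have h2 : (((n+1:ℕ):ℝ)+1/2)*x = (n+1)*x + x/2 := by push_cast; ring
    rw [h1, h2, sin_add, sin_sub]; push_cast; ring

lemma DD_far {n : ℕ} {x σ : ℝ} (h0 : 0 < σ) (h : σ ≤ |sin (x/2)|) : -DD n x ≤ 1/2 + 1/(2*σ) := by
  have e := DD_eq n x
  have hs : sin (x/2) ≠ 0 := by intro h'; rw [h', abs_zero] at h; linarith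
  have e1 : DD n x = sin ((n+1/2)*x)/(2*sin (x/2)) - 1/2 := by
    rw [eq_sub_iff_add_eq, eq_div_iff (by positivity)]; linarith
  have : |sin ((n+1/2)*x)/(2*sin (x/2))| ≤ 1/(2*σ) := by
    rw [abs_div, abs_mul, abs_two]
    gcongr
    exact abs_sin_le_one _
  rw [e1]; linarith [(abs_le.1 this).1]

lemma DD_near {n : ℕ} {x : ℝ} (h0 : 0 < x) (h : x ≤ π) : -DD n x ≤ 1.5 - sin (n*x)/x := by
  have e := DD_eq n x
  obtain ⟨y, rfl⟩ : ∃ y, x = 2*y := ⟨x/2, by ring⟩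
  have y0 : 0 < y := by linarith
  rw [mul_div_cancel_left₀ _ (two_ne_zero)] at e
  have sp : 0 < sin y := sin_pos_of_pos_of_lt_pi y0 (by linarith [pi_pos])
  have cp : 0 ≤ cos y := cos_nonneg_of_mem_Icc ⟨by linarith [pi_pos], by linarith⟩
  have e3 : ((n:ℝ)+1/2)*(2*y) = n*(2*y) + y := by ring
  rw [e3, sin_add] at e
  set A := sin (n*(2*y))
  have hA : |A| ≤ 1 := abs_sin_le_one _
  have hC := cos_le_one (n*(2*y))
  have hC2 := neg_one_le_cos (n*(2*y))
  have e1 : DD n (2*y) = A*(cos y/sin y)/2 + cos (n*(2*y))/2 - 1/2 := by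
    generalize cos (n*(2*y)) = C at *
    field_simp; linarith
  have k1 : 0 ≤ 1/y - cos y/sin y := by
    rw [sub_nonneg, div_le_div_iff₀ sp y0]
    rcases lt_or_ge y (π/2) with g | g
    · have := le_tan y0.le g
      rw [tan_eq_sin_div_cos, le_div_iff₀ (cos_pos_of_mem_Ioo ⟨by linarith, g⟩)] at this
      linarith
    · have : cos y ≤ 0 := cos_nonpos_of_pi_div_two_le_of_le g (by linarith [pi_pos])
      nlinarith
  have k2 : 1/y - cos y/sin y ≤ 1 := by
    have : 1/y - cos y/sin y = (sin y - y*cos y)/(y*sin y) := by field_simp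
    rw [this, div_le_one (by positivity)]
    rcases le_total 1 y with g | g
    · nlinarith
    · have h1 := sin_le y0.le
      have h2 := one_sub_sq_div_two_le_cos (x := y)
      have h3 : (1-y)*sin y ≤ (1-y)*y := by apply mul_le_mul_of_nonneg_left h1; linarith
      have h4 : y*(1-y) ≤ y*cos y := by gcongr; nlinarith
      linarith
  have k3 : -1 ≤ -A*(1/y - cos y/sin y) * (-1) := by
    have : |A*(1/y - cos y/sin y)| ≤ 1*1 := by
      rw [abs_mul, abs_of_nonneg k1]; gcongr
    have := (abs_le.1 this).1
    linarith
  have k4 : A*(1/y - cos y/sin y) ≤ 1 := by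
    have : |A*(1/y - cos y/sin y)| ≤ 1*1 := by
      rw [abs_mul, abs_of_nonneg k1]; gcongr
    linarith [(abs_le.1 this).2]
  rw [e1]
  have e2 : A/(2*y) = A*(1/y)/2 := by field_simp
  rw [e2]
  linarith

lemma DD_red (x : ℝ) : ∃ x' ∈ Icc 0 π, ∀ n, DD n x = DD n x' := by
  have hp := pi_pos
  set N := round (x/(2*π)) with hN
  have h := abs_sub_round (x/(2*π))
  rw [← hN] at h
  refine ⟨|x - N*(2*π)|, ⟨abs_nonneg _, ?_⟩, fun n => ?_⟩
  · have : x - N*(2*π) = (x/(2*π) - N)*(2*π) := by field_simp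
    rw [this, abs_mul, abs_of_pos (show 0 < 2*π by positivity)]
    nlinarith
  · unfold DD
    refine Finset.sum_congr rfl fun k _ => ?_
    have h1 : (k:ℝ)*|x - N*(2*π)| = |k*(x-N*(2*π))| := by rw [abs_mul, abs_of_nonneg (by positivity : (0:ℝ) ≤ k)]
    rw [h1, cos_abs]
    have h2 : (k:ℝ)*(x-N*(2*π)) = k*x - ((k*N:ℤ):ℝ)*(2*π) := by push_cast; ring
    rw [h2, cos_sub_int_mul_two_pi]

lemma DD_all (n : ℕ) (x : ℝ) : -DD n x ≤ n/4 + 1.5 := by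
  obtain ⟨y, hy, h⟩ := DD_red x
  rw [h]
  rcases hy.1.lt_or_eq with g | g
  · have := DD_near (n := n) g hy.2
    have k : -(sin (n*y)/y) ≤ n/4 := by
      rw [← neg_div, div_le_iff₀ g]
      have s0 : 0 ≤ n*y := by positivity
      have hp := pi_gt_d2
      have : -sin (n*y) ≤ (n*y)/4 := by
        rcases le_total (n*y) π with q | q
        · have := sin_nonneg_of_nonneg_of_le_pi s0 q; linarith
        rcases le_total (n*y) 4 with q2 | q2
        · rw [← sin_sub_pi]
          have := sin_le (x := n*y-π) (by linarith)
          linarith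
        · linarith [neg_one_le_sin (n*y)]
      linarith
    linarith
  · rw [← g]; simp [DD]; linarith [show (0:ℝ) ≤ n by positivity]

lemma sin_pt (x : ℝ) : |2*sin x| ≤ exp (0.0576 - PF 0.9 35 (2*x)) := by
  rcases eq_or_ne (sin x) 0 with h | h
  · rw [h]; simp; positivity
  have hp : 0 < |2*sin x| := by positivity
  rw [← log_le_iff_le_exp hp]
  have q := pos_quad (r := 0.9) (by norm_num) (by norm_num) (2*x)
  have h1 : |2*sin x|^2 ≤ (20/19)^2*(1+0.9^2 - 2*0.9*cos (2*x)) := by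
    rw [sq_abs, cos_two_mul]
    nlinarith [sin_sq_add_cos_sq x, cos_sq_le_one x]
  have h2 := log_le_log (by positivity) h1
  rw [log_pow, log_mul (by norm_num) q.ne', log_pow] at h2
  have h3 := (abs_le.1 (logpoly (r := 0.9) (by norm_num) (by norm_num) 35 (2*x))).2
  have h4 : log (20/19:ℝ) ≤ 0.05132 := by
    rw [log_le_iff_le_exp (by norm_num)]
    refine le_trans ?_ (quadratic_le_exp_of_nonneg (by norm_num))
    norm_num
  have h5 : (0.9:ℝ)^(35+1)/(((35:ℕ):ℝ)+1)/(1-0.9) ≤ 0.00626 := by norm_num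
  rw [div_div] at h5
  push_cast at h2 h3 h5
  linarith

lemma S_le (n : ℕ) (x : ℝ) : |S n x| ≤ exp (n*0.0576 + ∑ m ∈ Finset.range 35, (0.9:ℝ)^(m+1)/(m+1) * (-DD n ((m+1)*(2*x)))) := by
  unfold S
  rw [Finset.abs_prod]
  calc ∏ k ∈ Finset.Icc 1 n, |2*sin (k*x)| ≤ ∏ k ∈ Finset.Icc 1 n, exp (0.0576 - PF 0.9 35 (2*(k*x))) :=
        Finset.prod_le_prod (fun _ _ => abs_nonneg _) fun k _ => sin_pt _
    _ = _ := by
        rw [← Real.exp_sum]; congr 1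
        rw [Finset.sum_sub_distrib]
        simp only [Finset.sum_const, Nat.card_Icc, add_tsub_cancel_right, nsmul_eq_mul, sub_eq_add_neg]
        congr 1
        unfold PF DD
        rw [Finset.sum_comm, ← Finset.sum_neg_distrib]
        refine Finset.sum_congr rfl fun m _ => ?_
        rw [← Finset.mul_sum, ← mul_neg]
        congr 3; ext k; congr 1; ring

lemma far_mult {β : ℝ} {p : ℤ} {q m : ℕ} (q0 : 0 < q) (hc : IsCoprime p (q:ℤ)) (hb : |β - p/q| ≤ 1/(70*q)) (hm : m ≤ 35) (hq : ¬ q ∣ m) :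
    1/(q:ℝ) ≤ |sin (m*(β*π))| := by
  have qr : (0:ℝ) < q := by exact_mod_cast q0
  have hp := pi_pos
  set N := round (m*β) with hN
  have h := abs_sub_round (m*β)
  rw [← hN] at h
  have h1 : 1 ≤ |(m:ℤ)*p - N*q| := by
    refine Int.one_le_abs ?_
    intro h0
    apply hq
    have : (q:ℤ) ∣ m*p := ⟨N, by linarith⟩
    have := hc.symm.dvd_of_dvd_mul_right this
    exact_mod_cast this
  have h2 : (1:ℝ) ≤ |(m:ℝ)*p - N*q| := by exact_mod_cast h1
  have e1 : (m:ℝ)*β - N = ((m:ℝ)*p - N*q)/q + m*(β - p/q) := by field_simp; ring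
  have h3 : 1/(2*(q:ℝ)) ≤ |(m:ℝ)*β - N| := by
    have k1 : 1/(q:ℝ) ≤ |((m:ℝ)*p - N*q)/q| := by rw [abs_div, abs_of_pos qr]; gcongr
    have k2 : |(m:ℝ)*(β - p/q)| ≤ 35*(1/(70*q)) := by
      rw [abs_mul, abs_of_nonneg (by positivity : (0:ℝ) ≤ m)]
      have : (m:ℝ) ≤ 35 := by exact_mod_cast hm
      gcongr
    have k3 := abs_sub_abs_le_abs_sub (((m:ℝ)*p - N*q)/q) (-(m*(β - p/q)))
    rw [sub_neg_eq_add, ← e1, abs_neg] at k3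
    have k4 : 1/(q:ℝ) - 35*(1/(70*q)) = 1/(2*(q:ℝ)) := by field_simp; norm_num
    linarith
  have e2 : |sin (m*(β*π))| = sin (π*|m*β - N|) := by
    have : (m:ℝ)*(β*π) = π*(m*β - N) + N*π := by ring
    rw [this, sin_add_int_mul_pi, abs_mul]
    have h1 : |((-1:ℝ))^N| = 1 := by simp
    rw [h1, one_mul]
    have : π*|m*β-N| = |π*(m*β-N)| := by rw [abs_mul, abs_of_pos hp]
    rw [this]
    rcases abs_cases (π*(m*β-N)) with ⟨g, g2⟩ | ⟨g, g2⟩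
    · rw [g, abs_of_nonneg]
      apply sin_nonneg_of_nonneg_of_le_pi g2
      nlinarith [(abs_le.1 h).2]
    · rw [g, sin_neg, abs_of_nonpos]
      apply sin_nonpos_of_nonpos_of_neg_pi_le g2.le
      nlinarith [(abs_le.1 h).1]
  rw [e2]
  have j := mul_le_sin (x := π*|m*β - N|) (by positivity) (by nlinarith)
  have : 2/π*(π*|m*β-N|) = 2*|m*β-N| := by field_simp
  rw [this] at j
  have : 1/(q:ℝ) = 2*(1/(2*q)) := by field_simp
  linarith
end QP
end

section
open Real Set MeasureTheory
namespace QP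

lemma mult_sum {r l : ℝ} {J n : ℕ} {ψ : ℝ} (r0 : 0 ≤ r) (l0 : 0 ≤ l) (p0 : 0 ≤ ψ) (hJ : J*ψ ≤ π) (hT : 0 < ψ → TF r J (n*ψ) ≤ l*(n*ψ)) :
    ∑ j ∈ Finset.range J, r^(j+1)/((j:ℝ)+1) * (-DD n ((j+1)*ψ)) ≤ 1.5*(∑ j ∈ Finset.range J, r^(j+1)/((j:ℝ)+1)) + l*n := by
  rcases p0.lt_or_eq with h | h
  · have h1 : ∑ j ∈ Finset.range J, r^(j+1)/((j:ℝ)+1) * (-DD n ((j+1)*ψ)) ≤ ∑ j ∈ Finset.range J, (1.5*(r^(j+1)/((j:ℝ)+1)) + (r^(j+1)/((j:ℝ)+1)*(-(sin ((j+1)*(n*ψ))/(j+1))))/ψ) := by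
      refine Finset.sum_le_sum fun j hj => ?_
      have jJ : (j:ℝ)+1 ≤ J := by exact_mod_cast Finset.mem_range.1 hj
      have := DD_near (n := n) (x := (j+1)*ψ) (by positivity) (le_trans (by gcongr) hJ)
      have e : (n:ℝ)*((j+1)*ψ) = (j+1)*(n*ψ) := by ring
      rw [e] at this
      calc _ ≤ r^(j+1)/((j:ℝ)+1) * (1.5 - sin ((j+1)*(n*ψ))/((j+1)*ψ)) := by gcongr
        _ = _ := by rw [← div_div]; ring
    refine h1.trans ?_
    rw [Finset.sum_add_distrib, ← Finset.mul_sum, ← Finset.sum_div]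
    have := hT h
    have k : TF r J (n*ψ)/ψ ≤ l*n := by rw [div_le_iff₀ h]; linarith
    unfold TF at k
    linarith
  · rw [← h]
    have : ∑ j ∈ Finset.range J, r^(j+1)/((j:ℝ)+1) * (-DD n ((j+1)*0)) ≤ 0 := by
      refine Finset.sum_nonpos fun j _ => ?_
      have : DD n ((j+1)*0) = n := by simp [DD]
      rw [this]
      have : 0 ≤ r^(j+1)/((j:ℝ)+1)*n := by positivity
      linarith
    have : 0 ≤ ∑ j ∈ Finset.range J, r^(j+1)/((j:ℝ)+1) := Finset.sum_nonneg fun j _ => by positivity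
    have : 0 ≤ l*n := by positivity
    linarith

lemma wq_check : ∀ q ∈ Finset.Icc 4 69, (∑ m ∈ Finset.range 35, (9/10:ℚ)^(m+1)/(m+1)*(if q ∣ m+1 then (901/4+3/2) else (1+(q:ℚ))/2)) ≤ 90 ∧ (∑ m ∈ Finset.range 35, (9/10:ℚ)^(m+1)/(m+1)*(if q ∣ m+1 then 1/4 else 0)) ≤ 999/10000 := by
  decide +kernel

/-- the reduced angle -/
lemma DD_angle {β : ℝ} {p : ℤ} {q : ℕ} (q0 : 0 < q) (n j : ℕ) :
    DD n ((j+1)*(q*(2*(β*π)))) = DD n ((j+1)*(2*π*q*|β-p/q|)) := by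
  unfold DD
  refine Finset.sum_congr rfl fun k _ => ?_
  have qr : (q:ℝ) ≠ 0 := by positivity
  have h1 : (k:ℝ)*((j+1)*(2*π*q*|β-p/q|)) = |k*((j+1)*(2*π*q*(β-p/q)))| := by
    rw [abs_mul, abs_mul, abs_mul, abs_of_nonneg (by positivity : (0:ℝ) ≤ k), abs_of_nonneg (by positivity : (0:ℝ) ≤ (j:ℝ)+1), abs_of_nonneg (by positivity : (0:ℝ) ≤ 2*π*q)]
  rw [h1, cos_abs]
  have h2 : (k:ℝ)*((j+1)*(2*π*q*(β-p/q))) = k*((j+1)*(q*(2*(β*π)))) - ((k*(j+1)*p:ℤ):ℝ)*(2*π) := by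
    push_cast; field_simp
  rw [h2, cos_sub_int_mul_two_pi]

lemma c2_1 (τ : ℝ) (h0 : 0 ≤ τ) (h1 : τ ≤ π) : (-0.15342+(1+(0.9:ℝ)^2)/4+0.00626)*τ + 0.9/2*sin τ ≤ 0.0956*(τ+π+((1:ℕ):ℝ)*(2*π)) := by
  have := sin_quad h0 h1
  have a1 := pi_gt_d4
  have a2 := pi_lt_d4
  obtain ⟨u, rfl⟩ : ∃ u, τ = u + π/2 := ⟨τ-π/2, by ring⟩
  rw [add_sub_cancel_right] at this
  push_cast
  nlinarith [sq_nonneg (u-1.15)]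
lemma c2_2 (τ : ℝ) (h0 : 0 ≤ τ) (h1 : τ ≤ π) : (-0.15342+(1+(0.81:ℝ)^2)/4+0.0066)*τ + 0.81/2*sin τ ≤ 0.1802*(τ+π+((0:ℕ):ℝ)*(2*π)) := by
  have := sin_quad h0 h1
  have a1 := pi_gt_d4
  have a2 := pi_lt_d4
  obtain ⟨u, rfl⟩ : ∃ u, τ = u + π/2 := ⟨τ-π/2, by ring⟩
  rw [add_sub_cancel_right] at this
  push_cast
  nlinarith [sq_nonneg (u-0.53)]
lemma c2_3 (τ : ℝ) (h0 : 0 ≤ τ) (h1 : τ ≤ π) : (-0.15342+(1+(0.729:ℝ)^2)/4+0.00694)*τ + 0.729/2*sin τ ≤ 0.2*(τ+π+((0:ℕ):ℝ)*(2*π)) := by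
  have := sin_quad h0 h1
  have a1 := pi_gt_d4
  have a2 := pi_lt_d4
  obtain ⟨u, rfl⟩ : ∃ u, τ = u + π/2 := ⟨τ-π/2, by ring⟩
  rw [add_sub_cancel_right] at this
  push_cast
  nlinarith [sq_nonneg (u-0.246)]

lemma re2 (d : ℕ → ℝ) : ∑ m ∈ Finset.range 35, (0.9:ℝ)^(m+1)/(m+1) * (if 2 ∣ m+1 then d m else 1.5) ≤ (∑ j ∈ Finset.range 17, (0.81:ℝ)^(j+1)/((j:ℝ)+1) * d (2*j+1))/2 + 2.3 ∧ ∑ j ∈ Finset.range 17, (0.81:ℝ)^(j+1)/((j:ℝ)+1) ≤ 1.7 := by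
  constructor
  · simp only [Finset.sum_range_succ, Finset.sum_range_zero]
    norm_num
    linarith
  · norm_num [Finset.sum_range_succ]
lemma re3 (d : ℕ → ℝ) : ∑ m ∈ Finset.range 35, (0.9:ℝ)^(m+1)/(m+1) * (if 3 ∣ m+1 then d m else 2) ≤ (∑ j ∈ Finset.range 11, (0.729:ℝ)^(j+1)/((j:ℝ)+1) * d (3*j+2))/3 + 4 ∧ ∑ j ∈ Finset.range 11, (0.729:ℝ)^(j+1)/((j:ℝ)+1) ≤ 1.4 := by
  constructor
  · simp only [Finset.sum_range_succ, Finset.sum_range_zero]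
    norm_num
    linarith
  · norm_num [Finset.sum_range_succ]

set_option maxHeartbeats 1000000 in
lemma minor {n : ℕ} (hn : 901 ≤ n) {α : ℝ} (h1 : π/n ≤ α) (h2 : α ≤ π/2) : |S n α| ≤ exp (0.1575*n) := by
  refine (S_le n α).trans (exp_le_exp.2 ?_)
  have hp := pi_pos
  have nr : (901:ℝ) ≤ n := by exact_mod_cast hn
  obtain ⟨β, rfl⟩ : ∃ β, α = β*π := ⟨α/π, by field_simp⟩
  have b1 : 1/(n:ℝ) ≤ β := by
    have : 1/(n:ℝ)*π ≤ β*π := by rw [one_div_mul_eq_div]; exact h1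
    exact le_of_mul_le_mul_right this hp
  have b2 : β ≤ 1/2 := by
    have : β*π ≤ 1/2*π := by linarith
    exact le_of_mul_le_mul_right this hp
  have b0 : 0 < β := lt_of_lt_of_le (by positivity) b1
  obtain ⟨ρ, hρ, hd⟩ := Real.exists_rat_abs_sub_le_and_den_le β (n := 69) (by norm_num)
  have q0 := ρ.den_pos
  have hc : IsCoprime ρ.num (ρ.den:ℤ) := by
    rw [Int.isCoprime_iff_gcd_eq_one]
    exact ρ.reduced
  rw [Rat.cast_def] at hρ
  have hb : |β - ρ.num/ρ.den| ≤ 1/(70*ρ.den) := by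
    refine hρ.trans (le_of_eq ?_); norm_num
  clear hρ
  generalize ρ.num = p at *
  generalize ρ.den = q at *
  have qr : (0:ℝ) < q := by exact_mod_cast q0
  have far : ∀ m ∈ Finset.range 35, ¬ q ∣ m+1 → -DD n (((m:ℝ)+1)*(2*(β*π))) ≤ (1+q)/2 := by
    intro m hm hq
    have k := far_mult q0 hc hb (Finset.mem_range.1 hm) hq
    have e : ((m+1:ℕ):ℝ)*(β*π) = (((m:ℝ)+1)*(2*(β*π)))/2 := by push_cast; ring
    rw [e] at k
    refine (DD_far (by positivity) k).trans (le_of_eq ?_)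
    field_simp
  set ψ := 2*π*q*|β-p/q| with hψ
  have ps0 : 0 ≤ ψ := by positivity
  have ps1 : ψ ≤ π/35 := by
    rw [hψ]
    calc 2*π*q*|β-p/q| ≤ 2*π*q*(1/(70*q)) := by gcongr
      _ = π/35 := by field_simp; norm_num
  have ang := fun j => DD_angle (β := β) (p := p) q0 n j
  simp only [← hψ] at ang
  rcases lt_or_ge q 4 with hq | hq
  · interval_cases q
    · have hp0 : p = 0 := by
        have g := abs_le.1 hb
        norm_num at g
        have g1 : (p:ℝ) < 1 := by linarith [g.1]
        have g2 : (-1:ℝ) < p := by linarith [g.2]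
        have g3 : p < 1 := by exact_mod_cast g1
        have g4 : -1 < p := by exact_mod_cast g2
        omega
      have eψ : (n:ℝ)*ψ = 2*π*(n*β) := by rw [hψ, hp0]; simp [abs_of_pos b0]; ring
      have nb : 1 ≤ (n:ℝ)*β := by
        rw [div_le_iff₀ (by positivity)] at b1; linarith
      have T := mult_sum (n := n) (r := 0.9) (l := 0.0956) (J := 35) (ψ := ψ) (by norm_num) (by norm_num) ps0 (by push_cast; linarith) (fun _ => TF_bound (ε := 0.00626) (by norm_num) (by norm_num) (by norm_num) (by norm_num) (by norm_num) 1 (by norm_num) c2_1 (by rw [eψ]; push_cast; nlinarith))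
      have : ∀ j : ℕ, DD n (((j:ℝ)+1)*(2*(β*π))) = DD n ((j+1)*ψ) := by
        intro j; rw [← ang]; simp
      simp only [this]
      have B : ∑ j ∈ Finset.range 35, (0.9:ℝ)^(j+1)/((j:ℝ)+1) ≤ 2.2975 := by
        norm_num [Finset.sum_range_succ]
      linarith
    · have T := mult_sum (n := n) (r := 0.81) (l := 0.1802) (J := 17) (ψ := ψ) (by norm_num) (by norm_num) ps0 (by push_cast; linarith) (fun _ => TF_bound (ε := 0.0066) (by norm_num) (by norm_num) (by norm_num) (by norm_num) (by norm_num) 0 (by norm_num) c2_2 (by simp; positivity))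
      have X : ∑ m ∈ Finset.range 35, (0.9:ℝ)^(m+1)/(m+1) * (-DD n (((m:ℝ)+1)*(2*(β*π)))) ≤ ∑ m ∈ Finset.range 35, (0.9:ℝ)^(m+1)/(m+1) * (if 2 ∣ m+1 then (-DD n (((m:ℝ)+1)*(2*(β*π)))) else 1.5) := by
        refine Finset.sum_le_sum fun m hm => ?_
        gcongr
        split_ifs with g
        · exact le_rfl
        · refine (far m hm g).trans ?_; norm_num
      simp only [← ang] at T
      have R := re2 fun m => -DD n (((m:ℝ)+1)*(2*(β*π)))
      have e : ∀ j : ℕ, (((2*j+1:ℕ):ℝ)+1)*(2*(β*π)) = (j+1)*((2:ℕ)*(2*(β*π))) := by intro j; push_cast; ring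
      simp only [e] at R
      linarith [R.1, R.2]
    · have T := mult_sum (n := n) (r := 0.729) (l := 0.2) (J := 11) (ψ := ψ) (by norm_num) (by norm_num) ps0 (by push_cast; linarith) (fun _ => TF_bound (ε := 0.00694) (by norm_num) (by norm_num) (by norm_num) (by norm_num) (by norm_num) 0 (by norm_num) c2_3 (by simp; positivity))
      have X : ∑ m ∈ Finset.range 35, (0.9:ℝ)^(m+1)/(m+1) * (-DD n (((m:ℝ)+1)*(2*(β*π)))) ≤ ∑ m ∈ Finset.range 35, (0.9:ℝ)^(m+1)/(m+1) * (if 3 ∣ m+1 then (-DD n (((m:ℝ)+1)*(2*(β*π)))) else 2) := by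
        refine Finset.sum_le_sum fun m hm => ?_
        gcongr
        split_ifs with g
        · exact le_rfl
        · refine (far m hm g).trans ?_; norm_num
      simp only [← ang] at T
      have R := re3 fun m => -DD n (((m:ℝ)+1)*(2*(β*π)))
      have e : ∀ j : ℕ, (((3*j+2:ℕ):ℝ)+1)*(2*(β*π)) = (j+1)*((3:ℕ)*(2*(β*π))) := by intro j; push_cast; ring
      simp only [e] at R
      linarith [R.1, R.2]
  · obtain ⟨w1, w2⟩ := wq_check q (Finset.mem_Icc.2 ⟨hq, hd⟩)
    have w1' : (∑ m ∈ Finset.range 35, (9/10:ℝ)^(m+1)/(m+1)*(if q ∣ m+1 then (901/4+3/2) else (1+(q:ℝ))/2)) ≤ 90 := by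
      have := (Rat.cast_le (K := ℝ)).2 w1
      push_cast [apply_ite (Rat.cast : ℚ → ℝ)] at this
      exact this
    have w2' : (∑ m ∈ Finset.range 35, (9/10:ℝ)^(m+1)/(m+1)*(if q ∣ m+1 then 1/4 else 0)) ≤ 999/10000 := by
      have := (Rat.cast_le (K := ℝ)).2 w2
      push_cast [apply_ite (Rat.cast : ℚ → ℝ)] at this
      exact this
    have X : ∑ m ∈ Finset.range 35, (0.9:ℝ)^(m+1)/(m+1) * (-DD n (((m:ℝ)+1)*(2*(β*π)))) ≤ ∑ m ∈ Finset.range 35, ((9/10:ℝ)^(m+1)/(m+1)*(if q ∣ m+1 then (901/4+3/2) else (1+(q:ℝ))/2) + (n-901)*((9/10:ℝ)^(m+1)/(m+1)*(if q ∣ m+1 then 1/4 else 0))) := by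
      refine Finset.sum_le_sum fun m hm => ?_
      have e : (0.9:ℝ) = 9/10 := by norm_num
      rw [e, mul_left_comm ((n:ℝ)-901), ← mul_add]
      gcongr
      split_ifs with g
      · have := DD_all n (((m:ℝ)+1)*(2*(β*π))); linarith
      · have := far m hm g; linarith
    rw [Finset.sum_add_distrib, ← Finset.mul_sum] at X
    have : (n-901:ℝ)*(∑ m ∈ Finset.range 35, (9/10:ℝ)^(m+1)/(m+1)*(if q ∣ m+1 then 1/4 else 0)) ≤ (n-901)*(999/10000) := by
      apply mul_le_mul_of_nonneg_left w2'; linarith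
    linarith
end QP
end

section
open Real Set MeasureTheory
namespace QP

lemma phi_deriv {x : ℝ} (h : x ∈ Ioo 0 π) : HasDerivAt (fun x => log (2*sin x)) (cos x/sin x) x := by
  have := sinpos h
  refine (((hasDerivAt_sin x).const_mul 2).log (by positivity)).congr_deriv ?_
  field_simp

lemma cot_anti : AntitoneOn (fun x => cos x/sin x) (Ioo 0 π) := by
  intro x hx y hy hxy
  have h1 := sinpos hx
  have h2 := sinpos hy
  show cos y/sin y ≤ cos x/sin x
  rw [div_le_div_iff₀ h2 h1]
  have := sin_nonneg_of_nonneg_of_le_pi (x := y-x) (by linarith) (by linarith [hx.1, hy.2])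
  rw [sin_sub] at this
  linarith

/-- antiderivative of `log (2 sin x)` -/
noncomputable def JJ (x : ℝ) : ℝ := x*log (2*sin x) - I x

lemma JJ_deriv {x : ℝ} (h : x ∈ Ioo 0 π) : HasDerivAt JJ (log (2*sin x)) x := by
  refine (((hasDerivAt_id x).mul (phi_deriv h)).sub (I_deriv h)).congr_deriv ?_
  rw [c_eq h.1]; simp; ring

lemma JJ_mid {x d : ℝ} (d0 : 0 ≤ d) (h1 : 0 < x - d) (h2 : x + d < π) : JJ (x+d) - JJ (x-d) ≤ 2*d*log (2*sin x) := by
  have sub : ∀ u, x-d ≤ u → u ≤ x+d → u ∈ Ioo 0 π := fun u a b => ⟨by linarith, by linarith⟩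
  have := int_lin (G := JJ) (g := fun x => log (2*sin x)) (A := log (2*sin x)) (B := cos x/sin x) (p := x-d) (q := x+d) (by linarith)
    (fun u hu => (JJ_deriv (sub u hu.1 hu.2)).continuousAt.continuousWithinAt) (fun u hu => JJ_deriv (sub u hu.1.le hu.2.le))
    (fun u hu => by
      have := tangent_le (convex_Ioo 0 π) (fun x hx => phi_deriv hx) cot_anti (sub x (by linarith) (by linarith)) (sub u hu.1.le hu.2.le)
      have e : (x-d+(x+d))/2 = x := by ring
      rw [e]; exact this)
  have e : x + d - (x-d) = 2*d := by ring
  rw [e] at this; exact this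

lemma JJ_sum (n : ℕ) {x : ℝ} (hx : 0 < x) (h : (n+1/2)*x < π) : JJ ((n+1/2)*x) - JJ (x/2) ≤ x*log (S n x) := by
  induction n with
  | zero => 
    have : ((0:ℕ):ℝ)+1/2 = 1/2 := by norm_num
    rw [this]; simp [S]
    rw [show (2⁻¹*x) = x/2 by ring]
  | succ n ih =>
    push_cast at h
    have hnn : (0:ℝ) ≤ n := by positivity
    have e1 := ih (by nlinarith)
    have hm := mul_nonneg hnn hx.le
    have pos : 0 < S n x := by
      apply Finset.prod_pos; intro k hk
      have k1 := (Finset.mem_Icc.1 hk)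
      have k2 : (1:ℝ) ≤ k := by exact_mod_cast k1.1
      have k3 : (k:ℝ) ≤ n := by exact_mod_cast k1.2
      have := sinpos (x := k*x) ⟨by positivity, by nlinarith⟩
      positivity
    have p2 := sinpos (x := ((n:ℝ)+1)*x) ⟨by positivity, by nlinarith⟩
    rw [S_succ]; push_cast
    rw [log_mul pos.ne' (by positivity)]
    have := JJ_mid (x := ((n:ℝ)+1)*x) (d := x/2) (by positivity) (by nlinarith) (by nlinarith)
    rw [show ((n:ℝ)+1)*x + x/2 = (n + 1 + 1/2)*x by ring, show ((n:ℝ)+1)*x - x/2 = (n + 1/2)*x by ring] at this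
    linarith

lemma log_const : 0.1937 ≤ log (2*sin 2.4894) := by
  have p1 := pi_gt_d6
  have p2 := pi_lt_d6
  have h1 : sin 0.65219 ≤ sin 2.4894 := by
    rw [← sin_pi_sub 2.4894]
    apply sin_le_sin_of_le_of_le_pi_div_two <;> linarith
  have h2 := s7 (x := 0.65219) (by norm_num)
  have h3 : (1.2138:ℝ) ≤ 2*sin 2.4894 := by norm_num at h2 ⊢; linarith
  refine le_trans ?_ (log_le_log (by norm_num) h3)
  rw [le_log_iff_exp_le (by norm_num)]
  have := exp_bound' (x := 0.1937) (by norm_num) (by norm_num) (n := 6) (by norm_num)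
  refine this.trans ?_
  norm_num [Finset.sum_range_succ, Nat.factorial]

lemma Rt.S_low {n e : ℕ} {v a : ℝ} (h : Rt n e v a) : exp (0.1937*n - 2.404) ≤ S n a := by
  have R := h.R
  have ap := h.pos
  have am := h.small
  have hi := h.hi
  have lo := h.lo
  have hp := pi_gt_d2
  rw [← le_log_iff_exp_le (S_pos h.mem)]
  have X1 : ((n:ℝ)+1/2)*a ≤ 2.4894 := by linarith
  have X0 : 2.481 ≤ ((n:ℝ)+1/2)*a := by linarith
  have j := JJ_sum n ap (by linarith)
  have q := Q_ge n ap (by linarith)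
  have ca : 0 ≤ c a := by
    have e := c_eq ap
    rw [e]
    have := sinpos (x := a) ⟨ap, by linarith⟩
    have := cos_pos_of_mem_Ioo (x := a) ⟨by linarith, by linarith⟩
    positivity
  have qv : Q n a ≤ 2 := by
    have := h.eq
    unfold F at this
    have := h.v2
    have e1 := h.e1
    have : 0 ≤ (e:ℝ)*c a := by positivity
    linarith
  have i0 : 0 ≤ I (a/2) := by
    have := I_trap (x := 0) (y := a/2) le_rfl (by linarith) (by linarith)
    rw [I_zero, c_zero] at this
    have ca2 : 0 ≤ c (a/2) := by
      rw [c_eq (by linarith)]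
      have := sinpos (x := a/2) ⟨by linarith, by linarith⟩
      have := cos_pos_of_mem_Ioo (x := a/2) ⟨by linarith, by linarith⟩
      positivity
    have : 0 ≤ (a/2-0)*((1+c (a/2))/2) := mul_nonneg (by linarith) (by linarith)
    linarith
  have j0 : JJ (a/2) ≤ 0 := by
    unfold JJ
    have sp := sinpos (x := a/2) ⟨by linarith, by linarith⟩
    have sl := sin_le (x := a/2) (by linarith)
    have := log_nonpos (x := 2*sin (a/2)) (by linarith) (by linarith)
    nlinarith
  have mono : log (2*sin 2.4894) ≤ log (2*sin (((n:ℝ)+1/2)*a)) := by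
    have p := sinpos (x := 2.4894) ⟨by norm_num, by linarith⟩
    apply log_le_log (by positivity)
    have : sin (π-2.4894) ≤ sin (π-((n:ℝ)+1/2)*a) := by
      apply sin_le_sin_of_le_of_le_pi_div_two <;> linarith [pi_lt_d2]
    rw [sin_pi_sub, sin_pi_sub] at this
    linarith
  have lc := log_const
  unfold JJ at j j0
  set l := log (2*sin (((n:ℝ)+1/2)*a))
  have m1 : ((n:ℝ)+1/2)*a*0.1937 ≤ ((n:ℝ)+1/2)*a*l := by
    apply mul_le_mul_of_nonneg_left (by linarith); linarith
  have m2 : a*Q n a ≤ a*2 := by gcongr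
  have : a*(0.1937*n - 2.404) ≤ a*log (S n a) := by nlinarith
  exact le_of_mul_le_mul_left this ap

lemma Rt.S_big {n e : ℕ} {v a : ℝ} (h : Rt n e v a) : (n:ℝ)^4*exp (0.1575*n) ≤ 0.06 * S n a := by
  have R := h.R
  have k := expdec h.hn (k := 0.00905) (by norm_num)
  have k4 : exp (-(0.00905*n))^4 ≤ (exp (-(0.00905*901))*(901/n))^4 := by gcongr
  rw [mul_pow, ← exp_nat_mul, ← exp_nat_mul, div_pow] at k4
  push_cast at k4
  have n4 : (0:ℝ) < (n:ℝ)^4 := by positivity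
  have k5 : (n:ℝ)^4*exp (4*(-(0.00905*n))) ≤ exp (4*(-(0.00905*901)))*901^4 := by
    rw [← mul_div_assoc, le_div_iff₀ n4] at k4; linarith
  have s := h.S_low
  have e1 : exp (0.1575*n) = exp (4*(-(0.00905*n)))*exp (2.404) * exp (0.1937*n-2.404) := by
    rw [← exp_add, ← exp_add]; congr 1; ring
  have k6 : exp (4*(-(0.00905*901)))*901^4 * exp 2.404 ≤ 0.06 := by
    have e2 : exp (4*(-(0.00905*901)))*901^4 * exp 2.404 = 901^4*exp (-(30:ℝ)) * exp (-0.2122:ℝ) := by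
      rw [mul_right_comm, ← exp_add, mul_assoc (901^4), ← exp_add, mul_comm]; congr 2; norm_num
    rw [e2]
    have := exp_m (x := 30) 30 (by norm_num)
    have h2 : exp (-0.2122:ℝ) ≤ 0.85 := by
      rw [exp_neg, inv_le_comm₀ (exp_pos _) (by norm_num)]
      have := quadratic_le_exp_of_nonneg (x := 0.2122) (by norm_num)
      norm_num at this ⊢; linarith
    calc 901^4*exp (-(30:ℝ)) * exp (-0.2122:ℝ) ≤ 901^4*0.36788^30*0.85 := by gcongr
      _ ≤ _ := by norm_num
  calc (n:ℝ)^4*exp (0.1575*n) = ((n:ℝ)^4*exp (4*(-(0.00905*n))))*exp (2.404) * exp (0.1937*n-2.404) := by rw [e1]; ring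
    _ ≤ (exp (4*(-(0.00905*901)))*901^4)*exp (2.404) * exp (0.1937*n-2.404) := by gcongr
    _ ≤ 0.06 * S n a := by gcongr
end QP
end

section
open Real Set MeasureTheory
namespace QP
section
variable {n e : ℕ} {a : ℝ}

lemma Rt.mz (h : Rt n e 0 a) {z : ℝ} (h1 : 0.91 ≤ z) (h2 : z ≤ 1.07) : a*z ∈ Ioo 0 (π/n) := h.r107 (by linarith) h2

lemma Rt.A2_43 (h : Rt n e 0 a) : A2 n e a ≤ 4.32*A1 n e a := by
  linarith [h.A2_hi, h.s_lo, h.R]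

lemma Rt.F_upper (h : Rt n e 0 a) {z : ℝ} (h1 : 0.91 ≤ z) (h2 : z ≤ 1.07) : F n e (a*z) ≤ A1 n e a*(1-z) := by
  have a0 := h.pos
  have t := F_tangent (e := e) h.n0 h.mem (h.mz h1 h2)
  rw [h.eq] at t
  have e1 : F1 n e a*(a*z-a) = A1 n e a*(1-z) := by rw [A1_eq]; ring
  linarith

lemma Rt.F_left (h : Rt n e 0 a) {z : ℝ} (h1 : 0.91 ≤ z) (h2 : z ≤ 1) : A1 n e a*(1-z)*(1-2.16*(1-z)) ≤ F n e (a*z) := by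
  have a0 := h.pos
  have t := F_D (e := e) h.n0 a0 (z := z) (r := 1) (by linarith) le_rfl h2 (by rw [mul_one]; exact h.mem.2)
  rw [h.eq, mul_one] at t
  have := mul_le_mul_of_nonneg_right h.A2_43 (sq_nonneg (1-z))
  norm_num at t
  nlinarith

lemma Rt.F_rightU (h : Rt n e 0 a) {z : ℝ} (h1 : 1 ≤ z) (h2 : z ≤ 1.07) : F n e (a*z) ≤ -(A1 n e a*(z-1)*z) := by
  have a0 := h.pos
  have t := F_U (e := e) h.n0 a0 (z := z) (r := 1) one_pos le_rfl h1 h.mem.2 (h.mz (by linarith) h2).2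
  rw [h.eq, mul_one] at t
  have := mul_le_mul_of_nonneg_right h.A2_lo (sq_nonneg (1-z))
  norm_num at t
  nlinarith

lemma Rt.s_sq (h : Rt n e 0 a) : 0.5156*n^3*a^2 ≤ A1 n e a ∧ A1 n e a ≤ 0.5306*n^3*a^2 := by
  have R := h.R
  have lo := h.lo
  have hi := h.hi
  have q1 : (n*a)^2 ≤ 2.488^2 := by gcongr
  have q2 : 2.481^2 ≤ (n*a)^2 := by gcongr
  have n0 : (0:ℝ) ≤ n := by linarith
  have := mul_le_mul_of_nonneg_left q1 n0
  have := mul_le_mul_of_nonneg_left q2 n0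
  constructor
  · have := h.s_lo; nlinarith
  · have := h.s_hi; nlinarith

lemma Rt.slope (h : Rt n e 0 a) {z : ℝ} (h1 : 0.91 ≤ z) (h2 : z ≤ 1.07) : F n e (a*z)/(a*z)*(a*z-a) ≤ -(0.45*n^3*(a*z-a)^2) := by
  have a0 := h.pos
  have R := h.R
  have z0 : 0 < z := by linarith
  obtain ⟨s1, -⟩ := h.s_sq
  have k : F n e (a*z)*(z-1) ≤ -(0.875*A1 n e a*(z-1)^2*z) := by
    have s0 : 0 ≤ A1 n e a := by linarith [h.s_lo]
    have q : 0 ≤ A1 n e a*(z-1)^2 := by positivity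
    rcases le_total z 1 with g | g
    · have := mul_le_mul_of_nonneg_right (h.F_left h1 g) (sub_nonneg.2 g)
      have := mul_le_mul_of_nonneg_left (show 0.875*z ≤ 1-2.16*(1-z) by linarith) q
      nlinarith
    · have := mul_le_mul_of_nonneg_right (h.F_rightU g h2) (sub_nonneg.2 g)
      have := mul_nonneg q z0.le
      nlinarith
  have e1 : F n e (a*z)/(a*z)*(a*z-a) = F n e (a*z)*(z-1)/z := by field_simp
  rw [e1, div_le_iff₀ z0]
  have q : 0 ≤ (z-1)^2*z := by positivity
  have := mul_le_mul_of_nonneg_right s1 q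
  have : 0 ≤ n^3*a^2*((z-1)^2*z) := by positivity
  nlinarith

lemma Rt.conc (h : Rt n e 0 a) {z : ℝ} (h1 : 0.91 ≤ z) (h2 : z ≤ 1.07) : -(0.85*n^3) ≤ F1 n e (a*z)/(a*z) - F n e (a*z)/(a*z)^2 := by
  have a0 := h.pos
  have R := h.R
  have z0 : 0 < z := by linarith
  obtain ⟨-, s1⟩ := h.s_sq
  have s0 : 0 ≤ A1 n e a := by linarith [h.s_lo]
  have e1 : F1 n e (a*z)/(a*z) - F n e (a*z)/(a*z)^2 = (a*F1 n e (a*z)*z - F n e (a*z))/(a^2*z^2) := by field_simp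
  rw [e1, le_div_iff₀ (by positivity)]
  have u := h.F_upper h1 h2
  have hA := A1_eq n e a
  rcases le_total z 1 with g | g
  · have m := F1_anti (e := e) h.n0 (h.mz h1 h2) h.mem (by nlinarith)
    have m2 := mul_le_mul_of_nonneg_left m a0.le
    have m3 := mul_le_mul_of_nonneg_right m2 z0.le
    have : 0.828 ≤ z^2 := by nlinarith
    have : 0 ≤ n^3*a^2*(z^2-0.828) := by
      have : 0 ≤ z^2-0.828 := by linarith
      positivity
    nlinarith
  · have m := F1_anti (e := e) h.n0 (h.mz h1 h2) (h.mz (z := 1.07) (by norm_num) (by norm_num)) (by gcongr)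
    have d := le_of_deriv (f := fun u => F2 n e (a*1.07)*u - F1 n e u) (f' := fun u => F2 n e (a*1.07) - F2 n e u) (p := a) (q := a*1.07) (by linarith)
      (fun u hu => by
        have mu : u ∈ Ioo 0 (π/n) := ⟨a0.trans_le hu.1, hu.2.trans_lt (h.mz (z := 1.07) (by norm_num) (by norm_num)).2⟩
        exact ((continuous_const.mul continuous_id).continuousAt.sub (F1_deriv (e := e) h.n0 mu).continuousAt).continuousWithinAt)
      (fun u hu => by
        have mu : u ∈ Ioo 0 (π/n) := ⟨a0.trans_le hu.1.le, hu.2.trans (h.mz (z := 1.07) (by norm_num) (by norm_num)).2⟩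
        exact (((hasDerivAt_id u).const_mul _).sub (F1_deriv (e := e) h.n0 mu)).congr_deriv (by simp))
      (fun u hu => by
        have mu : u ∈ Ioo 0 (π/n) := ⟨a0.trans_le hu.1.le, hu.2.trans (h.mz (z := 1.07) (by norm_num) (by norm_num)).2⟩
        have := F2_anti (e := e) h.n0 mu (h.mz (z := 1.07) (by norm_num) (by norm_num)) hu.2.le
        linarith)
    have f2 : -(8.065*A1 n e a) ≤ F2 n e (a*1.07)*a^2 := by
      have q := h.A2_steps.2.2.2
      rw [scal2 (by positivity)]
      have e1 : -A2 n e (a*1.07)/(a*1.07)^2*a^2 = -(A2 n e (a*1.07)/1.07^2) := by field_simp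
      rw [e1]; linarith
    -- a*F1(1.07a) ≥ a*F1 a + 0.07*a^2*F2
    have m2 := mul_le_mul_of_nonneg_left m a0.le
    have d2 := mul_le_mul_of_nonneg_left d a0.le
    have k : -(1.57*A1 n e a) ≤ a*F1 n e (a*z) := by nlinarith
    have m3 := mul_le_mul_of_nonneg_right k z0.le
    have k2 : A1 n e a*(z-1)  + 0 ≤ -F n e (a*z) := by linarith
    have w0 : 0 ≤ z - 1 := by linarith
    have : 0 ≤ A1 n e a*(z-1) := by positivity
    have : 1.57*A1 n e a*z - A1 n e a*(z-1) ≤ 1.6*A1 n e a*z^2 := by nlinarith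
    have := mul_le_mul_of_nonneg_right s1 (sq_nonneg z)
    have : 0 ≤ n^3*a^2*z^2 := by positivity
    nlinarith
end
end QP
end

section
open Real Set MeasureTheory
namespace QP
section
variable {n e : ℕ} {a : ℝ}

lemma Rt.drop_r (h : Rt n e 0 a) : f n e (a*1.07) ≤ f n e a * exp (-(0.00782*n)) := by
  have a0 := h.pos
  have sl := h.s_lo
  have R := h.R
  set s := A1 n e a with hs
  have hm : ∀ u ∈ Icc a (a*1.07), u ∈ Ioo 0 (π/n) := fun u hu =>
    ⟨a0.trans_le hu.1, hu.2.trans_lt (h.r107 (r := 1.07) (by norm_num) (by norm_num)).2⟩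
  have key := le_of_deriv (f := fun u => log (f n e u) + s * ((u-a)/a)^2/2)
    (f' := fun u => F n e u / u + s * ((u-a)/a)/a) (p := a) (q := a*1.07) (by linarith)
    (fun u hu => by
      have := (logf_deriv (e := e) h.n0 (hm u hu)).continuousAt
      exact (this.add (by fun_prop)).continuousWithinAt)
    (fun u hu => by
      have d := logf_deriv (e := e) h.n0 (hm u ⟨hu.1.le, hu.2.le⟩)
      have d2 : HasDerivAt (fun u => (u-a)/a) (1/a) u := ((hasDerivAt_id u).sub_const a).div_const a
      refine (d.add (((d2.pow 2).const_mul s).div_const 2)).congr_deriv ?_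
      simp; ring)
    (fun u hu => by
      have u0 := (hm u ⟨hu.1.le, hu.2.le⟩).1
      have t := h.F_rightU (z := u/a) (by rw [le_div_iff₀ a0]; linarith [hu.1]) (by rw [div_le_iff₀ a0]; linarith [hu.2])
      rw [mul_div_cancel₀ _ a0.ne', ← hs] at t
      have b2 : F n e u/u ≤ -(s*(u/a-1)*(u/a))/u := by gcongr
      have b3 : -(s*(u/a-1)*(u/a))/u = -(s*((u-a)/a)/a) := by field_simp
      linarith)
  simp only [sub_self, zero_div] at key
  have e2 : (a*1.07-a)/a = 0.07 := by field_simp; norm_num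
  rw [e2] at key
  have f1 := f_pos (e := e) h.n0 (hm (a*1.07) ⟨by linarith, le_rfl⟩)
  have f2 := f_pos (e := e) h.n0 h.mem
  have : log (f n e (a*1.07)) ≤ log (f n e a) + -(0.00782*n) := by
    norm_num at key ⊢; linarith
  have := exp_le_exp.2 this
  rwa [exp_add, exp_log f1, exp_log f2] at this

lemma Rt.window_r (h : Rt n e 0 a) {Y : ℝ} (hY : Y ≤ 0.0184) (hYn : Y^2 * n ≤ 0.3025) {x : ℝ}
    (hx : x ∈ Icc a (a*(1+Y))) : 0.57 * f n e a ≤ f n e x := by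
  have a0 := h.pos
  have sl := h.s_lo
  have sh := h.s_hi
  have R := h.R
  set s := A1 n e a with hs
  have s0 : 0 ≤ s := by linarith
  have x1 : x ≤ a*1.07 := hx.2.trans (by gcongr; linarith)
  have hm : ∀ u ∈ Icc a x, u ∈ Ioo 0 (π/n) := fun u hu =>
    ⟨a0.trans_le hu.1, (hu.2.trans x1).trans_lt (h.r107 (r := 1.07) (by norm_num) (by norm_num)).2⟩
  have key := le_of_deriv (f := fun u => -log (f n e u) - 1.05*s * ((u-a)/a)^2/2)
    (f' := fun u => -(F n e u / u) - 1.05*s * ((u-a)/a)/a) (p := a) (q := x) hx.1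
    (fun u hu => by
      have := (logf_deriv (e := e) h.n0 (hm u hu)).continuousAt
      exact (this.neg.sub (by fun_prop)).continuousWithinAt)
    (fun u hu => by
      have d := logf_deriv (e := e) h.n0 (hm u ⟨hu.1.le, hu.2.le⟩)
      have d2 : HasDerivAt (fun u => (u-a)/a) (1/a) u := ((hasDerivAt_id u).sub_const a).div_const a
      refine (d.neg.sub (((d2.pow 2).const_mul (1.05*s)).div_const 2)).congr_deriv ?_
      simp; ring)
    (fun u hu => by
      have u0 := (hm u ⟨hu.1.le, hu.2.le⟩).1
      have y0 : 0 ≤ (u-a)/a := div_nonneg (by linarith [hu.1]) a0.le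
      have y1 : (u-a)/a ≤ 0.0184 := by rw [div_le_iff₀ a0]; nlinarith [hu.2, hx.2]
      have t := h.F_right (w := (u-a)/a) y0 (by linarith)
      have e1 : a*(1+(u-a)/a) = u := by field_simp; ring
      rw [e1, ← hs] at t
      set y := (u-a)/a
      have k : y+2.52*y^2+55/6*y^3 ≤ 1.05*y := by
        have : y*y ≤ 0.0184*y := by gcongr
        have : y*y*y ≤ 0.0184*y*0.0184 := by gcongr
        nlinarith
      have k2 := mul_le_mul_of_nonneg_left k s0
      have b2 : -(1.05*s*y) ≤ F n e u := by linarith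
      have b3 : -(1.05*s*y)/a ≤ F n e u/u := by
        calc -(1.05*s*y)/a = -(1.05*s*y/a) := by ring
          _ ≤ -(1.05*s*y/u) := by
              apply neg_le_neg
              have := hu.1.le
              gcongr
          _ = -(1.05*s*y)/u := by ring
          _ ≤ _ := by gcongr
      have b4 : -(1.05*s*y)/a = -(1.05*s*y/a) := by ring
      linarith)
  simp only [sub_self, zero_div] at key
  have fx := f_pos (e := e) h.n0 (hm x ⟨hx.1, le_rfl⟩)
  have fa := f_pos (e := e) h.n0 h.mem
  set y := (x-a)/a with hy
  have y0 : 0 ≤ y := div_nonneg (by linarith [hx.1]) a0.le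
  have y1 : y ≤ Y := by rw [hy, div_le_iff₀ a0]; linarith [hx.2]
  have b1 : s * Y^2 ≤ 0.98773 := by have := mul_le_mul_of_nonneg_right sh (sq_nonneg Y); nlinarith
  have b2 : s*y^2 ≤ s*Y^2 := by gcongr
  have b3 : log (f n e a) - 0.541 ≤ log (f n e x) := by norm_num at key; linarith
  have b4 := exp_le_exp.2 b3
  rw [exp_log fx, sub_eq_add_neg, exp_add, exp_log fa] at b4
  have := mul_le_mul_of_nonneg_left exp541 fa.le
  linarith

lemma Rt.mass (h : Rt n e 0 a) : 0.627/√n*(a*f n e a) ≤ ∫ t in (a*0.91)..(a*1.07), f n e t := by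
  have a0 := h.pos
  have R := h.R
  obtain ⟨r1, r2, -⟩ := sq_facts h.hn
  have r0 : 0 < √(n:ℝ) := by linarith
  have fa := f_pos (e := e) h.n0 h.mem
  set Y := 0.55/√(n:ℝ) with hY
  have Y0 : 0 < Y := by positivity
  have Y1 : Y ≤ 0.0184 := by rw [hY, div_le_iff₀ r0]; linarith
  have Y2 : Y^2*n ≤ 0.3025 := by
    rw [hY, div_pow, sq √(n:ℝ), r2]; 
    rw [div_mul_cancel₀ _ (by linarith)]; norm_num
  have ii : ∀ p q, IntervalIntegrable (f n e) volume p q := fun p q => (f_cont n e).intervalIntegrable p q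
  have nn : ∀ p q, a*0.91 ≤ p → p ≤ q → q ≤ a*1.07 → 0 ≤ ∫ t in p..q, f n e t := by
    intro p q h1 h2 h3
    refine intervalIntegral.integral_nonneg h2 fun t ht => ?_
    have m1 := h.mz (z := 0.91) le_rfl (by norm_num)
    have m2 := h.mz (z := 1.07) (by norm_num) le_rfl
    exact (f_pos h.n0 ⟨by linarith [m1.1, ht.1], by linarith [m2.2, ht.2]⟩).le
  have s1 := intervalIntegral.integral_add_adjacent_intervals (ii (a*0.91) (a*(1-Y))) (ii (a*(1-Y)) (a*(1+Y)))
  have s2 := intervalIntegral.integral_add_adjacent_intervals (ii (a*0.91) (a*(1+Y))) (ii (a*(1+Y)) (a*1.07))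
  have n1 := nn (a*0.91) (a*(1-Y)) le_rfl (by gcongr; linarith) (by gcongr; linarith)
  have n2 := nn (a*(1+Y)) (a*1.07) (by gcongr; linarith) (by gcongr; linarith) le_rfl
  have c : ∫ t in (a*(1-Y))..(a*(1+Y)), (0.57*f n e a) ≤ ∫ t in (a*(1-Y))..(a*(1+Y)), f n e t := by
    refine intervalIntegral.integral_mono_on (by gcongr; linarith) (by simp) (ii _ _) fun t ht => ?_
    rcases le_total t a with g | g
    · exact f_window h Y0 Y1 Y2 ⟨ht.1, g⟩
    · exact h.window_r Y1 Y2 ⟨g, ht.2⟩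
  rw [intervalIntegral.integral_const, smul_eq_mul] at c
  have e1 : (a*(1+Y)-a*(1-Y))*(0.57*f n e a) = 0.627/√n*(a*f n e a) := by rw [hY]; field_simp; norm_num
  linarith

lemma right_mass {n e : ℕ} (hn : 0 < n) {p : ℝ} (hp : p ∈ Ioo 0 (π/n)) (hF : F n e p < 0) :
    ∫ t in p..(π/n), f n e t ≤ (π/n) * f n e p / (-F n e p) := by
  have p0 := hp.1
  have b0 : 0 < π/(n:ℝ) := p0.trans hp.2
  have c2 := intervalIntegral.integral_le_sub_of_hasDeriv_right_of_le (g := fun t => (π/n)/F n e p * f n e t)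
      (g' := fun t => (π/n)/F n e p*(f n e t * (F n e t/t))) (φ := fun t => f n e t) hp.2.le
      (by have := f_cont n e; fun_prop)
      (fun t ht => ((f_deriv hn ⟨p0.trans ht.1, ht.2⟩).const_mul _).hasDerivWithinAt)
      ((f_cont n e).continuousOn.integrableOn_compact isCompact_Icc)
      (fun t ht => by
        have t0 := p0.trans ht.1
        have m : t ∈ Ioo 0 (π/n) := ⟨t0, ht.2⟩
        have F1 := F_anti (e := e) hn hp m ht.1.le
        have f0 := f_pos (e := e) hn m
        have e1 : (π/n)/F n e p*(F n e t/t) = ((-F n e t)*(π/n))/((-F n e p)*t) := by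
          have := hF.ne
          field_simp
        have : 1 ≤ (π/n)/F n e p*(F n e t/t) := by
          have : 0 < -F n e p := by linarith
          rw [e1, one_le_div (by positivity)]
          exact mul_le_mul (by linarith) ht.2.le t0.le (by linarith)
        have := mul_le_mul_of_nonneg_left this f0.le
        linarith)
  have := f_nonneg (e := e) hn (x := π/n) ⟨b0.le, le_rfl⟩
  have : 0 ≤ (π/n)/(-F n e p) * f n e (π/n) := by
    have : 0 < -F n e p := by linarith
    positivity
  have e1 : (π/n) * f n e p / (-F n e p) = -((π/n)/F n e p * f n e p) := by rw [div_neg]; ring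
  have e2 : (π/n)/(-F n e p) * f n e (π/n) = -((π/n)/F n e p * f n e (π/n)) := by rw [div_neg]; ring
  linarith
end
end QP
end

section
open Real Set MeasureTheory
namespace QP
section
variable {n e : ℕ} {a : ℝ}

/-- bounds of `f` at the two ends of the window -/
lemma Rt.ends (h : Rt n e 0 a) : f n e (a*0.91) ≤ f n e a*(0.001365/√n) ∧ f n e (a*1.07) ≤ f n e a*(0.0274/√n) := by
  have R := h.R
  obtain ⟨r1, r2, r3⟩ := sq_facts h.hn
  have r0 : 0 < √(n:ℝ) := by linarith
  have fa := f_pos (e := e) h.n0 h.mem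
  constructor
  · refine h.f_drop.trans ?_
    gcongr
    refine (expdec h.hn (by norm_num)).trans ?_
    have := exp_m (x := 0.0112*901) 10 (by norm_num)
    calc exp (-(0.0112*901))*(901/n) ≤ 0.36788^10*(30.03/√n) := by gcongr
      _ = (0.36788^10*30.03)/√n := by ring
      _ ≤ _ := by gcongr; norm_num
  · refine h.drop_r.trans ?_
    gcongr
    refine (expdec h.hn (by norm_num)).trans ?_
    have := exp_m (x := 0.00782*901) 7 (by norm_num)
    calc exp (-(0.00782*901))*(901/n) ≤ 0.36788^7*(30.03/√n) := by gcongr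
      _ = (0.36788^7*30.03)/√n := by ring
      _ ≤ _ := by gcongr; norm_num

lemma Rt.bd (h : Rt n e 0 a) : f n e (a*0.91) + f n e (a*1.07) ≤ 0.0186*n*∫ t in (a*0.91)..(a*1.07), f n e t := by
  have R := h.R
  have a0 := h.pos
  obtain ⟨r1, r2, r3⟩ := sq_facts h.hn
  have r0 : 0 < √(n:ℝ) := by linarith
  have fa := f_pos (e := e) h.n0 h.mem
  obtain ⟨h1, h2⟩ := h.ends
  have m := h.mass
  have lo := h.lo
  have e1 : f n e a*(0.001365/√n) + f n e a*(0.0274/√n) = f n e a/√n*0.028765 := by ring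
  have e2 : 0.0186*n*(0.627/√n*(a*f n e a)) = f n e a/√n*(0.0116622*(n*a)) := by ring
  have k : f n e a/√n*0.028765 ≤ f n e a/√n*(0.0116622*(n*a)) := by gcongr; linarith
  have : 0.0186*n*(0.627/√n*(a*f n e a)) ≤ 0.0186*n*∫ t in (a*0.91)..(a*1.07), f n e t := by gcongr
  linarith

lemma Rt.tails (h : Rt n e 0 a) : (∫ t in (0:ℝ)..(a*0.91), f n e t) + (∫ t in (a*1.07)..(π/n), f n e t) ≤ 0.25/n*∫ t in (a*0.91)..(a*1.07), f n e t := by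
  have R := h.R
  have a0 := h.pos
  obtain ⟨r1, r2, r3⟩ := sq_facts h.hn
  have r0 : 0 < √(n:ℝ) := by linarith
  have fa := f_pos (e := e) h.n0 h.mem
  obtain ⟨h1, h2⟩ := h.ends
  have m := h.mass
  have lo := h.lo
  have sl := h.s_lo
  have n0 : (0:ℝ) < n := by linarith
  have F1 := h.F_left (z := 0.91) le_rfl (by norm_num)
  have F1' : 0.2313*n ≤ F n e (a*0.91) := by norm_num at F1 ⊢; linarith
  have F2 := h.F_rightU (z := 1.07) (by norm_num) le_rfl
  have F2' : 0.239*n ≤ -F n e (a*1.07) := by norm_num at F2 ⊢; linarith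
  have t1 := left_mass (e := e) h.n0 (h.mz (z := 0.91) le_rfl (by norm_num)) (by linarith)
  have t2 := right_mass (e := e) h.n0 (h.mz (z := 1.07) (by norm_num) le_rfl) (by linarith)
  have k1 : a*0.91*f n e (a*0.91)/F n e (a*0.91) ≤ a*0.91*(f n e a*(0.001365/√n))/(0.2313*n) := by gcongr
  have k2 : (π/n)*f n e (a*1.07)/(-F n e (a*1.07)) ≤ (3.1416/n)*(f n e a*(0.0274/√n))/(0.239*n) := by
    have := (f_pos (e := e) h.n0 (h.mz (z := 1.07) (by norm_num) le_rfl)).le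
    have := pi_lt_d4
    gcongr
  have e1 : a*0.91*(f n e a*(0.001365/√n))/(0.2313*n) = (0.91*0.001365/0.2313)*(a*f n e a/(√n*n)) := by field_simp
  have e2 : (3.1416/n)*(f n e a*(0.0274/√n))/(0.239*n) = (3.1416*0.0274/0.239)*(f n e a/(√n*n))/n := by field_simp
  have e4 : (3.1416*0.0274/0.239)*(f n e a/(√n*n))/n ≤ (0.1452)*(a*f n e a/(√n*n)) := by
    rw [div_le_iff₀ n0]
    have : (3.1416*0.0274/0.239)*(f n e a/(√n*n)) ≤ (0.1452*(n*a))*(f n e a/(√n*n)) := by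
      gcongr; norm_num; linarith
    refine this.trans (le_of_eq ?_); ring
  have e3 : 0.25/n*(0.627/√n*(a*f n e a)) = 0.15675*(a*f n e a/(√n*n)) := by field_simp; norm_num
  have : 0.25/n*(0.627/√n*(a*f n e a)) ≤ 0.25/n*∫ t in (a*0.91)..(a*1.07), f n e t := by gcongr
  have p : 0 ≤ a*f n e a/(√n*n) := by positivity
  norm_num at *
  linarith

lemma Rt.win_low (h : Rt n e 0 a) {x : ℝ} (hx : |x - π/(2*a)| ≤ 1) (x0 : 0 ≤ x) :
    (1-0.6/n)*(∫ t in (a*0.91)..(a*1.07), f n e t) ≤ ∫ t in (a*0.91)..(a*1.07), f n e t*sin (x*t) := by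
  have R := h.R
  have a0 := h.pos
  have lo := h.lo
  have hi := h.hi
  have sm := h.small
  have n0 : (0:ℝ) < n := by linarith
  have hp1 := pi_gt_d4
  have hp2 := pi_lt_d4
  set δ := x*a - π/2 with hδ
  have d1 : |δ| ≤ a := by
    have : δ = (x-π/(2*a))*a := by rw [hδ]; field_simp
    rw [this, abs_mul, abs_of_pos a0]
    nlinarith
  have d2 : δ^2 ≤ a^2 := by rw [← sq_abs δ]; gcongr
  have xa : x*a ≤ 1.5736 := by have := (abs_le.1 d1).2; linarith
  have xx : x^2 ≤ 0.4024*n^2 := by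
    have : x*2.481 ≤ 1.5736*n := by
      calc x*2.481 ≤ x*(n*a) := by gcongr
        _ = (x*a)*n := by ring
        _ ≤ 1.5736*n := by gcongr
    nlinarith
  have na2 : (n*a)^2 ≤ 2.488^2 := by gcongr
  have key := intervalIntegral.sub_le_integral_of_hasDeriv_right_of_le (g := fun t => 0.5367/n*(f n e t*(t-a)))
      (g' := fun t => 0.5367/n*(f n e t*(F n e t/t)*(t-a)+f n e t)) (φ := fun t => f n e t*(sin (x*t) - (1-0.6/n))) (a := a*0.91) (b := a*1.07) (by linarith)
      (by have := f_cont n e; fun_prop)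
      (fun t ht => by
        have m : t ∈ Ioo 0 (π/n) := ⟨by linarith [ht.1], ht.2.trans (h.mz (z := 1.07) (by norm_num) le_rfl).2⟩
        refine ((((f_deriv (e := e) h.n0 m).mul ((hasDerivAt_id t).sub_const a)).const_mul _).congr_deriv ?_).hasDerivWithinAt
        simp)
      (by have := f_cont n e
          exact (Continuous.continuousOn (by fun_prop)).integrableOn_compact isCompact_Icc)
      (fun t ht => by
        have m : t ∈ Ioo 0 (π/n) := ⟨by linarith [ht.1], ht.2.trans (h.mz (z := 1.07) (by norm_num) le_rfl).2⟩
        have f0 := f_pos (e := e) h.n0 m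
        have sl := h.slope (z := t/a) (by rw [le_div_iff₀ a0]; linarith [ht.1]) (by rw [div_le_iff₀ a0]; linarith [ht.2])
        rw [mul_div_cancel₀ _ a0.ne'] at sl
        have e1 : x*t = π/2 - -(x*(t-a)+δ) := by rw [hδ]; ring
        have c1 := one_sub_sq_div_two_le_cos (x := -(x*(t-a)+δ))
        rw [← sin_pi_div_two_sub, ← e1] at c1
        have q : (x*(t-a)+δ)^2 ≤ 1.2*(x^2*(t-a)^2)+6*δ^2 := by nlinarith [sq_nonneg (0.2*x*(t-a)-δ)]
        have q2 : x^2*(t-a)^2 ≤ 0.4024*n^2*(t-a)^2 := by gcongr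
        have q3 : 3*δ^2 ≤ 0.0207/n := by
          rw [le_div_iff₀ n0]
          have : n*(3*δ^2*n) ≤ n*0.0207 := by nlinarith
          nlinarith
        have q4 : 0.5367/n*(0.45*n^3*(t-a)^2) = 0.241515*n^2*(t-a)^2 := by field_simp; ring
        have q5 := mul_le_mul_of_nonneg_left sl (show 0 ≤ 0.5367/(n:ℝ) by positivity)
        have q6 : 0.6/(n:ℝ) = 0.5367/n+0.0633/n := by rw [← add_div]; norm_num
        have q7 : 0.0207/(n:ℝ) ≤ 0.0633/n := by gcongr; norm_num
        have q8 : 0 ≤ n^2*(t-a)^2 := by positivity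
        have : 0.5367/n*(F n e t/t*(t-a)+1) ≤ sin (x*t) - (1-0.6/n) := by linarith
        have := mul_le_mul_of_nonneg_left this f0.le
        linarith)
  have f1 := f_pos (e := e) h.n0 (h.mz (z := 0.91) le_rfl (by norm_num))
  have f2 := f_pos (e := e) h.n0 (h.mz (z := 1.07) (by norm_num) le_rfl)
  have g1 : 0 ≤ 0.5367/n*(f n e (a*1.07)*(a*1.07-a)) := by
    have : 0 ≤ a*1.07-a := by linarith
    positivity
  have g2 : 0 ≤ 0.5367/n*(f n e (a*0.91)*(a-a*0.91)) := by
    have : 0 ≤ a-a*0.91 := by linarith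
    positivity
  have e1 : ∫ t in (a*0.91)..(a*1.07), f n e t*(sin (x*t) - (1-0.6/n)) = (∫ t in (a*0.91)..(a*1.07), f n e t*sin (x*t)) - (1-0.6/n)*(∫ t in (a*0.91)..(a*1.07), f n e t) := by
    have cf := f_cont n e
    rw [← intervalIntegral.integral_const_mul, ← intervalIntegral.integral_sub]
    · congr 1; ext t; ring
    · exact (Continuous.intervalIntegrable (by fun_prop) _ _)
    · exact (Continuous.intervalIntegrable (by fun_prop) _ _)
  rw [e1] at key
  linarith

lemma winarith {n : ℝ} (h : 901 ≤ n) : (n^2+(n-0.9)^2)/2.91+0.618375*n+0.0186*n ≤ 1.3*(n-0.9)+(n-0.9)^2/1.455 := by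
  have e : (n-0.9)^2 = n^2-1.8*n+0.81 := by ring
  rw [e]
  norm_num
  linarith

lemma Rt.win_up (h : Rt n e 0 a) {x σ : ℝ} (hσ : σ^2 = 1) (hx : 1.3*n ≤ x) :
    ∫ t in (a*0.91)..(a*1.07), f n e t*(σ*sin (x*t)) ≤ (1-0.9/n)*(∫ t in (a*0.91)..(a*1.07), f n e t) := by
  have R := h.R
  have a0 := h.pos
  have n0 : (0:ℝ) < n := by linarith
  set θ := 1-0.9/(n:ℝ) with hθ
  have nθ : n*θ = n-0.9 := by rw [hθ]; field_simp
  have θ0 : 0 < θ := by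
    have : 0 < n*θ := by linarith
    exact pos_of_mul_pos_right this n0.le
  set P := ∫ t in (a*0.91)..(a*1.07), f n e t*(σ*sin (x*t)) with hP
  set A := ∫ t in (a*0.91)..(a*1.07), f n e t with hA
  have fa := f_pos (e := e) h.n0 h.mem
  have A0 : 0 ≤ A := le_trans (by positivity) h.mass
  rcases le_total P 0 with P0 | P0
  · have : 0 ≤ θ*A := by positivity
    linarith
  have hcs : ∀ y, |σ*cos y| ≤ 1 := by
    intro y
    have s1 : |σ| = 1 := by rw [← sq_abs] at hσ; nlinarith [abs_nonneg σ]
    rw [abs_mul, s1, one_mul]; exact abs_cos_le_one y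
  set l := 1.455/(n:ℝ)^2 with hl
  have l0 : 0 < l := by positivity
  have key := intervalIntegral.integral_le_sub_of_hasDeriv_right_of_le (g := fun t => -(f n e t*(σ*cos (x*t))) + l/2*(f n e t*(F n e t/t)))
      (g' := fun t => f n e t*(x*(σ*sin (x*t)) - F n e t/t*(σ*cos (x*t)) + l/2*((F n e t/t)^2 + (F1 n e t/t - F n e t/t^2))))
      (φ := fun t => f n e t*((x+θ/l)*(σ*sin (x*t)) - ((1+θ^2)/(2*l)+l/2*(0.85*n^3)))) (a := a*0.91) (b := a*1.07) (by linarith)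
      (fun t ht => by
        have m : t ∈ Ioo 0 (π/n) := ⟨by linarith [ht.1], ht.2.trans_lt (h.mz (z := 1.07) (by norm_num) le_rfl).2⟩
        have t0 := m.1.ne'
        have c1 := (f_cont n e).continuousAt (x := t)
        have c2 := (F_deriv (e := e) h.n0 m).continuousAt
        refine ContinuousAt.continuousWithinAt ?_
        exact (c1.mul (by fun_prop)).neg.add (continuousAt_const.mul (c1.mul (c2.div continuousAt_id t0))))
      (fun t ht => by
        have m : t ∈ Ioo 0 (π/n) := ⟨by linarith [ht.1], ht.2.trans (h.mz (z := 1.07) (by norm_num) le_rfl).2⟩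
        have t0 := m.1.ne'
        have d1 := f_deriv (e := e) h.n0 m
        have d2 := F_deriv (e := e) h.n0 m
        have d3 : HasDerivAt (fun t => σ*cos (x*t)) (σ*(-sin (x*t)*x)) t := by
          have := ((hasDerivAt_id t).const_mul x).cos.const_mul σ
          simpa using this
        refine (((d1.mul d3).neg.add ((d1.mul (d2.div (hasDerivAt_id t) t0)).const_mul (l/2))).congr_deriv ?_).hasDerivWithinAt
        simp only [id, Pi.div_apply]
        field_simp
        ring)
      (by have := f_cont n e
          exact (Continuous.continuousOn (by fun_prop)).integrableOn_compact isCompact_Icc)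
      (fun t ht => by
        have m : t ∈ Ioo 0 (π/n) := ⟨by linarith [ht.1], ht.2.trans (h.mz (z := 1.07) (by norm_num) le_rfl).2⟩
        have f0 := f_pos (e := e) h.n0 m
        have cc := h.conc (z := t/a) (by rw [le_div_iff₀ a0]; linarith [ht.1]) (by rw [div_le_iff₀ a0]; linarith [ht.2])
        rw [mul_div_cancel₀ _ a0.ne'] at cc
        refine mul_le_mul_of_nonneg_left ?_ f0.le
        set L := F n e t/t
        set Sn := σ*sin (x*t) with hSn
        set Cs := σ*cos (x*t) with hCs
        have sc : Sn^2+Cs^2 = 1 := by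
          rw [hSn, hCs, mul_pow, mul_pow, hσ, one_mul, one_mul, sin_sq_add_cos_sq]
        have c2 := mul_le_mul_of_nonneg_left cc (show 0 ≤ l/2 by positivity)
        have k : -((1+θ^2)/(2*l)) + θ/l*Sn ≤ l/2*L^2 - L*Cs := by
          have e1 : -((1+θ^2)/(2*l)) + θ/l*Sn = (-(1+θ^2)+2*θ*Sn)/(2*l) := by field_simp
          rw [e1, div_le_iff₀ (by positivity)]
          nlinarith [sq_nonneg (l*L-Cs), sq_nonneg (Sn-θ)]
        linarith)
  have f1 := f_pos (e := e) h.n0 (h.mz (z := 0.91) le_rfl (by norm_num))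
  have f2 := f_pos (e := e) h.n0 (h.mz (z := 1.07) (by norm_num) le_rfl)
  have sl := h.s_lo
  have F1 := h.F_left (z := 0.91) le_rfl (by norm_num)
  have F1' : 0 ≤ F n e (a*0.91) := by norm_num at F1 ⊢; linarith
  have F2 := h.F_rightU (z := 1.07) (by norm_num) le_rfl
  have F2' : F n e (a*1.07) ≤ 0 := by norm_num at F2 ⊢; linarith
  have g1 : 0 ≤ l/2*(f n e (a*0.91)*(F n e (a*0.91)/(a*0.91))) := by positivity
  have g2 : l/2*(f n e (a*1.07)*(F n e (a*1.07)/(a*1.07))) ≤ 0 := by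
    have : F n e (a*1.07)/(a*1.07) ≤ 0 := div_nonpos_of_nonpos_of_nonneg F2' (by positivity)
    apply mul_nonpos_of_nonneg_of_nonpos (by positivity)
    exact mul_nonpos_of_nonneg_of_nonpos f2.le this
  have g3 : -(f n e (a*1.07)*(σ*cos (x*(a*1.07)))) ≤ f n e (a*1.07) := by
    have := mul_le_mul_of_nonneg_left (abs_le.1 (hcs (x*(a*1.07)))).1 f2.le
    linarith
  have g4 : (f n e (a*0.91)*(σ*cos (x*(a*0.91)))) ≤ f n e (a*0.91) := by
    have := mul_le_mul_of_nonneg_left (abs_le.1 (hcs (x*(a*0.91)))).2 f1.le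
    linarith
  have e1 : ∫ t in (a*0.91)..(a*1.07), f n e t*((x+θ/l)*(σ*sin (x*t)) - ((1+θ^2)/(2*l)+l/2*(0.85*n^3))) = (x+θ/l)*P - ((1+θ^2)/(2*l)+l/2*(0.85*n^3))*A := by
    have cf := f_cont n e
    rw [hP, hA, ← intervalIntegral.integral_const_mul, ← intervalIntegral.integral_const_mul, ← intervalIntegral.integral_sub]
    · congr 1; ext t; ring
    · exact (Continuous.intervalIntegrable (by fun_prop) _ _)
    · exact (Continuous.intervalIntegrable (by fun_prop) _ _)
  rw [e1] at key
  have bd := h.bd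
  rw [← hA] at bd
  have xP : 1.3*n*P ≤ x*P := by gcongr
  have e2 : θ/l = θ*n^2/1.455 := by rw [hl]; field_simp
  have e3 : (1+θ^2)/(2*l) = (1+θ^2)*n^2/2.91 := by rw [hl]; field_simp; norm_num
  have e4 : l/2*(0.85*n^3) = 0.618375*n := by rw [hl]; field_simp; norm_num
  rw [e2, e3, e4] at key
  have fin : (1.3*n+θ*n^2/1.455)*P ≤ (1.3*n+θ*n^2/1.455)*(θ*A) := by
    have : ((1+θ^2)*n^2/2.91+0.618375*n+0.0186*n) ≤ (1.3*n+θ*n^2/1.455)*θ := by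
      have : (1.3*n+θ*n^2/1.455)*θ = 1.3*(n*θ)+(n*θ)^2/1.455 := by ring
      rw [this]
      have : (1+θ^2)*n^2/2.91 = (n^2+(n*θ)^2)/2.91 := by ring
      rw [this, nθ]; exact winarith R
    have := mul_le_mul_of_nonneg_right this A0
    clear_value P A θ l
    clear hP hA e1 e2 e3 e4 hcs hl hθ nθ h F1 F1' F2 F2'
    linarith
  exact le_of_mul_le_mul_left fin (by positivity)
end
end QP
end

section
open Real Set MeasureTheory
namespace QP
section
variable {n e : ℕ} {a : ℝ}

/-- the contribution of the minor arc -/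
lemma minor_int (hn : 901 ≤ n) {g : ℝ → ℝ} (hg : Continuous g) (hb : ∀ t, |g t| ≤ 1) :
    |(∫ t in (0:ℝ)..(π/2), S n t*g t) - ∫ t in (0:ℝ)..(π/n), S n t*g t| ≤ 1.571*exp (0.1575*n) := by
  have R : (901:ℝ) ≤ n := by exact_mod_cast hn
  have cS := S_cont n
  have ii : ∀ p q : ℝ, IntervalIntegrable (fun t => S n t*g t) volume p q := fun p q => Continuous.intervalIntegrable (by fun_prop) _ _
  have hp := pi_pos
  have hp2 := pi_lt_d4
  have le : π/n ≤ π/2 := by gcongr; linarith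
  rw [intervalIntegral.integral_interval_sub_left (ii _ _) (ii _ _)]
  have := intervalIntegral.norm_integral_le_of_norm_le_const (a := π/n) (b := π/2) (C := exp (0.1575*n)) (f := fun t => S n t*g t) (fun t ht => by
    rw [uIoc_of_le le] at ht
    rw [norm_eq_abs, abs_mul]
    calc |S n t| * |g t| ≤ exp (0.1575*n)*1 := by
          gcongr
          · exact minor hn ht.1.le ht.2
          · exact hb t
      _ = _ := mul_one _)
  rw [norm_eq_abs] at this
  refine this.trans ?_
  rw [mul_comm]
  gcongr
  have : 0 < π/n := by positivity
  rw [abs_of_nonneg (by linarith)]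
  linarith

lemma Rt.inv_bd {v : ℝ} (h : Rt n e v a) : π/(2*a) ≤ 0.634*n := by
  have a0 := h.pos
  rw [div_le_iff₀ (by positivity)]
  have := pi_lt_d4
  have := h.lo
  linarith

lemma split3 {g : ℝ → ℝ} (hg : Continuous g) (p q r : ℝ) :
    ∫ t in (0:ℝ)..r, g t = (∫ t in (0:ℝ)..p, g t) + (∫ t in p..q, g t) + ∫ t in q..r, g t := by
  have ii : ∀ p q : ℝ, IntervalIntegrable g volume p q := fun p q => hg.intervalIntegrable _ _
  rw [intervalIntegral.integral_add_adjacent_intervals (ii _ _) (ii _ _), intervalIntegral.integral_add_adjacent_intervals (ii _ _) (ii _ _)]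

lemma Rt.exp_A (h : Rt n 0 0 a) : 3.142*exp (0.1575*n) < 0.05/n*∫ t in (a*0.91)..(a*1.07), f n 0 t := by
  have R := h.R
  have n0 : (0:ℝ) < n := by linarith
  have a0 := h.pos
  obtain ⟨r1, r2, r3⟩ := sq_facts h.hn
  have r0 : 0 < √(n:ℝ) := by linarith
  have big := h.S_big
  have m := h.mass
  have lo := h.lo
  have fa : 0 < f n 0 a := f_pos h.n0 h.mem
  have fS : f n 0 a = S n a := by simp [f]
  set A := ∫ t in (a*0.91)..(a*1.07), f n 0 t
  rw [← fS] at big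
  set s := f n 0 a
  set E := exp (0.1575*n)
  have E0 : 0 < E := exp_pos _
  have rn : √(n:ℝ) ≤ n := by nlinarith
  have m2 : 1.555*s ≤ n^2*A := by
    have : n^2*(0.627/n*(a*s)) ≤ n^2*A := by
      gcongr
      refine le_trans ?_ m
      gcongr
    refine le_trans ?_ this
    have e1 : n^2*(0.627/n*(a*s)) = 0.627*(n*a)*s := by field_simp
    rw [e1]
    gcongr
    linarith
  have e2 : n^2*(n^2*E) ≤ n^2*(0.0386*A) := by
    have : n^2*(n^2*E) = n^4*E := by ring
    rw [this]; linarith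
  have e3 : n^2*E ≤ 0.0386*A := le_of_mul_le_mul_left e2 (by positivity)
  have e4 : 901*(n*E) ≤ n^2*E := by
    have : n^2*E = n*(n*E) := by ring
    rw [this]; gcongr
  have nE : 0 < n*E := by positivity
  have e5 : 0.05/n*A = 0.05*A/n := by ring
  rw [e5, lt_div_iff₀ n0]
  linarith

lemma cc_low (h : Rt n 0 0 a) {x : ℝ} (hx : |x - π/(2*a)| ≤ 1) :
    (1-0.6/n)*(∫ t in (a*0.91)..(a*1.07), f n 0 t) - 1.571*exp (0.1575*n) ≤ CC n x := by
  have R := h.R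
  have n0 : (0:ℝ) < n := by linarith
  have a0 := h.pos
  have sm := h.small
  have hp := pi_gt_d4
  have x0 : 0 ≤ x := by
    have : 1 ≤ π/(2*a) := by rw [le_div_iff₀ (by positivity)]; linarith
    have := (abs_le.1 hx).1
    linarith
  have xn : x ≤ n := by
    have := h.inv_bd
    have := (abs_le.1 hx).2
    linarith
  have w := h.win_low hx x0
  have mi := (abs_le.1 (minor_int h.hn (g := fun t => sin (x*t)) (by fun_prop) (fun t => abs_sin_le_one _))).1
  have cf := f_cont n 0
  have sp := split3 (g := fun t => f n 0 t*sin (x*t)) (by fun_prop) (a*0.91) (a*1.07) (π/n)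
  have fe : ∀ t, f n 0 t = S n t := fun t => by simp [f]
  have e0 : ∫ t in (0:ℝ)..(π/n), S n t*sin (x*t) = ∫ t in (0:ℝ)..(π/n), f n 0 t*sin (x*t) := by simp only [fe]
  have z1 := h.mz (z := 0.91) le_rfl (by norm_num)
  have z2 := h.mz (z := 1.07) (by norm_num) le_rfl
  have nn : ∀ t ∈ Icc 0 (π/n), 0 ≤ f n 0 t*sin (x*t) := by
    intro t ht
    refine mul_nonneg (f_nonneg h.n0 ht) (sin_nonneg_of_nonneg_of_le_pi (mul_nonneg x0 ht.1) ?_)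
    have h2 := (le_div_iff₀ n0).1 ht.2
    have := mul_le_mul_of_nonneg_right xn ht.1
    linarith
  have p1 : 0 ≤ ∫ t in (0:ℝ)..(a*0.91), f n 0 t*sin (x*t) :=
    intervalIntegral.integral_nonneg z1.1.le fun t ht => nn t ⟨ht.1, ht.2.trans z1.2.le⟩
  have p2 : 0 ≤ ∫ t in (a*1.07)..(π/n), f n 0 t*sin (x*t) :=
    intervalIntegral.integral_nonneg z2.2.le fun t ht => nn t ⟨z2.1.le.trans ht.1, ht.2⟩
  unfold CC
  rw [e0, sp] at mi
  linarith

lemma cc_up (h : Rt n 0 0 a) {x σ : ℝ} (hσ : σ = 1 ∨ σ = -1) (hx : 1.3*n ≤ x) :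
    σ*CC n x ≤ (1-0.65/n)*(∫ t in (a*0.91)..(a*1.07), f n 0 t) + 1.571*exp (0.1575*n) := by
  have R := h.R
  have n0 : (0:ℝ) < n := by linarith
  have s1 : |σ| = 1 := by rcases hσ with rfl | rfl <;> simp
  have s2 : σ^2 = 1 := by rcases hσ with rfl | rfl <;> norm_num
  have hb : ∀ t, |σ*sin (x*t)| ≤ 1 := fun t => by
    rw [abs_mul, s1, one_mul]; exact abs_sin_le_one _
  have w := h.win_up s2 hx
  have mi := (abs_le.1 (minor_int h.hn (g := fun t => σ*sin (x*t)) (by fun_prop) hb)).2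
  have cf := f_cont n 0
  have sp := split3 (g := fun t => f n 0 t*(σ*sin (x*t))) (by fun_prop) (a*0.91) (a*1.07) (π/n)
  have fe : ∀ t, f n 0 t = S n t := fun t => by simp [f]
  have e0 : ∫ t in (0:ℝ)..(π/n), S n t*(σ*sin (x*t)) = ∫ t in (0:ℝ)..(π/n), f n 0 t*(σ*sin (x*t)) := by simp only [fe]
  have z1 := h.mz (z := 0.91) le_rfl (by norm_num)
  have z2 := h.mz (z := 1.07) (by norm_num) le_rfl
  have nn : ∀ t ∈ Icc 0 (π/n), f n 0 t*(σ*sin (x*t)) ≤ f n 0 t := by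
    intro t ht
    exact mul_le_of_le_one_right (f_nonneg h.n0 ht) (abs_le.1 (hb t)).2
  have p1 : ∫ t in (0:ℝ)..(a*0.91), f n 0 t*(σ*sin (x*t)) ≤ ∫ t in (0:ℝ)..(a*0.91), f n 0 t :=
    intervalIntegral.integral_mono_on z1.1.le (Continuous.intervalIntegrable (by fun_prop) _ _) (cf.intervalIntegrable _ _) fun t ht => nn t ⟨ht.1, ht.2.trans z1.2.le⟩
  have p2 : ∫ t in (a*1.07)..(π/n), f n 0 t*(σ*sin (x*t)) ≤ ∫ t in (a*1.07)..(π/n), f n 0 t :=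
    intervalIntegral.integral_mono_on z2.2.le (Continuous.intervalIntegrable (by fun_prop) _ _) (cf.intervalIntegrable _ _) fun t ht => nn t ⟨z2.1.le.trans ht.1, ht.2⟩
  have ta := h.tails
  have e1 : σ*CC n x = ∫ t in (0:ℝ)..(π/2), S n t*(σ*sin (x*t)) := by
    unfold CC
    rw [← intervalIntegral.integral_const_mul]
    congr 1; ext t; ring
  rw [e1]
  rw [e0, sp] at mi
  have e2 : (1-0.65/(n:ℝ)) = (1-0.9/n)+0.25/n := by ring
  rw [e2, add_mul]
  linarith

lemma h3_main (hn : 901 ≤ n) : ∃ j : ℕ, ∀ x : ℝ, 1.3 * n ≤ x → |CC n x| < CC n ((NN n : ℝ) - 2 * j) := by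
  obtain ⟨a, h⟩ := exists_root n 0 hn (by norm_num) 0 le_rfl (by norm_num)
  have R := h.R
  have n0 : (0:ℝ) < n := by linarith
  have ib := h.inv_bd
  have W : (n:ℝ) ≤ NN n := by
    have : n ≤ NN n := by
      unfold NN
      rw [Nat.le_div_iff_mul_le (by norm_num)]
      nlinarith
    exact_mod_cast this
  set y := π/(2*a) with hy
  have w0 : 0 ≤ ((NN n : ℝ) - y + 1)/2 := by linarith
  refine ⟨⌊((NN n : ℝ) - y + 1)/2⌋₊, fun x hx => ?_⟩
  have j1 := Nat.floor_le w0
  have j2 := Nat.lt_floor_add_one (((NN n : ℝ) - y + 1)/2)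
  set j : ℝ := (⌊((NN n : ℝ) - y + 1)/2⌋₊ : ℝ)
  have lw := cc_low h (x := (NN n : ℝ) - 2*j) (by rw [abs_le]; constructor <;> linarith)
  have u1 := cc_up h (Or.inl rfl) hx
  have u2 := cc_up h (Or.inr rfl) hx
  have eA := h.exp_A
  set A := ∫ t in (a*0.91)..(a*1.07), f n 0 t
  have e2 : (1-0.6/(n:ℝ))*A = (1-0.65/n)*A+0.05/n*A := by ring
  rw [abs_lt]
  constructor <;> linarith

lemma Rt.exp_B {v : ℝ} (h : Rt n 1 v a) : 1.571*exp (0.1575*n) < 0.018/(n*√n)*(a*f n 1 a) := by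
  have R := h.R
  have n0 : (0:ℝ) < n := by linarith
  have a0 := h.pos
  have sm := h.small
  obtain ⟨r1, r2, r3⟩ := sq_facts h.hn
  have r0 : 0 < √(n:ℝ) := by linarith
  have big := h.S_big
  have lo := h.lo
  have s0 : 0 < S n a := S_pos h.mem
  have fS : f n 1 a = S n a*sin a := by simp [f]
  have sa : 0.5*a ≤ sin a := by
    have := sin_gt_sub_cube a0
    have : a^3 ≤ a := by
      have : a^3 = a*(a*a) := by ring
      rw [this]; exact mul_le_of_le_one_right a0.le (by nlinarith)
    linarith
  rw [fS]
  set s := S n a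
  set E := exp (0.1575*n)
  have E0 : 0 < E := exp_pos _
  have rn : √(n:ℝ) ≤ n/30 := by nlinarith
  have k : 0.018/(n*(n/30))*(a*(s*(0.5*a))) ≤ 0.018/(n*√n)*(a*(s*sin a)) := by gcongr
  refine lt_of_lt_of_le ?_ k
  have e1 : 0.018/(n*(n/30))*(a*(s*(0.5*a))) = 0.27*(n*a)^2*s/n^4 := by field_simp; ring
  rw [e1, lt_div_iff₀ (by positivity)]
  have : 0.27*2.481^2*s ≤ 0.27*(n*a)^2*s := by gcongr
  norm_num at *
  linarith

lemma GG_near (hn : 901 ≤ n) (y : ℝ) : |GG n y - ∫ t in (0:ℝ)..(π/n), f n 1 t*cos (y*t)| ≤ 1.571*exp (0.1575*n) := by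
  have := minor_int hn (g := fun t => sin t*cos (y*t)) (by fun_prop) (fun t => by
    rw [abs_mul]
    exact mul_le_one₀ (abs_sin_le_one _) (abs_nonneg _) (abs_cos_le_one _))
  have e1 : GG n y = ∫ t in (0:ℝ)..(π/2), S n t*(sin t*cos (y*t)) := by
    unfold GG; congr 1; ext t; ring
  have e2 : ∫ t in (0:ℝ)..(π/n), f n 1 t*cos (y*t) = ∫ t in (0:ℝ)..(π/n), S n t*(sin t*cos (y*t)) := by
    congr 1; ext t; simp only [f, pow_one]; ring
  rw [e1, e2]; exact this

lemma located (hn : 901 ≤ n) (ho : Odd n) {a0 a2 : ℝ} (h0 : Rt n 1 0 a0) (h2 : Rt n 1 2 a2) :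
    π/(2*a0) - 0.05 - 1 < (NN n : ℝ) - 2 * L n ∧ (NN n : ℝ) - 2 * L n ≤ π/(2*a2) + 0.05 + 1 := by
  have R := h0.R
  refine locate n ho (by omega) _ _ ?_ ?_ ?_ (h3_main hn)
  · have := h0.inv_bd
    linarith
  · intro y y0 y1
    have m := main_pos h0 y0 y1
    have b := h0.exp_B
    have g := (abs_le.1 (GG_near hn y)).1
    have fa : 0 < f n 1 a0 := f_pos h0.n0 h0.mem
    have ap := h0.pos
    have : 0.018/(n*√n)*(a0*f n 1 a0) ≤ 0.036/(n*√n)*(a0*f n 1 a0) := by gcongr; norm_num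
    linarith
  · intro y y0 y1
    have m := main_neg h2 y0 y1
    have b := h2.exp_B
    have g := (abs_le.1 (GG_near hn y)).2
    linarith

lemma NN_two (n : ℕ) : 2*NN n = n*(n+1) := by
  unfold NN
  exact Nat.mul_div_cancel' (Nat.even_mul_succ_self n).two_dvd

theorem large (n : ℕ) (ho : Odd n) (hn : 905 ≤ n) :
    (2 * (n : ℤ) - 3 + (L (n - 4) : ℤ) - (L n : ℤ)) = 1 ∨ (2 * (n : ℤ) - 3 + (L (n - 4) : ℤ) - (L n : ℤ)) = 2 := by
  obtain ⟨m, rfl⟩ : ∃ m, n = m+4 := ⟨n-4, by omega⟩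
  have hm : 901 ≤ m := by omega
  have hm4 : 901 ≤ m+4 := by omega
  have om : Odd m := by
    rcases ho with ⟨k, hk⟩
    exact ⟨k-2, by omega⟩
  obtain ⟨a0, A0⟩ := exists_root m 1 hm le_rfl 0 le_rfl (by norm_num)
  obtain ⟨a2, A2⟩ := exists_root m 1 hm le_rfl 2 (by norm_num) (by norm_num)
  obtain ⟨b0, B0⟩ := exists_root (m+4) 1 hm4 le_rfl 0 le_rfl (by norm_num)
  obtain ⟨b2, B2⟩ := exists_root (m+4) 1 hm4 le_rfl 2 (by norm_num) (by norm_num)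
  have l1 := located hm om A0 A2
  have l2 := located hm4 ho B0 B2
  have g1 := gap_lo A2 B0
  have g2 := gap_hi A0 B2
  have N1 : (NN (m+4) : ℤ) = NN m + 4*m + 10 := by
    have e1 := NN_two m
    have e2 := NN_two (m+4)
    have : NN (m+4) = NN m + 4*m + 10 := by
      have e3 : (m+4)*(m+4+1) = m*(m+1)+8*m+20 := by ring
      rw [e3] at e2
      omega
    rw [this]; push_cast; ring
  have N2 : (NN (m+4) : ℝ) = NN m + 4*m + 10 := by exact_mod_cast N1
  rw [Nat.add_sub_cancel]
  rw [N2] at l2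
  have k1 : (0:ℝ) < 4*m+10 - 2*L (m+4) + 2*L m := by linarith [l1.2, l2.1]
  have k2 : (4*m+10 - 2*L (m+4) + 2*L m : ℝ) < 6 := by linarith [l1.1, l2.2]
  have k1' : (0:ℤ) < 4*m+10 - 2*L (m+4) + 2*L m := by exact_mod_cast k1
  have k2' : (4*m+10 - 2*L (m+4) + 2*L m : ℤ) < 6 := by exact_mod_cast k2
  push_cast
  omega
end
end QP
end

section
/-! ## Part F : the certified table for small `n` -/
namespace QP

lemma GoodL.app : ∀ {xs ys : List ℕ} {n m : ℕ}, GoodL xs n → m = n + 2 * xs.length → GoodL ys m → GoodL (xs ++ ys) n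
  | [], ys, n, m, _, h, hy => by
    have : m = n := by simpa using h
    rw [this] at hy; exact hy
  | x :: xs, ys, n, m, hx, h, hy => by
    refine ⟨hx.1, GoodL.app hx.2 ?_ hy⟩
    rw [h, List.length_cons]; ring

lemma GoodL.get : ∀ {xs : List ℕ} {n : ℕ}, GoodL xs n → ∀ i, i < xs.length →
    2 * L (n + 2 * i + 2) + xs.getD i 0 = NN (n + 2 * i + 2)
  | [], n, _, i, hi => by simp at hi
  | x :: xs, n, h, 0, _ => by simpa using h.1
  | x :: xs, n, h, i + 1, hi => by
    have := GoodL.get h.2 i (by simpa using hi)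
    rw [show n + 2 * (i + 1) + 2 = n + 2 + 2 * i + 2 by ring]
    simpa using this

lemma step {B e0 e n m : ℕ} {xs : List ℕ} (h : block B e0 e n xs = true)
    (h0 : ∀ i, (a n i).natAbs ≤ 2 ^ e0) (hm : m = n + 2 * xs.length) :
    GoodL xs n ∧ ∀ i, (a m i).natAbs ≤ 2 ^ e := by
  rw [hm]; exact block_sound h h0

/-- values of `NN n - 2 L n` for odd `n` from 3 to 81 -/
def tab1 : List ℕ :=
  [6, 15, 4, 21, 36, 9, 8, 9, 10, 45, 16, 13, 20, 21, 16, 21, 24, 25, 24, 25, 28, 29, 30, 33, 32, 33, 36, 37, 36, 39, 40, 41, 44, 45, 46, 47, 48, 49, 50, 51]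

/-- values of `NN n - 2 L n` for odd `n` from 83 to 161 -/
def tab2 : List ℕ :=
  [52, 55, 56, 57, 58, 59, 60, 61, 64, 65, 66, 67, 68, 69, 70, 71, 74, 75, 76, 77, 78, 79, 80, 81, 84, 85, 86, 87, 88, 89, 90, 93, 94, 95, 96, 97, 98, 99, 100, 103]

/-- values of `NN n - 2 L n` for odd `n` from 163 to 241 -/
def tab3 : List ℕ :=
  [104, 105, 106, 107, 108, 109, 112, 113, 114, 115, 116, 117, 118, 119, 122, 123, 124, 125, 126, 127, 128, 129, 132, 133, 134, 135, 136, 137, 138, 141, 142, 143, 144, 145, 146, 147, 148, 151, 152, 153]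

/-- values of `NN n - 2 L n` for odd `n` from 243 to 291 -/
def tab4 : List ℕ :=
  [154, 155, 156, 157, 160, 161, 162, 163, 164, 165, 166, 167, 170, 171, 172, 173, 174, 175, 176, 179, 180, 181, 182, 183, 184]

/-- values of `NN n - 2 L n` for odd `n` from 293 to 341 -/
def tab5 : List ℕ :=
  [185, 186, 189, 190, 191, 192, 193, 194, 195, 196, 199, 200, 201, 202, 203, 204, 205, 208, 209, 210, 211, 212, 213, 214, 215]

/-- values of `NN n - 2 L n` for odd `n` from 343 to 391 -/
def tab6 : List ℕ :=
  [218, 219, 220, 221, 222, 223, 224, 227, 228, 229, 230, 231, 232, 233, 234, 237, 238, 239, 240, 241, 242, 243, 244, 247, 248]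

/-- values of `NN n - 2 L n` for odd `n` from 393 to 421 -/
def tab7 : List ℕ :=
  [249, 250, 251, 252, 253, 256, 257, 258, 259, 260, 261, 262, 263, 266, 267]

/-- values of `NN n - 2 L n` for odd `n` from 423 to 451 -/
def tab8 : List ℕ :=
  [268, 269, 270, 271, 272, 275, 276, 277, 278, 279, 280, 281, 282, 285, 286]

/-- values of `NN n - 2 L n` for odd `n` from 453 to 481 -/
def tab9 : List ℕ :=
  [287, 288, 289, 290, 291, 294, 295, 296, 297, 298, 299, 300, 301, 304, 305]

/-- values of `NN n - 2 L n` for odd `n` from 483 to 511 -/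
def tab10 : List ℕ :=
  [306, 307, 308, 309, 310, 311, 314, 315, 316, 317, 318, 319, 320, 323, 324]

/-- values of `NN n - 2 L n` for odd `n` from 513 to 531 -/
def tab11 : List ℕ :=
  [325, 326, 327, 328, 329, 330, 333, 334, 335, 336]

/-- values of `NN n - 2 L n` for odd `n` from 533 to 551 -/
def tab12 : List ℕ :=
  [337, 338, 339, 342, 343, 344, 345, 346, 347, 348]

/-- values of `NN n - 2 L n` for odd `n` from 553 to 571 -/
def tab13 : List ℕ :=
  [349, 352, 353, 354, 355, 356, 357, 358, 359, 362]

/-- values of `NN n - 2 L n` for odd `n` from 573 to 591 -/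
def tab14 : List ℕ :=
  [363, 364, 365, 366, 367, 368, 371, 372, 373, 374]

/-- values of `NN n - 2 L n` for odd `n` from 593 to 611 -/
def tab15 : List ℕ :=
  [375, 376, 377, 378, 381, 382, 383, 384, 385, 386]

/-- values of `NN n - 2 L n` for odd `n` from 613 to 631 -/
def tab16 : List ℕ :=
  [387, 390, 391, 392, 393, 394, 395, 396, 397, 400]

/-- values of `NN n - 2 L n` for odd `n` from 633 to 651 -/
def tab17 : List ℕ :=
  [401, 402, 403, 404, 405, 406, 409, 410, 411, 412]

/-- values of `NN n - 2 L n` for odd `n` from 653 to 667 -/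
def tab18 : List ℕ :=
  [413, 414, 415, 416, 419, 420, 421, 422]

/-- values of `NN n - 2 L n` for odd `n` from 669 to 683 -/
def tab19 : List ℕ :=
  [423, 424, 425, 426, 429, 430, 431, 432]

/-- values of `NN n - 2 L n` for odd `n` from 685 to 699 -/
def tab20 : List ℕ :=
  [433, 434, 435, 438, 439, 440, 441, 442]

/-- values of `NN n - 2 L n` for odd `n` from 701 to 715 -/
def tab21 : List ℕ :=
  [443, 444, 445, 448, 449, 450, 451, 452]

/-- values of `NN n - 2 L n` for odd `n` from 717 to 731 -/
def tab22 : List ℕ :=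
  [453, 454, 457, 458, 459, 460, 461, 462]

/-- values of `NN n - 2 L n` for odd `n` from 733 to 747 -/
def tab23 : List ℕ :=
  [463, 464, 467, 468, 469, 470, 471, 472]

/-- values of `NN n - 2 L n` for odd `n` from 749 to 763 -/
def tab24 : List ℕ :=
  [473, 476, 477, 478, 479, 480, 481, 482]

/-- values of `NN n - 2 L n` for odd `n` from 765 to 779 -/
def tab25 : List ℕ :=
  [483, 486, 487, 488, 489, 490, 491, 492]

/-- values of `NN n - 2 L n` for odd `n` from 781 to 791 -/
def tab26 : List ℕ :=
  [493, 496, 497, 498, 499, 500]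

/-- values of `NN n - 2 L n` for odd `n` from 793 to 803 -/
def tab27 : List ℕ :=
  [501, 502, 505, 506, 507, 508]

/-- values of `NN n - 2 L n` for odd `n` from 805 to 815 -/
def tab28 : List ℕ :=
  [509, 510, 511, 512, 515, 516]

/-- values of `NN n - 2 L n` for odd `n` from 817 to 827 -/
def tab29 : List ℕ :=
  [517, 518, 519, 520, 521, 524]

/-- values of `NN n - 2 L n` for odd `n` from 829 to 839 -/
def tab30 : List ℕ :=
  [525, 526, 527, 528, 529, 530]

/-- values of `NN n - 2 L n` for odd `n` from 841 to 851 -/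
def tab31 : List ℕ :=
  [531, 534, 535, 536, 537, 538]

/-- values of `NN n - 2 L n` for odd `n` from 853 to 863 -/
def tab32 : List ℕ :=
  [539, 540, 541, 544, 545, 546]

/-- values of `NN n - 2 L n` for odd `n` from 865 to 875 -/
def tab33 : List ℕ :=
  [547, 548, 549, 550, 553, 554]

/-- values of `NN n - 2 L n` for odd `n` from 877 to 887 -/
def tab34 : List ℕ :=
  [555, 556, 557, 558, 559, 560]

/-- values of `NN n - 2 L n` for odd `n` from 889 to 899 -/
def tab35 : List ℕ :=
  [563, 564, 565, 566, 567, 568]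

/-- values of `NN n - 2 L n` for odd `n` from 901 to 903 -/
def tab36 : List ℕ :=
  [569, 572]

/-- the whole table -/
def tab : List ℕ := tab1 ++ (tab2 ++ (tab3 ++ (tab4 ++ (tab5 ++ (tab6 ++ (tab7 ++ (tab8 ++ (tab9 ++ (tab10 ++ (tab11 ++ (tab12 ++ (tab13 ++ (tab14 ++ (tab15 ++ (tab16 ++ (tab17 ++ (tab18 ++ (tab19 ++ (tab20 ++ (tab21 ++ (tab22 ++ (tab23 ++ (tab24 ++ (tab25 ++ (tab26 ++ (tab27 ++ (tab28 ++ (tab29 ++ (tab30 ++ (tab31 ++ (tab32 ++ (tab33 ++ (tab34 ++ (tab35 ++ (tab36)))))))))))))))))))))))))))))))))))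

lemma a_one_le (i : ℕ) : (a 1 i).natAbs ≤ 2 ^ 0 := by
  have : a 1 i = (1 - (Polynomial.X : Polynomial ℤ) ^ 1).coeff i := by simp [a]
  rw [this, Polynomial.coeff_sub, Polynomial.coeff_X_pow, Polynomial.coeff_one]
  split_ifs <;> simp_all

theorem tab_good : GoodL tab 1 := by
  have c0 := a_one_le
  have b1 : block 22 0 19 1 tab1 = true := by decide +kernel
  obtain ⟨g1, c1⟩ := step (m := 81) b1 c0 rfl
  have b2 : block 44 19 41 81 tab2 = true := by decide +kernel
  obtain ⟨g2, c2⟩ := step (m := 161) b2 c1 rfl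
  have b3 : block 66 41 63 161 tab3 = true := by decide +kernel
  obtain ⟨g3, c3⟩ := step (m := 241) b3 c2 rfl
  have b4 : block 80 63 77 241 tab4 = true := by decide +kernel
  obtain ⟨g4, c4⟩ := step (m := 291) b4 c3 rfl
  have b5 : block 94 77 91 291 tab5 = true := by decide +kernel
  obtain ⟨g5, c5⟩ := step (m := 341) b5 c4 rfl
  have b6 : block 108 91 105 341 tab6 = true := by decide +kernel
  obtain ⟨g6, c6⟩ := step (m := 391) b6 c5 rfl
  have b7 : block 117 105 114 391 tab7 = true := by decide +kernel
  obtain ⟨g7, c7⟩ := step (m := 421) b7 c6 rfl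
  have b8 : block 125 114 122 421 tab8 = true := by decide +kernel
  obtain ⟨g8, c8⟩ := step (m := 451) b8 c7 rfl
  have b9 : block 134 122 131 451 tab9 = true := by decide +kernel
  obtain ⟨g9, c9⟩ := step (m := 481) b9 c8 rfl
  have b10 : block 142 131 139 481 tab10 = true := by decide +kernel
  obtain ⟨g10, c10⟩ := step (m := 511) b10 c9 rfl
  have b11 : block 148 139 145 511 tab11 = true := by decide +kernel
  obtain ⟨g11, c11⟩ := step (m := 531) b11 c10 rfl
  have b12 : block 154 145 151 531 tab12 = true := by decide +kernel
  obtain ⟨g12, c12⟩ := step (m := 551) b12 c11 rfl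
  have b13 : block 159 151 156 551 tab13 = true := by decide +kernel
  obtain ⟨g13, c13⟩ := step (m := 571) b13 c12 rfl
  have b14 : block 165 156 162 571 tab14 = true := by decide +kernel
  obtain ⟨g14, c14⟩ := step (m := 591) b14 c13 rfl
  have b15 : block 171 162 168 591 tab15 = true := by decide +kernel
  obtain ⟨g15, c15⟩ := step (m := 611) b15 c14 rfl
  have b16 : block 176 168 173 611 tab16 = true := by decide +kernel
  obtain ⟨g16, c16⟩ := step (m := 631) b16 c15 rfl
  have b17 : block 182 173 179 631 tab17 = true := by decide +kernel
  obtain ⟨g17, c17⟩ := step (m := 651) b17 c16 rfl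
  have b18 : block 187 179 184 651 tab18 = true := by decide +kernel
  obtain ⟨g18, c18⟩ := step (m := 667) b18 c17 rfl
  have b19 : block 191 184 188 667 tab19 = true := by decide +kernel
  obtain ⟨g19, c19⟩ := step (m := 683) b19 c18 rfl
  have b20 : block 196 188 193 683 tab20 = true := by decide +kernel
  obtain ⟨g20, c20⟩ := step (m := 699) b20 c19 rfl
  have b21 : block 200 193 197 699 tab21 = true := by decide +kernel
  obtain ⟨g21, c21⟩ := step (m := 715) b21 c20 rfl
  have b22 : block 205 197 202 715 tab22 = true := by decide +kernel
  obtain ⟨g22, c22⟩ := step (m := 731) b22 c21 rfl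
  have b23 : block 209 202 206 731 tab23 = true := by decide +kernel
  obtain ⟨g23, c23⟩ := step (m := 747) b23 c22 rfl
  have b24 : block 214 206 211 747 tab24 = true := by decide +kernel
  obtain ⟨g24, c24⟩ := step (m := 763) b24 c23 rfl
  have b25 : block 218 211 216 763 tab25 = true := by decide +kernel
  obtain ⟨g25, c25⟩ := step (m := 779) b25 c24 rfl
  have b26 : block 222 216 219 779 tab26 = true := by decide +kernel
  obtain ⟨g26, c26⟩ := step (m := 791) b26 c25 rfl
  have b27 : block 225 219 222 791 tab27 = true := by decide +kernel
  obtain ⟨g27, c27⟩ := step (m := 803) b27 c26 rfl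
  have b28 : block 229 222 226 803 tab28 = true := by decide +kernel
  obtain ⟨g28, c28⟩ := step (m := 815) b28 c27 rfl
  have b29 : block 232 226 229 815 tab29 = true := by decide +kernel
  obtain ⟨g29, c29⟩ := step (m := 827) b29 c28 rfl
  have b30 : block 236 229 233 827 tab30 = true := by decide +kernel
  obtain ⟨g30, c30⟩ := step (m := 839) b30 c29 rfl
  have b31 : block 239 233 236 839 tab31 = true := by decide +kernel
  obtain ⟨g31, c31⟩ := step (m := 851) b31 c30 rfl
  have b32 : block 242 236 239 851 tab32 = true := by decide +kernel
  obtain ⟨g32, c32⟩ := step (m := 863) b32 c31 rfl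
  have b33 : block 246 239 243 863 tab33 = true := by decide +kernel
  obtain ⟨g33, c33⟩ := step (m := 875) b33 c32 rfl
  have b34 : block 249 243 246 875 tab34 = true := by decide +kernel
  obtain ⟨g34, c34⟩ := step (m := 887) b34 c33 rfl
  have b35 : block 253 246 250 887 tab35 = true := by decide +kernel
  obtain ⟨g35, c35⟩ := step (m := 899) b35 c34 rfl
  have b36 : block 254 250 251 899 tab36 = true := by decide +kernel
  obtain ⟨g36, c36⟩ := step (m := 903) b36 c35 rfl
  exact g1.app rfl (g2.app rfl (g3.app rfl (g4.app rfl (g5.app rfl (g6.app rfl (g7.app rfl (g8.app rfl (g9.app rfl (g10.app rfl (g11.app rfl (g12.app rfl (g13.app rfl (g14.app rfl (g15.app rfl (g16.app rfl (g17.app rfl (g18.app rfl (g19.app rfl (g20.app rfl (g21.app rfl (g22.app rfl (g23.app rfl (g24.app rfl (g25.app rfl (g26.app rfl (g27.app rfl (g28.app rfl (g29.app rfl (g30.app rfl (g31.app rfl (g32.app rfl (g33.app rfl (g34.app rfl (g35.app rfl (g36)))))))))))))))))))))))))))))))))))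

theorem tab_diff : ∀ i < 422, tab.getD (i + 29) 0 = tab.getD (i + 27) 0 + 2 ∨ tab.getD (i + 29) 0 = tab.getD (i + 27) 0 + 4 := by
  decide +kernel

theorem small (n : ℕ) (ho : Odd n) (h1 : 61 ≤ n) (h2 : n < 905) :
    (2 * (n : ℤ) - 3 + (L (n - 4) : ℤ) - (L n : ℤ)) = 1 ∨ (2 * (n : ℤ) - 3 + (L (n - 4) : ℤ) - (L n : ℤ)) = 2 := by
  obtain ⟨i, rfl, hi⟩ : ∃ i, n = 1 + 2 * (i + 29) + 2 ∧ i < 422 := by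
    obtain ⟨k, hk⟩ := ho
    exact ⟨k - 30, by omega, by omega⟩
  have len : tab.length = 451 := by decide +kernel
  have p := tab_good.get (i + 29) (by omega)
  have q := tab_good.get (i + 27) (by omega)
  have d := tab_diff i hi
  have N := NN_two (1 + 2 * (i + 29) + 2)
  have N' := NN_two (1 + 2 * (i + 27) + 2)
  have e : (1 + 2 * (i + 29) + 2) * (1 + 2 * (i + 29) + 2 + 1) = (1 + 2 * (i + 27) + 2) * (1 + 2 * (i + 27) + 2 + 1) + 16 * i + 476 := by ring
  rw [e, ← N'] at N
  rw [show 1 + 2 * (i + 29) + 2 - 4 = 1 + 2 * (i + 27) + 2 by omega]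
  push_cast
  generalize L (1 + 2 * (i + 29) + 2) = l1 at *
  generalize L (1 + 2 * (i + 27) + 2) = l2 at *
  omega

end QP
end

/-- For odd `n` with `61 ≤ n ≤ 75000`, `E n = (2n - 3) + L(n-4) - L(n) ∈ {1, 2}`. -/
theorem stmt_13 (n : ℕ) (hodd : Odd n) (h1 : 61 ≤ n) (h2 : n ≤ 75000) :
    (2 * (n : ℤ) - 3 + (L (n - 4) : ℤ) - (L n : ℤ)) ∈ ({1, 2} : Set ℤ) := by
  rw [Set.mem_insert_iff, Set.mem_singleton_iff]
  rcases lt_or_ge n 905 with h | h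
  · exact QP.small n hodd h1 h
  · exact QP.large n hodd h
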